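/- arXiv:2009.05278 — 5 statements merged into one kernel-verified Lean document; each statement's English description precedes it below -/
import Mathlib

section
/- For every prime number ℓ and every integer n ≥ 1, ℓ does not divide the class number of ℚ(ℓ^n), the n-th layer of the cyclotomic ℤ_ℓ-extension of ℚ. -/
open NumberField

section

open scoped nonZeroDivisors Pointwise

theorem ClassGroup.mk0_smul_eq_mk0_smul {R : Type*} [CommRing R] [IsDedekindDomain R] {G : Type*}
    [Group G] [MulSemiringAction G R] (g : G) {I J I' J' : (Ideal R)⁰}
    (hI : (I' : Ideal R) = g • (I : Ideal R)) (hJ : (J' : Ideal R) = g • (J : Ideal R))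
    (h : ClassGroup.mk0 I = ClassGroup.mk0 J) : ClassGroup.mk0 I' = ClassGroup.mk0 J' := by
  obtain ⟨x, y, hx, hy, hxy⟩ := ClassGroup.mk0_eq_mk0_iff.mp h
  refine ClassGroup.mk0_eq_mk0_iff.mpr ⟨g • x, g • y, (smul_ne_zero_iff_ne g).mpr hx,
    (smul_ne_zero_iff_ne g).mpr hy, ?_⟩
  rw [hI, hJ]
  simpa only [smul_mul', Ideal.smul_closure, Set.smul_set_singleton] using congrArg (g • ·) hxy

/-- The translate of a nonzero ideal by an element of a group acting on the ring. -/
noncomputable def Ideal.smulNonZeroDivisors {R : Type*} [CommRing R] [IsDomain R] {G : Type*}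
    [Group G] [MulSemiringAction G R] (g : G) (I : (Ideal R)⁰) : (Ideal R)⁰ :=
  ⟨g • (I : Ideal R),
    mem_nonZeroDivisors_of_ne_zero ((smul_ne_zero_iff_ne g).mpr (nonZeroDivisors.ne_zero I.2))⟩

/-- The map on ideal classes induced by an element of a group acting on the ring. -/
noncomputable def ClassGroup.smulMap {R : Type*} [CommRing R] [IsDedekindDomain R] {G : Type*}
    [Group G] [MulSemiringAction G R] (g : G) (c : ClassGroup R) : ClassGroup R :=
  ClassGroup.mk0 (Ideal.smulNonZeroDivisors g (ClassGroup.mk0_surjective c).choose)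

theorem ClassGroup.smulMap_mk0 {R : Type*} [CommRing R] [IsDedekindDomain R] {G : Type*}
    [Group G] [MulSemiringAction G R] (g : G) (I : (Ideal R)⁰) :
    ClassGroup.smulMap g (ClassGroup.mk0 I) = ClassGroup.mk0 (Ideal.smulNonZeroDivisors g I) :=
  ClassGroup.mk0_smul_eq_mk0_smul g rfl rfl
    (ClassGroup.mk0_surjective (ClassGroup.mk0 I)).choose_spec

/-- The action on the class group induced by an action on the ring. -/
noncomputable abbrev ClassGroup.mulAction (R : Type*) [CommRing R] [IsDedekindDomain R]
    (G : Type*) [Group G] [MulSemiringAction G R] : MulAction G (ClassGroup R) where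
  smul := ClassGroup.smulMap
  one_smul c := by
    obtain ⟨I, rfl⟩ := ClassGroup.mk0_surjective c
    change ClassGroup.smulMap 1 _ = _
    rw [ClassGroup.smulMap_mk0]
    exact congrArg _ (Subtype.ext (one_smul G (I : Ideal R)))
  mul_smul g h c := by
    obtain ⟨I, rfl⟩ := ClassGroup.mk0_surjective c
    change ClassGroup.smulMap (g * h) _ = ClassGroup.smulMap g (ClassGroup.smulMap h _)
    rw [ClassGroup.smulMap_mk0, ClassGroup.smulMap_mk0, ClassGroup.smulMap_mk0]
    exact congrArg _ (Subtype.ext (mul_smul g h (I : Ideal R)))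

/-- If every nonzero prime contains an element generating an invariant radical ideal whose prime
divisors are all conjugate to that prime, then all invariant ideals are principal. -/
theorem isPrincipal_of_forall_smul_eq {R : Type*} [CommRing R] [IsDedekindDomain R]
    {G : Type*} [Group G] [MulSemiringAction G R]
    (H : ∀ P : Ideal R, P.IsPrime → P ≠ ⊥ → ∃ a ∈ P, a ≠ 0 ∧
      (∀ g : G, g • Ideal.span {a} = Ideal.span {a}) ∧
      (Ideal.span {a}).IsRadical ∧ ∀ Q : Ideal R, Q.IsPrime → a ∈ Q → ∃ g : G, Q = g • P)
    (I : Ideal R) (hI : ∀ g : G, g • I = I) : Submodule.IsPrincipal I := by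
  induction I using WellFoundedGT.induction with
  | ind I ih =>
    by_cases h0 : I = ⊥
    · subst h0; infer_instance
    by_cases h1 : I = ⊤
    · subst h1; infer_instance
    obtain ⟨P, hP, hIP⟩ := Ideal.exists_le_maximal I h1
    have hPb : P ≠ ⊥ := fun h => h0 (le_bot_iff.mp (h ▸ hIP))
    obtain ⟨a, haP, ha0, hinv, hrad, hconj⟩ := H P hP.isPrime hPb
    have hIa : I ≤ Ideal.span {a} := by
      rw [← hrad.radical, Ideal.radical_eq_sInf]
      refine le_sInf ?_
      rintro Q ⟨hQ, hQp⟩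
      obtain ⟨g, rfl⟩ := hconj Q hQp (by simpa [Ideal.span_le] using hQ)
      rw [← hI g]
      exact Ideal.map_mono hIP
    obtain ⟨J, rfl⟩ := Ideal.dvd_iff_le.mpr hIa
    have hab : Ideal.span {a} ≠ ⊥ := by simpa using ha0
    have hlt : Ideal.span {a} * J < J := by
      refine lt_of_le_of_ne Ideal.mul_le_right fun h => ?_
      have : Ideal.span {a} = 1 := by
        refine mul_right_cancel₀ (b := J) ?_ (by rw [h, one_mul])
        rintro rfl
        simp at h0
      rw [Ideal.one_eq_top, Ideal.span_singleton_eq_top] at this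
      exact hP.ne_top (Ideal.eq_top_of_isUnit_mem _ haP this)
    have hJ := ih J hlt fun g => by
      refine mul_left_cancel₀ hab ?_
      have := hI g
      rwa [smul_mul', hinv g] at this
    obtain ⟨b, hb⟩ := hJ
    refine ⟨⟨a * b, ?_⟩⟩
    have hb' : J = Ideal.span {b} := hb
    rw [hb', Ideal.span_singleton_mul_span_singleton]

/-- In a cyclic extension of `ℚ` with principal invariant ideals and an element of norm `-1` in its
ring of integers, every invariant ideal class is trivial. -/
theorem ClassGroup.mk0_eq_one_of_smul_eq {K : Type} [Field K] [NumberField K] [IsGalois ℚ K]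
    (σ : Gal(K/ℚ)) (hσ : ∀ x, x ∈ Subgroup.zpowers σ) (u : 𝓞 K)
    (hu : Algebra.norm ℚ (u : K) = -1)
    (H : ∀ I : Ideal (𝓞 K), (∀ g : Gal(K/ℚ), g • I = I) → Submodule.IsPrincipal I)
    (I : (Ideal (𝓞 K))⁰)
    (hI : ClassGroup.mk0 (Ideal.smulNonZeroDivisors σ I) = ClassGroup.mk0 I) :
    ClassGroup.mk0 I = 1 := by
  obtain ⟨x, y, hx, hy, hxy⟩ := ClassGroup.mk0_eq_mk0_iff.mp hI
  have hI0 : (I : Ideal (𝓞 K)) ≠ 0 := nonZeroDivisors.ne_zero I.2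
  have hJ : (Ideal.smulNonZeroDivisors σ I : Ideal (𝓞 K)) = σ • (I : Ideal (𝓞 K)) := rfl
  have huu : IsUnit u := by
    rw [NumberField.isUnit_iff_norm, RingOfIntegers.coe_norm, hu]
    simp
  have hnorm : |Algebra.norm ℚ (x : K)| = |Algebra.norm ℚ (y : K)| := by
    have h1 := congrArg Ideal.absNorm hxy
    rw [map_mul, map_mul, hJ] at h1
    have h2 : Ideal.absNorm (σ • (I : Ideal (𝓞 K))) = Ideal.absNorm (I : Ideal (𝓞 K)) := by
      rw [Ideal.absNorm_apply, Ideal.absNorm_apply]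
      exact (Nat.card_congr (Ideal.quotientEquiv (I : Ideal (𝓞 K)) _
        (MulSemiringAction.toRingEquiv _ _ σ) rfl).toEquiv).symm
    rw [h2] at h1
    have h3 := Nat.eq_of_mul_eq_mul_right
      (Nat.pos_of_ne_zero (by simpa [Ideal.absNorm_eq_zero_iff] using hI0)) h1
    simp only [Ideal.absNorm_span_singleton] at h3
    rw [← Algebra.coe_norm_int, ← Algebra.coe_norm_int, ← Int.cast_abs, ← Int.cast_abs,
      Int.abs_eq_natAbs, Int.abs_eq_natAbs, h3]
  have hx' : (x : K) ≠ 0 := by simpa using hx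
  obtain ⟨z, hz, hzx⟩ : ∃ z : 𝓞 K, Ideal.span {z} = Ideal.span {y} ∧
      Algebra.norm ℚ ((z : K) / x) = 1 := by
    have hNx : Algebra.norm ℚ (x : K) ≠ 0 := by simpa using hx
    rcases abs_eq_abs.mp hnorm with h | h
    · exact ⟨y, rfl, by rw [div_eq_mul_inv, map_mul, Algebra.norm_inv, ← h, mul_inv_cancel₀ hNx]⟩
    · refine ⟨y * u, Ideal.span_singleton_mul_right_unit huu y, ?_⟩
      rw [div_eq_mul_inv, map_mul, Algebra.norm_inv,
        show ((y * u : 𝓞 K) : K) = y * u from rfl, map_mul, hu,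
        mul_neg_one, ← h, mul_inv_cancel₀ hNx]
  have : IsCyclic Gal(K/ℚ) := ⟨σ, hσ⟩
  obtain ⟨t, ht⟩ := groupCohomology.exists_div_of_norm_eq_one hσ hzx
  obtain ⟨m, hm, hmt⟩ :=
    ((IsFractionRing.isAlgebraic_iff ℤ ℚ K).mpr (.of_finite ℚ (t : K))).exists_integral_multiple
  let s : 𝓞 K := ⟨m • (t : K), hmt⟩
  have hs : s ≠ 0 := by
    rw [← RingOfIntegers.coe_ne_zero_iff]
    exact smul_ne_zero hm t.ne_zero
  have hst : z * σ • s = x * s := by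
    ext
    have h1 : ((σ • s : 𝓞 K) : K) = m • σ t := by
      change σ (m • (t : K)) = _
      rw [map_zsmul]
    have h2 : (s : K) = m • (t : K) := rfl
    have h3 : σ (t : K) ≠ 0 := by simp
    change (z : K) * ((σ • s : 𝓞 K) : K) = x * (s : K)
    rw [h1, h2, mul_smul_comm, mul_smul_comm]
    congr 1
    field_simp at ht
    linear_combination -ht
  have hinv : σ • (Ideal.span {s} * (I : Ideal (𝓞 K))) = Ideal.span {s} * (I : Ideal (𝓞 K)) := by
    rw [smul_mul', Ideal.smul_closure, Set.smul_set_singleton, ← hJ]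
    refine mul_left_cancel₀ (a := Ideal.span {x}) (by simpa using hx) ?_
    rw [mul_left_comm, hxy, ← hz, ← mul_assoc, ← mul_assoc,
      Ideal.span_singleton_mul_span_singleton, Ideal.span_singleton_mul_span_singleton,
      mul_comm _ z, hst]
  obtain ⟨w, hw⟩ := H (Ideal.span {s} * (I : Ideal (𝓞 K))) fun g => by
    have : g ∈ MulAction.stabilizer Gal(K/ℚ) (Ideal.span {s} * (I : Ideal (𝓞 K))) :=
      (Subgroup.zpowers_le.mpr (MulAction.mem_stabilizer_iff.mpr hinv)) (hσ g)
    exact this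
  rw [← map_one ClassGroup.mk0]
  refine ClassGroup.mk0_eq_mk0_iff.mpr ⟨s, w, hs, ?_, by simpa using hw⟩
  rintro rfl
  exact hI0 (by simpa [hs] using hw)

theorem not_dvd_card_classGroup {K : Type} [Field K] [NumberField K] [IsGalois ℚ K]
    [IsCyclic Gal(K/ℚ)] {p n : ℕ} (hp : p.Prime) (hdeg : Module.finrank ℚ K = p ^ n)
    (u : 𝓞 K) (hu : Algebra.norm ℚ (u : K) = -1)
    (H : ∀ I : Ideal (𝓞 K), (∀ g : Gal(K/ℚ), g • I = I) → Submodule.IsPrincipal I) :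
    ¬ p ∣ Nat.card (ClassGroup (𝓞 K)) := by
  obtain ⟨σ, hσ⟩ := IsCyclic.exists_generator (α := Gal(K/ℚ))
  have := Fact.mk hp
  let _ := ClassGroup.mulAction (𝓞 K) Gal(K/ℚ)
  have hG : IsPGroup p Gal(K/ℚ) :=
    IsPGroup.of_card (n := n) (by rw [IsGalois.card_aut_eq_finrank, hdeg])
  have hfix : MulAction.fixedPoints Gal(K/ℚ) (ClassGroup (𝓞 K)) ⊆ {1} := by
    intro c hc
    obtain ⟨I, rfl⟩ := ClassGroup.mk0_surjective c
    exact ClassGroup.mk0_eq_one_of_smul_eq σ hσ u hu H I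
      ((ClassGroup.smulMap_mk0 σ I).symm.trans (hc σ))
  have hone : (1 : ClassGroup (𝓞 K)) ∈ MulAction.fixedPoints Gal(K/ℚ) (ClassGroup (𝓞 K)) := by
    intro g
    rw [← map_one ClassGroup.mk0]
    exact (ClassGroup.smulMap_mk0 g 1).trans
      (congrArg _ (Subtype.ext (smul_one (N := Ideal (𝓞 K)) g)))
  intro h
  have h1 := hG.card_modEq_card_fixedPoints (ClassGroup (𝓞 K))
  rw [hfix.antisymm (Set.singleton_subset_iff.mpr hone),
    Nat.card_eq_fintype_card (α := ({1} : Set (ClassGroup (𝓞 K)))),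
    Fintype.card_unique] at h1
  exact hp.one_lt.ne' (Nat.dvd_one.mp ((h1.dvd_iff dvd_rfl).mp h))

theorem natCast_dvd_pow_totient_sub_self {L : Type*} [Field L] [NumberField L] {m : ℕ} [NeZero m]
    [IsCyclotomicExtension {m} ℚ L] {p : ℕ} (hp : p.Prime) (hpm : p.Coprime m) (x : 𝓞 L) :
    (p : 𝓞 L) ∣ x ^ (p ^ m.totient) - x := by
  have hζ := IsCyclotomicExtension.zeta_spec m ℚ L
  have := Fact.mk hp
  have hpu : ¬ IsUnit (p : 𝓞 L) := by
    rw [NumberField.isUnit_iff_norm]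
    have : Algebra.norm ℚ ((p : 𝓞 L) : L) = (p : ℚ) ^ Module.finrank ℚ L := by
      simpa using Algebra.norm_algebraMap (R := ℚ) (S := L) (p : ℚ)
    rw [RingOfIntegers.coe_norm, this, abs_of_nonneg (by positivity)]
    exact (one_lt_pow₀ (by exact_mod_cast hp.one_lt) Module.finrank_pos.ne').ne'
  have : CharP (𝓞 L ⧸ Ideal.span {(p : 𝓞 L)}) p := CharP.quotient _ p hpu
  let φ : 𝓞 L →ₐ[ℤ] 𝓞 L ⧸ Ideal.span {(p : 𝓞 L)} := (Ideal.Quotient.mk _).toIntAlgHom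
  let ψ : 𝓞 L →ₐ[ℤ] 𝓞 L ⧸ Ideal.span {(p : 𝓞 L)} :=
    ((iterateFrobenius _ p m.totient).comp (Ideal.Quotient.mk _)).toIntAlgHom
  have h : φ = ψ := by
    refine hζ.integralPowerBasis.algHom_ext ?_
    rw [hζ.integralPowerBasis_gen]
    change Ideal.Quotient.mk _ _ = iterateFrobenius _ p m.totient (Ideal.Quotient.mk _ _)
    rw [iterateFrobenius_def, ← map_pow]
    congr 1
    have hpow : ∀ z : 𝓞 L, IsPrimitiveRoot z m → z = z ^ (p ^ m.totient) := by
      intro z hz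
      rw [← pow_mod_orderOf, ← hz.eq_orderOf, Nat.ModEq.pow_totient hpm, hz.eq_orderOf,
        pow_mod_orderOf, pow_one]
    exact hpow _ hζ.toInteger_isPrimitiveRoot
  have h2 : Ideal.Quotient.mk (Ideal.span {(p : 𝓞 L)}) x =
      (Ideal.Quotient.mk _ x) ^ (p ^ m.totient) :=
    DFunLike.congr_fun h x
  rw [← Ideal.mem_span_singleton, ← Ideal.Quotient.eq_zero_iff_mem, map_sub, map_pow, ← h2,
    sub_self]

theorem isRadical_span_natCast {L : Type*} [Field L] [NumberField L] {m : ℕ} [NeZero m]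
    [IsCyclotomicExtension {m} ℚ L] {p : ℕ} (hp : p.Prime) (hpm : p.Coprime m) :
    (Ideal.span {(p : 𝓞 L)}).IsRadical := by
  have ht : 1 < p ^ m.totient :=
    Nat.one_lt_pow (Nat.totient_pos.mpr (NeZero.pos m)).ne' hp.one_lt
  rw [Ideal.isRadical_iff_quotient_reduced, isReduced_iff_pow_one_lt _ ht]
  intro y hy
  obtain ⟨x, rfl⟩ := Ideal.Quotient.mk_surjective y
  have := natCast_dvd_pow_totient_sub_self (L := L) hp hpm x
  rw [← Ideal.mem_span_singleton, ← Ideal.Quotient.eq_zero_iff_mem, map_sub, map_pow, hy,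
    zero_sub, neg_eq_zero] at this
  exact this

theorem dvd_of_algebraMap_dvd {K L : Type*} [Field K] [Field L] [Algebra K L] {a b : 𝓞 K}
    (h : algebraMap (𝓞 K) (𝓞 L) a ∣ algebraMap (𝓞 K) (𝓞 L) b) : a ∣ b := by
  obtain ⟨c, hc⟩ := h
  by_cases ha : a = 0
  · subst ha
    rw [map_zero, zero_mul, map_eq_zero_iff _ (FaithfulSMul.algebraMap_injective _ _)] at hc
    exact hc ▸ dvd_rfl
  have ha' : (a : K) ≠ 0 := by simpa using ha
  have hc' : algebraMap K L b = algebraMap K L a * c := congrArg (algebraMap (𝓞 L) L) hc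
  have hint : IsIntegral ℤ ((b : K) / a) := by
    rw [← isIntegral_algebraMap_iff (algebraMap K L).injective, map_div₀, hc',
      mul_div_cancel_left₀ _ (by simpa using ha)]
    exact c.isIntegral_coe
  refine ⟨⟨_, hint⟩, ?_⟩
  ext
  exact (mul_div_cancel₀ _ ha').symm

theorem liesOver_of_natCast_mem {K : Type*} [Field K] {p : ℕ} (hp : p.Prime)
    (Q : Ideal (𝓞 K)) (hQ : Q.IsPrime) (hpQ : (p : 𝓞 K) ∈ Q) :
    Q.LiesOver (Ideal.span {(p : ℤ)}) := by
  have := Fact.mk hp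
  have := Int.ideal_span_isMaximal_of_prime p
  refine ⟨this.eq_of_le (hQ.under ℤ).ne_top ?_⟩
  rw [Ideal.span_singleton_le_iff_mem, Ideal.mem_comap]
  simpa using hpQ

theorem exists_invariant_radical_generator {K L : Type*} [Field K] [NumberField K]
    [Field L] [NumberField L] [Algebra K L] [IsGalois ℚ K] {ℓ k : ℕ} (hℓ : ℓ.Prime)
    [IsCyclotomicExtension {ℓ ^ (k + 1)} ℚ L]
    (P : Ideal (𝓞 K)) (hP : P.IsPrime) (hPb : P ≠ ⊥) :
    ∃ a ∈ P, a ≠ 0 ∧ (∀ g : Gal(K/ℚ), g • Ideal.span {a} = Ideal.span {a}) ∧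
      (Ideal.span {a}).IsRadical ∧ ∀ Q : Ideal (𝓞 K), Q.IsPrime → a ∈ Q →
        ∃ g : Gal(K/ℚ), Q = g • P := by
  have := Fact.mk hℓ
  obtain ⟨p, hp, hPp⟩ : ∃ p : ℕ, p.Prime ∧ (p : 𝓞 K) ∈ P := by
    have hN : ∀ N : ℕ, N ≠ 0 → (N : 𝓞 K) ∈ P → ∃ p : ℕ, p.Prime ∧ (p : 𝓞 K) ∈ P := by
      intro N
      induction N using induction_on_primes with
      | zero => simp
      | one => exact fun _ h => (hP.ne_top ((Ideal.eq_top_iff_one P).mpr (by simpa using h))).elim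
      | prime_mul p a hp ih =>
        intro h0 h
        rw [Nat.cast_mul] at h
        rcases hP.mem_or_mem h with h | h
        · exact ⟨p, hp, h⟩
        · exact ih (by rintro rfl; simp at h0) h
    exact hN _ (by simpa [Ideal.absNorm_eq_zero_iff] using hPb) (Ideal.absNorm_mem P)
  have hPover := liesOver_of_natCast_mem hp P hP hPp
  by_cases hpℓ : p = ℓ
  · subst hpℓ
    have hζ := IsCyclotomicExtension.zeta_spec (p ^ (k + 1)) ℚ L
    have huniq : ∀ Q : Ideal (𝓞 K), Q.IsPrime → (p : 𝓞 K) ∈ Q →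
        Q = (Ideal.span {hζ.toInteger - 1}).comap (algebraMap (𝓞 K) (𝓞 L)) := by
      intro Q hQ hpQ
      have := liesOver_of_natCast_mem hp Q hQ hpQ
      obtain ⟨R, -, hR, hRQ⟩ :=
        Ideal.exists_ideal_over_prime_of_isIntegral (S := 𝓞 L) Q ⊥ (by simp)
      have hpR : (p : 𝓞 L) ∈ R := by
        rw [← hRQ] at hpQ
        simpa using hpQ
      have := liesOver_of_natCast_mem hp R hR hpR
      rw [← hRQ, IsCyclotomicExtension.Rat.eq_span_zeta_sub_one_of_liesOver p k L hζ R]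
    set π := RingOfIntegers.norm K (hζ.toInteger - 1)
    have hn : Ideal.absNorm (Ideal.span {π}) = p := by
      have h1 := IsCyclotomicExtension.Rat.absNorm_span_zeta_sub_one p k hζ
      rw [Ideal.absNorm_span_singleton] at h1 ⊢
      have h2 : Algebra.norm ℤ π = Algebra.norm ℤ (hζ.toInteger - 1) := by
        rw [← Int.cast_inj (α := ℚ), Algebra.coe_norm_int, Algebra.coe_norm_int,
          RingOfIntegers.coe_norm, Algebra.norm_norm]
      rw [h2, h1]
    have hπp : (Ideal.span {π}).IsPrime := Ideal.isPrime_of_irreducible_absNorm (hn ▸ hp)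
    have hpπ : (p : 𝓞 K) ∈ Ideal.span {π} := by
      have := Ideal.absNorm_mem (Ideal.span {π})
      rwa [hn] at this
    have hPπ : P = Ideal.span {π} := (huniq P hP hPp).trans (huniq _ hπp hpπ).symm
    refine ⟨π, hPπ ▸ Ideal.mem_span_singleton_self π, ?_, ?_, hπp.isRadical, ?_⟩
    · rintro h
      rw [h] at hPπ
      simp [hPb] at hPπ
    · intro g
      refine (huniq _ (hπp.smul g) ?_).trans (huniq _ hπp hpπ).symm
      have hg : g • (p : 𝓞 K) = p :=
        map_natCast (MulSemiringAction.toRingHom Gal(K/ℚ) (𝓞 K) g) p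
      have := Ideal.smul_mem_pointwise_smul g _ _ hpπ
      rwa [hg] at this
    · intro Q hQ hπQ
      refine ⟨1, ?_⟩
      rw [one_smul, huniq P hP hPp]
      exact huniq Q hQ ((Ideal.span_singleton_le_iff_mem _).mpr hπQ hpπ)
  · have hcop : p.Coprime (ℓ ^ (k + 1)) := ((Nat.coprime_primes hp hℓ).mpr hpℓ).pow_right _
    refine ⟨p, hPp, by exact_mod_cast hp.ne_zero, ?_, ?_, ?_⟩
    · intro g
      rw [Ideal.smul_closure, Set.smul_set_singleton, ← MulSemiringAction.toRingHom_apply,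
        map_natCast]
    · rintro x ⟨n, hx⟩
      rw [Ideal.mem_span_singleton] at hx ⊢
      refine dvd_of_algebraMap_dvd (L := L) ?_
      rw [map_natCast, ← Ideal.mem_span_singleton]
      refine isRadical_span_natCast hp hcop ⟨n, ?_⟩
      rw [Ideal.mem_span_singleton, ← map_pow, ← map_natCast (algebraMap (𝓞 K) (𝓞 L))]
      exact map_dvd _ hx
    · intro Q hQ hpQ
      have := liesOver_of_natCast_mem hp Q hQ hpQ
      obtain ⟨g, hg⟩ := Ideal.exists_smul_eq_of_isGaloisGroup (Ideal.span {(p : ℤ)}) P Q Gal(K/ℚ)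
      exact ⟨g, hg.symm⟩

end

section

open Polynomial

/-- The polynomial with root `z ^ (2 ^ n) + z⁻¹ ^ (2 ^ n)`. -/
noncomputable def doublingPoly : ℕ → ℤ[X]
  | 0 => X
  | n + 1 => (doublingPoly n).comp (X ^ 2 - 2)

namespace doublingPoly

theorem natDegree_sq_sub_two : (X ^ 2 - 2 : ℤ[X]).natDegree = 2 := natDegree_X_pow_sub_C (r := 2)

theorem natDegree_eq (n : ℕ) : (doublingPoly n).natDegree = 2 ^ n := by
  induction n with
  | zero => simp [doublingPoly]
  | succ n ih => rw [doublingPoly, natDegree_comp, ih, natDegree_sq_sub_two, pow_succ]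

theorem monic (n : ℕ) : (doublingPoly n).Monic := by
  induction n with
  | zero => exact monic_X
  | succ n ih =>
    exact ih.comp (monic_X_pow_sub_C 2 two_ne_zero)
      (by rw [natDegree_sq_sub_two]; exact two_ne_zero)

theorem eval_two (n : ℕ) : (doublingPoly n).eval 2 = 2 := by
  induction n with
  | zero => simp [doublingPoly]
  | succ n ih => rw [doublingPoly, eval_comp]; norm_num [ih]

theorem eval_neg_one (n : ℕ) : (doublingPoly n).eval (-1) = -1 := by
  induction n with
  | zero => simp [doublingPoly]
  | succ n ih => rw [doublingPoly, eval_comp]; norm_num [ih]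

theorem abs_eval_neg_two (n : ℕ) : |(doublingPoly n).eval (-2)| = 2 := by
  cases n with
  | zero => simp [doublingPoly]
  | succ n => rw [doublingPoly, eval_comp]; norm_num [eval_two]

theorem map_zmod_two (n : ℕ) : (doublingPoly n).map (Int.castRingHom (ZMod 2)) = X ^ 2 ^ n := by
  induction n with
  | zero => simp [doublingPoly]
  | succ n ih =>
    have : (2 : (ZMod 2)[X]) = 0 := CharTwo.two_eq_zero
    rw [doublingPoly, map_comp, ih]
    simp only [this, sub_zero, Polynomial.map_sub, Polynomial.map_pow, map_X, Polynomial.map_ofNat,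
      X_pow_comp]
    rw [← pow_mul, pow_succ']

theorem irreducible {n : ℕ} (hn : n ≠ 0) : Irreducible (doublingPoly n) := by
  have hdeg := natDegree_eq n
  refine irreducible_of_eisenstein_criterion (P := Ideal.span {(2 : ℤ)})
    ((Ideal.span_singleton_prime two_ne_zero).mpr Int.prime_two) ?_ ?_ ?_ ?_ (monic n).isPrimitive
  · rw [(monic n).leadingCoeff, Ideal.mem_span_singleton]
    norm_num
  · intro m hm
    rw [degree_eq_natDegree (monic n).ne_zero, hdeg, Nat.cast_lt] at hm
    have := congrArg (coeff · m) (map_zmod_two n)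
    simp only [coeff_map, coeff_X_pow, hm.ne, if_false] at this
    exact Ideal.mem_span_singleton.mpr ((ZMod.intCast_zmod_eq_zero_iff_dvd _ 2).mp this)
  · rw [← natDegree_pos_iff_degree_pos, hdeg]; positivity
  · obtain ⟨n, rfl⟩ := Nat.exists_eq_succ_of_ne_zero hn
    rw [coeff_zero_eq_eval_zero, doublingPoly, eval_comp, Ideal.span_singleton_pow,
      Ideal.mem_span_singleton, ← dvd_abs]
    have := abs_eval_neg_two n
    norm_num [this]

theorem aeval_add_inv {F : Type*} [Field F] (n : ℕ) {z : F} (hz : z ≠ 0) :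
    aeval (z + z⁻¹) (doublingPoly n) = z ^ 2 ^ n + (z ^ 2 ^ n)⁻¹ := by
  induction n generalizing z with
  | zero => simp [doublingPoly]
  | succ n ih =>
    have h : (z + z⁻¹) ^ 2 - 2 = z ^ 2 + (z ^ 2)⁻¹ := by field_simp; ring
    rw [doublingPoly, aeval_comp]
    simp only [map_sub, map_pow, aeval_X, map_ofNat]
    rw [h, ih (pow_ne_zero 2 hz), ← pow_mul, ← pow_succ']

end doublingPoly

theorem norm_neg_one_sub_eq_neg_one {K : Type*} [Field K] [NumberField K] {n : ℕ} (hn : n ≠ 0)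
    (hdeg : Module.finrank ℚ K = 2 ^ n) {a : K} (ha : aeval a (doublingPoly n) = 0) :
    Algebra.norm ℚ (-1 - a) = -1 := by
  have hmon := doublingPoly.monic n
  have hirr := (hmon.irreducible_iff_irreducible_map_fraction_map (K := ℚ)).mp
    (doublingPoly.irreducible hn)
  have hmin : (doublingPoly n).map (algebraMap ℤ ℚ) = minpoly ℚ a :=
    minpoly.eq_of_irreducible_of_monic hirr (by rwa [aeval_map_algebraMap]) (hmon.map _)
  have hchar : (Algebra.lmul ℚ K a).charpoly = minpoly ℚ a := by
    refine (eq_of_monic_of_dvd_of_natDegree_le (minpoly.monic (.of_finite ℚ a))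
      (LinearMap.charpoly_monic _) (minpoly.dvd ℚ a (Algebra.aeval_self_charpoly_lmul a)) ?_)
    rw [LinearMap.charpoly_natDegree, hdeg, ← hmin, hmon.natDegree_map, doublingPoly.natDegree_eq]
  have h := LinearMap.eval_charpoly (Algebra.lmul ℚ K a) (-1)
  have heval : ((doublingPoly n).map (algebraMap ℤ ℚ)).eval (-1) = -1 := by
    have := congrArg (algebraMap ℤ ℚ) (doublingPoly.eval_neg_one n)
    rw [← eval₂_at_apply, ← eval_map] at this
    simpa using this
  rw [hchar, ← hmin, heval] at h
  rw [h, Algebra.norm_apply, map_sub, map_neg, map_one, map_neg, map_one]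

theorem IsPrimitiveRoot.intermediateField_adjoin_isCyclotomicExtension_of_neZero (F : Type*)
    {E : Type*} [Field F] [Field E] [Algebra F E] {m : ℕ} [NeZero m] {ζ : E}
    (hζ : IsPrimitiveRoot ζ m) : IsCyclotomicExtension {m} F (IntermediateField.adjoin F {ζ}) := by
  change IsCyclotomicExtension {m} F (IntermediateField.adjoin F {ζ}).toSubalgebra
  rw [IntermediateField.adjoin_simple_toSubalgebra_of_isAlgebraic
    (hζ.isIntegral (NeZero.pos m)).tower_top.isAlgebraic]
  exact hζ.adjoin_isCyclotomicExtension F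

theorem IsPrimitiveRoot.add_inv_mem {n : ℕ} {ζ : ℂ} (hζ : IsPrimitiveRoot ζ (2 ^ (n + 2)))
    {K : IntermediateField ℚ ℂ}
    (hKsub : K ≤ IntermediateField.adjoin ℚ {ζ})
    (hKdeg : Module.finrank ℚ K = 2 ^ n)
    (hKreal : ∀ x ∈ K, (starRingEnd ℂ) x = x) : ζ + ζ⁻¹ ∈ K := by
  have hconj : (starRingEnd ℂ) ζ = ζ⁻¹ := by
    rw [Complex.inv_eq_conj (Complex.norm_eq_one_of_pow_eq_one hζ.pow_eq_one (by positivity))]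
  set L := IntermediateField.adjoin ℚ {ζ} with hL
  have hζL : ζ ∈ L := IntermediateField.mem_adjoin_simple_self ℚ ζ
  have : IsCyclotomicExtension {2 ^ (n + 2)} ℚ L :=
    hζ.intermediateField_adjoin_isCyclotomicExtension_of_neZero ℚ
  have hLdeg : Module.finrank ℚ L = 2 ^ (n + 1) := by
    rw [IsCyclotomicExtension.finrank (n := 2 ^ (n + 2)) L
        (cyclotomic.irreducible_rat (by positivity)),
      Nat.totient_prime_pow_succ Nat.prime_two]
    simp
  have : FiniteDimensional ℚ L := .of_finrank_pos (by rw [hLdeg]; positivity)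
  let R : IntermediateField ℚ ℂ :=
    { (starRingEnd ℂ).eqLocusField (RingHom.id ℂ) with
      algebraMap_mem' := fun q => by simp [RingHom.eqLocusField] }
  have hmem : ∀ x, x ∈ R ↔ (starRingEnd ℂ) x = x := fun x => Iff.rfl
  have hKF : K ≤ L ⊓ R := le_inf hKsub fun x hx => (hmem x).mpr (hKreal x hx)
  have hne : L ⊓ R ≠ L := by
    intro h
    have hζR : ζ ∈ R := inf_eq_left.mp h hζL
    rw [hmem, hconj] at hζR
    have h2 : ζ ^ 2 = 1 := by
      rw [pow_two]
      nth_rewrite 1 [← hζR]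
      exact inv_mul_cancel₀ (hζ.ne_zero (by positivity))
    have h4 : 2 ^ (n + 2) ≤ 2 := Nat.le_of_dvd two_pos (hζ.dvd_of_pow_eq_one 2 h2)
    have : 2 ^ n * 4 ≤ 2 := by rwa [pow_add] at h4
    have := Nat.one_le_two_pow (n := n)
    omega
  have hFL : L ⊓ R ≤ L := inf_le_left
  have : FiniteDimensional ℚ ↥(L ⊓ R) :=
    FiniteDimensional.of_injective (IntermediateField.inclusion hFL).toLinearMap
      (IntermediateField.inclusion_injective hFL)
  have hd := IntermediateField.finrank_dvd_of_le_right hFL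
  have hd' := IntermediateField.finrank_dvd_of_le_right hKF
  rw [hLdeg] at hd
  rw [hKdeg] at hd'
  obtain ⟨c, hc⟩ := hd'
  have hc2 : c ∣ 2 := by
    rw [hc, pow_succ] at hd
    exact Nat.dvd_of_mul_dvd_mul_left (by positivity) hd
  have hKeq : K = L ⊓ R := by
    rcases (Nat.dvd_prime Nat.prime_two).mp hc2 with rfl | rfl
    · exact IntermediateField.eq_of_le_of_finrank_eq hKF (by rw [hc, hKdeg, mul_one])
    · exact (hne (IntermediateField.eq_of_le_of_finrank_eq hFL (by rw [hc, hLdeg, pow_succ]))).elim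
  rw [hKeq]
  refine ⟨add_mem hζL (inv_mem hζL), (hmem _).mpr ?_⟩
  rw [map_add, map_inv₀, hconj, inv_inv, add_comm]

theorem IsPrimitiveRoot.aeval_add_inv_doublingPoly {F : Type*} [Field F] {n : ℕ} {ζ : F}
    (hζ : IsPrimitiveRoot ζ (2 ^ (n + 2))) : aeval (ζ + ζ⁻¹) (doublingPoly n) = 0 := by
  rw [doublingPoly.aeval_add_inv n (hζ.ne_zero (by positivity))]
  have h4 : IsPrimitiveRoot (ζ ^ 2 ^ n) 4 := hζ.pow (by positivity) (by rw [pow_add]; rfl)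
  have h2 : (ζ ^ 2 ^ n) ^ 2 = -1 := (h4.pow (b := 2) (by positivity) rfl).eq_neg_one_of_two_right
  have h0 : ζ ^ 2 ^ n ≠ 0 := h4.ne_zero (by positivity)
  field_simp
  linear_combination h2

end

theorem exists_ringOfIntegers_norm_eq_neg_one_of_odd {K : Type*} [Field K] [NumberField K]
    (h : Odd (Module.finrank ℚ K)) : ∃ u : 𝓞 K, Algebra.norm ℚ (u : K) = -1 := by
  refine ⟨-1, ?_⟩
  simpa [h.neg_one_pow] using Algebra.norm_algebraMap (R := ℚ) (S := K) (-1)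

theorem exists_ringOfIntegers_norm_eq_neg_one_of_two {n : ℕ} (hn : n ≠ 0) {ζ : ℂ}
    (hζ : IsPrimitiveRoot ζ (2 ^ (n + 2))) (K : IntermediateField ℚ ℂ) [NumberField K]
    (hKsub : K ≤ IntermediateField.adjoin ℚ {ζ}) (hKdeg : Module.finrank ℚ K = 2 ^ n)
    (hKreal : ∀ x ∈ K, (starRingEnd ℂ) x = x) :
    ∃ u : 𝓞 K, Algebra.norm ℚ (u : K) = -1 := by
  let a : K := ⟨ζ + ζ⁻¹, hζ.add_inv_mem hKsub hKdeg hKreal⟩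
  have ha : Polynomial.aeval a (doublingPoly n) = 0 := by
    apply (algebraMap K ℂ).injective
    rw [← Polynomial.aeval_algebraMap_apply, map_zero]
    exact hζ.aeval_add_inv_doublingPoly
  have hint : IsIntegral ℤ a := ⟨doublingPoly n, doublingPoly.monic n, ha⟩
  exact ⟨⟨-1 - a, isIntegral_one.neg.sub hint⟩, norm_neg_one_sub_eq_neg_one hn hKdeg ha⟩

/-- **Weber-type statement**: for every prime `ℓ` and every `n ≥ 1`, the prime `ℓ` does not
divide the class number of `ℚ(ℓⁿ)`, the `n`-th layer of the cyclotomic `ℤℓ`-extension of `ℚ`,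
realized inside `ℂ` as the unique totally real cyclic subfield of degree `ℓⁿ` of the
cyclotomic field `ℚ(ζ_{ℓ^{n+2}})`. -/
theorem prime_not_dvd_classNumber_of_cyclotomic_layer
    (ℓ : ℕ) (hℓ : ℓ.Prime) (n : ℕ) (hn : 1 ≤ n)
    (ζ : ℂ) (hζ : IsPrimitiveRoot ζ (ℓ ^ (n + 2)))
    (K : IntermediateField ℚ ℂ) [IsGalois ℚ K] [IsCyclic (K ≃ₐ[ℚ] K)]
    (hKsub : K ≤ IntermediateField.adjoin ℚ {ζ})
    (hKdeg : Module.finrank ℚ K = ℓ ^ n)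
    (hKreal : ∀ x ∈ K, (starRingEnd ℂ) x = x) :
    ¬ (ℓ ∣ Nat.card (ClassGroup (𝓞 K))) := by
  have : FiniteDimensional ℚ K := .of_finrank_pos (by rw [hKdeg]; exact pow_pos hℓ.pos n)
  have : NumberField K := ⟨⟩
  have := NeZero.mk hℓ.ne_zero
  have : IsCyclotomicExtension {ℓ ^ (n + 1 + 1)} ℚ (IntermediateField.adjoin ℚ {ζ}) :=
    hζ.intermediateField_adjoin_isCyclotomicExtension_of_neZero ℚ
  have : NumberField (IntermediateField.adjoin ℚ {ζ}) :=
    IsCyclotomicExtension.numberField {ℓ ^ (n + 1 + 1)} ℚ _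
  let _ : Algebra K (IntermediateField.adjoin ℚ {ζ}) :=
    (IntermediateField.inclusion hKsub).toRingHom.toAlgebra
  obtain ⟨u, hu⟩ : ∃ u : 𝓞 K, Algebra.norm ℚ (u : K) = -1 := by
    rcases hℓ.eq_two_or_odd' with rfl | hodd
    · exact exists_ringOfIntegers_norm_eq_neg_one_of_two (Nat.one_le_iff_ne_zero.mp hn) hζ K
        hKsub hKdeg hKreal
    · exact exists_ringOfIntegers_norm_eq_neg_one_of_odd (hKdeg ▸ hodd.pow)
  exact not_dvd_card_classGroup hℓ hKdeg u hu (isPrincipal_of_forall_smul_eq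
    (exists_invariant_radical_generator (L := IntermediateField.adjoin ℚ {ζ}) (k := n + 1) hℓ))
end

section
/- If c is odd and coprime to f, then in the group ring ℤ[G_f] one has the factorization S_f^c = S'_f^c · (1 − σ_{−1}), where σ_{−1} ∈ G_f is the class of −1 (complex conjugation). -/
/-- An integer coprime to `f ≥ 2` is not a multiple of `f`. -/
lemma not_dvd_of_gcd_eq_one {f : ℕ} (hf : 2 ≤ f) {a : ℤ} (ha : Int.gcd a f = 1) :
    ¬ (f : ℤ) ∣ a := by
  intro h
  have h1 : f ∣ 1 := by
    rw [← ha]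
    exact Int.dvd_gcd h dvd_rfl
  have := Nat.le_of_dvd one_pos h1
  omega

lemma two_mul_ne_of_gcd_eq_one {f : ℕ} (hf : 3 ≤ f) {a : ℤ} (ha : Int.gcd a f = 1) :
    2 * a ≠ f := by
  intro h
  have h1 : a ∣ (1 : ℤ) := by
    have := Int.dvd_coe_gcd (dvd_refl a) (Dvd.intro_left 2 h)
    rwa [ha] at this
  have := Int.le_of_dvd one_pos h1
  omega

lemma gcd_natCast_sub_self_left {f : ℕ} {a : ℤ} (ha : Int.gcd a f = 1) :
    Int.gcd ((f : ℤ) - a) f = 1 := by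
  rw [← Int.isCoprime_iff_gcd_eq_one] at ha ⊢
  obtain ⟨u, v, h⟩ := ha
  exact ⟨-u, v + u, by linear_combination h⟩

/-- If `x * c ≡ a` and `y * c ≡ -a` modulo `f` with `x, y ∈ [1, f]`, then `x + y = f`. -/
lemma add_eq_of_modEq_neg {f : ℕ} (hf : 2 ≤ f) {a c x y : ℤ} (hc : Int.gcd c f = 1)
    (ha : Int.gcd a f = 1) (hx1 : 1 ≤ x) (hxf : x ≤ f) (hy1 : 1 ≤ y) (hyf : y ≤ f)
    (hx : x * c ≡ a [ZMOD f]) (hy : y * c ≡ f - a [ZMOD f]) : x + y = f := by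
  have hxlt : x ≠ f := by
    rintro rfl
    apply not_dvd_of_gcd_eq_one hf ha
    exact (Int.ModEq.dvd_iff hx).1 (dvd_mul_right _ _)
  have hdvd : (f : ℤ) ∣ (x + y) * c := by
    have h := Int.modEq_iff_dvd.1 (hx.add hy)
    have h2 : (x + y) * c = f - (a + (f - a) - (x * c + y * c)) := by ring
    rw [h2]
    exact dvd_sub dvd_rfl h
  have hcop : IsCoprime (f : ℤ) c := (Int.isCoprime_iff_gcd_eq_one.2 hc).symm
  obtain ⟨k, hk⟩ := hcop.dvd_of_dvd_mul_right hdvd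
  have hk0 : 0 < k := by
    by_contra! h
    nlinarith
  have hk2 : k < 2 := by
    by_contra! h
    have : x < f := lt_of_le_of_ne hxf hxlt
    nlinarith
  obtain rfl : k = 1 := by omega
  simpa using hk

/-- For `c` odd and coprime to `f`, in the integral group ring `ℤ[(ℤ/fℤ)ˣ]` the
Stickelberger-type element `S_f^c = Σ_{1 ≤ a ≤ f, (a,f)=1} (λ_a(c) + (1−c)/2)·σ_a⁻¹`
factors as `S_f^c = S'_f^c · (1 − σ_{−1})`, where
`S'_f^c = Σ_{1 ≤ a ≤ f/2, (a,f)=1} (λ_a(c) + (1−c)/2)·σ_a⁻¹`.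
Here `σ : ℤ → (ZMod f)ˣ` sends an integer coprime to `f` to its class, `a' a` is the unique
integer in `[1, f]` with `(a' a)·c ≡ a (mod f)`, and `lam a = λ_a(c) = ((a' a)·c − a)/f`. -/
theorem stickelberger_factorization
    (f : ℕ) (hf : 3 ≤ f) (c : ℤ) (hcodd : Odd c) (hc : Int.gcd c (f : ℤ) = 1)
    (σ : ℤ → (ZMod f)ˣ)
    (hσ : ∀ a : ℤ, Int.gcd a (f : ℤ) = 1 → ((σ a : (ZMod f)ˣ) : ZMod f) = (a : ZMod f))
    (a' : ℤ → ℤ)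
    (ha' : ∀ a : ℤ, Int.gcd a (f : ℤ) = 1 →
      1 ≤ a' a ∧ a' a ≤ f ∧ a' a * c ≡ a [ZMOD (f : ℤ)])
    (lam : ℤ → ℤ)
    (hlam : ∀ a : ℤ, Int.gcd a (f : ℤ) = 1 → lam a * f = a' a * c - a) :
    (∑ a ∈ (Finset.Icc (1 : ℤ) (f : ℤ)).filter (fun a => Int.gcd a (f : ℤ) = 1),
        MonoidAlgebra.single ((σ a)⁻¹) (lam a + (1 - c) / 2) :
      MonoidAlgebra ℤ (ZMod f)ˣ) =
    (∑ a ∈ (Finset.Icc (1 : ℤ) ((f : ℤ) / 2)).filter (fun a => Int.gcd a (f : ℤ) = 1),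
        MonoidAlgebra.single ((σ a)⁻¹) (lam a + (1 - c) / 2) :
      MonoidAlgebra ℤ (ZMod f)ˣ) *
      (1 - MonoidAlgebra.single (σ (-1)) 1) := by
  have hf0 : (f : ℤ) ≠ 0 := by omega
  have hneg : Int.gcd (-1) (f : ℤ) = 1 := by simp
  have hlam' : ∀ a : ℤ, Int.gcd a (f : ℤ) = 1 →
      lam (f - a) + (1 - c) / 2 = -(lam a + (1 - c) / 2) := by
    intro a ha
    have hb := gcd_natCast_sub_self_left ha
    obtain ⟨h1, h2, h3⟩ := ha' a ha
    obtain ⟨h4, h5, h6⟩ := ha' _ hb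
    have hsum := add_eq_of_modEq_neg (by omega) hc ha h1 h2 h4 h5 h3 h6
    have h7 : lam (f - a) + lam a = c - 1 := by
      apply mul_right_cancel₀ hf0
      linear_combination hlam a ha + hlam _ hb + c * hsum
    obtain ⟨k, rfl⟩ := hcodd
    omega
  have hσ' : ∀ a : ℤ, Int.gcd a (f : ℤ) = 1 → (σ (f - a))⁻¹ = (σ a)⁻¹ * σ (-1) := by
    intro a ha
    have hm : σ (-1) = -1 := by
      ext
      rw [hσ _ hneg]
      simp
    have hs : σ (f - a) = -σ a := by
      ext
      rw [hσ _ (gcd_natCast_sub_self_left ha), Units.val_neg, hσ a ha]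
      simp
    rw [hs, hm, mul_neg_one, inv_neg]
  rw [mul_sub, mul_one, Finset.sum_mul, sub_eq_add_neg (Finset.sum _ _), ← Finset.sum_neg_distrib,
    ← Finset.sum_filter_add_sum_filter_not _ (fun a : ℤ => a ≤ (f : ℤ) / 2)]
  congr 1
  · refine Finset.sum_congr ?_ fun _ _ => rfl
    ext a
    simp only [Finset.mem_filter, Finset.mem_Icc]
    omega
  · refine Finset.sum_bij' (fun a _ => (f : ℤ) - a) (fun a _ => (f : ℤ) - a) ?_ ?_ ?_ ?_ ?_
    · intro a ha
      simp only [Finset.mem_filter, Finset.mem_Icc] at ha ⊢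
      obtain ⟨⟨⟨h1, h2⟩, h3⟩, h4⟩ := ha
      have hne : a ≠ f := by
        rintro rfl
        exact not_dvd_of_gcd_eq_one (by omega) h3 dvd_rfl
      exact ⟨by omega, gcd_natCast_sub_self_left h3⟩
    · intro a ha
      simp only [Finset.mem_filter, Finset.mem_Icc] at ha ⊢
      obtain ⟨⟨h1, h2⟩, h3⟩ := ha
      have hne := two_mul_ne_of_gcd_eq_one hf h3
      exact ⟨⟨by omega, gcd_natCast_sub_self_left h3⟩, by omega⟩
    · intro a _
      ring
    · intro a _
      ring
    · intro a ha
      simp only [Finset.mem_filter] at ha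
      have h := gcd_natCast_sub_self_left ha.1.2
      have h1 := hlam' _ h
      have h2 := hσ' _ h
      rw [sub_sub_cancel] at h1 h2
      rw [h1, h2, MonoidAlgebra.single_mul_single, mul_one, MonoidAlgebra.single_neg]
end

section
/- Let p be a prime, let q := p if p is odd and q := 4 if p = 2, let m ≥ 0, and assume q·p^m divides f and c is odd and coprime to f. Let * denote the Spiegel involution on the group algebra (ℤ/qp^mℤ)[G_f]: the (ℤ/qp^mℤ)-algebra endomorphism determined on group elements by σ_a ↦ (a mod qp^m)·σ_a^{−1} (this is well defined since a coprime to f implies a mod qp^m is a unit, and a ↦ (a mod qp^m)·σ_a^{−1} is multiplicative). Then the images of S_f^c and S'_f^c in (ℤ/qp^mℤ)[G_f] satisfy (S_f^c)^* = (S'_f^c)^* · (1 + σ_{−1}). -/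
/-- Reindexing a sum over residues coprime to `f` by the reflection `a ↦ f - a`. -/
theorem sum_coprime_eq_sum_half {M : Type*} [AddCommMonoid M] {f : ℕ} (hf : 3 ≤ f) (g : ℤ → M) :
    ∑ a ∈ (Finset.Icc (1 : ℤ) (f : ℤ)).filter (fun a => Int.gcd a (f : ℤ) = 1), g a =
      ∑ a ∈ (Finset.Icc (1 : ℤ) ((f : ℤ) / 2)).filter (fun a => Int.gcd a (f : ℤ) = 1),
        (g a + g (f - a)) := by
  have hgcd : ∀ a : ℤ, Int.gcd (f - a) f = Int.gcd a f := fun a => by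
    simp
  have hne : ∀ a : ℤ, Int.gcd a f = 1 → a ≠ f := by
    rintro a ha rfl
    simp at ha
    omega
  have hne_half : ∀ a : ℤ, Int.gcd a f = 1 → 2 * a ≠ f := by
    intro a ha h
    rw [← h, Int.gcd_mul_left_right] at ha
    omega
  rw [Finset.sum_add_distrib,
    ← Finset.sum_filter_add_sum_filter_not _ (fun a : ℤ => a ≤ (f : ℤ) / 2)]
  congr 1
  · refine Finset.sum_congr ?_ fun _ _ => rfl
    ext a
    simp only [Finset.mem_filter, Finset.mem_Icc]
    omega
  · refine Finset.sum_nbij' (fun a => f - a) (fun a => f - a) ?_ ?_ ?_ ?_ ?_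
    · intro a ha
      simp only [Finset.mem_filter, Finset.mem_Icc, hgcd] at ha ⊢
      have := hne a ha.1.2
      omega
    · intro a ha
      simp only [Finset.mem_filter, Finset.mem_Icc, hgcd] at ha ⊢
      have := hne_half a ha.2
      omega
    · intro a _
      ring
    · intro a _
      ring
    · intro a _
      simp

/-- Behaviour of the Stickelberger-type elements under the **Spiegel involution**.
Let `p` be prime, `q = p` (`q = 4` if `p = 2`), `m ≥ 0`, `q·p^m ∣ f`, and `c` odd coprime
to `f`.  The Spiegel involution is the `(ℤ/qp^mℤ)`-algebra endomorphism `T` of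
`(ℤ/qp^mℤ)[(ℤ/fℤ)ˣ]` determined on group elements by `σ_a ↦ (a mod qp^m)·σ_a⁻¹`.
Then the images in `(ℤ/qp^mℤ)[(ℤ/fℤ)ˣ]` of
`S_f^c = Σ_{1 ≤ a ≤ f, (a,f)=1} (λ_a(c) + (1−c)/2)·σ_a⁻¹` and of
`S'_f^c = Σ_{1 ≤ a ≤ f/2, (a,f)=1} (λ_a(c) + (1−c)/2)·σ_a⁻¹` satisfy
`(S_f^c)^* = (S'_f^c)^* · (1 + σ_{−1})`. -/
theorem spiegel_involution_stickelberger
    (f : ℕ) (hf : 3 ≤ f) (p : ℕ) (hp : p.Prime) (m : ℕ)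
    (q : ℕ) (hq : q = if p = 2 then 4 else p) (hdvd : q * p ^ m ∣ f)
    (c : ℤ) (hcodd : Odd c) (hc : Int.gcd c (f : ℤ) = 1)
    (σ : ℤ → (ZMod f)ˣ)
    (hσ : ∀ a : ℤ, Int.gcd a (f : ℤ) = 1 → ((σ a : (ZMod f)ˣ) : ZMod f) = (a : ZMod f))
    (a' : ℤ → ℤ)
    (ha' : ∀ a : ℤ, Int.gcd a (f : ℤ) = 1 →
      1 ≤ a' a ∧ a' a ≤ f ∧ a' a * c ≡ a [ZMOD (f : ℤ)])
    (lam : ℤ → ℤ)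
    (hlam : ∀ a : ℤ, Int.gcd a (f : ℤ) = 1 → lam a * f = a' a * c - a)
    -- `T` is the Spiegel involution
    (T : MonoidAlgebra (ZMod (q * p ^ m)) (ZMod f)ˣ →ₐ[ZMod (q * p ^ m)]
      MonoidAlgebra (ZMod (q * p ^ m)) (ZMod f)ˣ)
    (hT : ∀ u : (ZMod f)ˣ, T (MonoidAlgebra.single u 1) =
      MonoidAlgebra.single u⁻¹ (ZMod.castHom hdvd (ZMod (q * p ^ m)) (u : ZMod f))) :
    T (∑ a ∈ (Finset.Icc (1 : ℤ) (f : ℤ)).filter (fun a => Int.gcd a (f : ℤ) = 1),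
        MonoidAlgebra.single ((σ a)⁻¹) ((lam a + (1 - c) / 2 : ℤ) : ZMod (q * p ^ m))) =
    T (∑ a ∈ (Finset.Icc (1 : ℤ) ((f : ℤ) / 2)).filter (fun a => Int.gcd a (f : ℤ) = 1),
        MonoidAlgebra.single ((σ a)⁻¹) ((lam a + (1 - c) / 2 : ℤ) : ZMod (q * p ^ m))) *
      (1 + MonoidAlgebra.single (σ (-1)) 1) := by
  have hgcd : ∀ a : ℤ, Int.gcd (f - a) f = Int.gcd a f := fun a => by
    simp
  have hneg : Int.gcd (-1) (f : ℤ) = 1 := by simp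
  have hσ_sub : ∀ a : ℤ, Int.gcd a f = 1 → σ (f - a) = σ (-1) * σ a := by
    intro a ha
    ext
    rw [Units.val_mul, hσ _ ((hgcd a).trans ha), hσ _ hneg, hσ a ha]
    simp
  have hσ_neg : σ (-1) = -1 := by
    ext
    rw [hσ _ hneg]
    simp
  have ha'_sub : ∀ a : ℤ, Int.gcd a f = 1 → a' (f - a) = f - a' a := by
    intro a ha
    obtain ⟨h1, h2, h3⟩ := ha' a ha
    obtain ⟨h4, h5, h6⟩ := ha' (f - a) ((hgcd a).trans ha)
    have hdvd_mul : (f : ℤ) ∣ (a' a + a' (f - a)) * c := by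
      have h := (h3.add h6).dvd
      have h' : (f : ℤ) ∣ f - (a' a * c + a' (f - a) * c) := by simpa using h
      rw [add_mul]
      exact (dvd_sub_right (dvd_refl _)).mp h'
    have hdvd_sum : (f : ℤ) ∣ a' a + a' (f - a) :=
      IsCoprime.dvd_of_dvd_mul_right (Int.isCoprime_iff_gcd_eq_one.mpr hc).symm hdvd_mul
    have hlt : a' a ≠ f := by
      intro h
      rw [h] at h3
      have hfa : (f : ℤ) ∣ a := by
        have := h3.dvd
        exact (dvd_sub_left (dvd_mul_right _ _)).mp this
      have hf1 : (f : ℤ) ∣ (Int.gcd a f : ℤ) := Int.dvd_coe_gcd hfa (dvd_refl _)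
      rw [ha] at hf1
      have := Int.le_of_dvd one_pos hf1
      omega
    obtain ⟨k, hk⟩ := hdvd_sum
    have hk1 : k = 1 := by
      have : 0 < k := by nlinarith
      have : k < 2 := by nlinarith [lt_of_le_of_ne h2 hlt]
      omega
    rw [hk1] at hk
    linarith
  have hlam_sub : ∀ a : ℤ, Int.gcd a f = 1 →
      lam (f - a) + (1 - c) / 2 = -(lam a + (1 - c) / 2) := by
    intro a ha
    have h : lam (f - a) = c - 1 - lam a := by
      have h1 := hlam a ha
      have h2 := hlam (f - a) ((hgcd a).trans ha)
      rw [ha'_sub a ha] at h2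
      refine mul_right_cancel₀ (b := (f : ℤ)) (by omega) ?_
      linear_combination h2 + h1
    obtain ⟨k, rfl⟩ := hcodd
    omega
  have hT_single : ∀ (u : (ZMod f)ˣ) (r : ZMod (q * p ^ m)), T (MonoidAlgebra.single u r) =
      MonoidAlgebra.single u⁻¹ (r * ZMod.castHom hdvd (ZMod (q * p ^ m)) (u : ZMod f)) := by
    intro u r
    have h : MonoidAlgebra.single u r = r • MonoidAlgebra.single u (1 : ZMod (q * p ^ m)) := by
      simp
    rw [h, map_smul, hT, MonoidAlgebra.smul_single, smul_eq_mul]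
  rw [map_sum, map_sum, sum_coprime_eq_sum_half hf, Finset.sum_mul]
  refine Finset.sum_congr rfl fun a ha => ?_
  have ha := (Finset.mem_filter.mp ha).2
  rw [hT_single, hT_single, mul_add, mul_one, MonoidAlgebra.single_mul_single, hlam_sub a ha,
    hσ_sub a ha, hσ_neg]
  congr 2
  · simp
  · rw [neg_one_mul, inv_neg, Units.val_neg, map_neg, Int.cast_neg, neg_mul_neg, mul_one]
end

section
/- Let p be an odd prime and suppose 4 ∣ f, p ∣ f, and c is coprime to f (hence c is odd). For each integer a with 1 ≤ a ≤ f and gcd(a, f) = 1 set μ_a := λ_a(c) + (1 − c)/2, and in the group algebra (ℤ/pℤ)[G_f] put B' := Σ_{1 ≤ a ≤ f, gcd(a,f)=1, a ≡ 1 (mod 4)} μ_a·(a mod p)^{−1}·σ_a. Then (1 + σ_{−1}) · B' = Σ_{1 ≤ a ≤ f, gcd(a,f)=1} μ_a·(a mod p)^{−1}·σ_a, where σ_{−1} ∈ G_f is the class of −1. -/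
theorem Int.gcd_natCast_sub_left (f : ℕ) {a : ℤ} (ha : Int.gcd a f = 1) :
    Int.gcd (f - a) f = 1 := by
  rw [← Int.isCoprime_iff_gcd_eq_one] at ha ⊢
  have := (ha.neg_left).add_mul_right_left 1
  rwa [one_mul, neg_add_eq_sub] at this

/-- The representative in `[1, f]` of the class of `a / c` is sent to its complement by
`a ↦ f - a`. -/
theorem representative_sub {f : ℕ} (hf : 3 ≤ f) {c : ℤ} (hc : Int.gcd c f = 1)
    {a x y : ℤ} (ha : Int.gcd a f = 1) (hx1 : 1 ≤ x) (hxf : x ≤ f)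
    (hx : x * c ≡ a [ZMOD f]) (hy1 : 1 ≤ y) (hyf : y ≤ f)
    (hy : y * c ≡ f - a [ZMOD f]) : y = f - x := by
  have hdvd : (f : ℤ) ∣ (x + y) * c := by
    obtain ⟨u, hu⟩ := hx.dvd
    obtain ⟨v, hv⟩ := hy.dvd
    exact ⟨1 - u - v, by linear_combination -hu - hv⟩
  obtain ⟨k, hk⟩ : (f : ℤ) ∣ x + y :=
    (Int.isCoprime_iff_gcd_eq_one.mpr hc).symm.dvd_of_dvd_mul_right hdvd
  have hxne : x ≠ f := by
    rintro rfl
    have h : (f : ℤ) ∣ a := by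
      obtain ⟨u, hu⟩ := hx.dvd
      exact ⟨u + c, by linear_combination hu⟩
    have := Int.dvd_coe_gcd h dvd_rfl
    rw [ha] at this
    have := Int.le_of_dvd (by omega) this
    omega
  have hf0 : (0 : ℤ) < f := by omega
  have hk1 : k = 1 := by
    have : 0 < k := by by_contra! h; nlinarith
    have : x < f := by omega
    have : k < 2 := by by_contra! h; nlinarith
    omega
  subst hk1
  linarith


/-- Let `p` be an odd prime with `4 ∣ f`, `p ∣ f`, and `c` coprime to `f` (hence odd).
With `μ_a := λ_a(c) + (1−c)/2`, set, in `(ℤ/pℤ)[(ℤ/fℤ)ˣ]`,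
`B' := Σ_{1 ≤ a ≤ f, (a,f)=1, a ≡ 1 (4)} μ_a·(a mod p)⁻¹·σ_a`.  Then
`(1 + σ_{−1})·B' = Σ_{1 ≤ a ≤ f, (a,f)=1} μ_a·(a mod p)⁻¹·σ_a`. -/
theorem half_system_sum
    (f : ℕ) (hf : 3 ≤ f) (p : ℕ) (hp : p.Prime) (hpodd : Odd p)
    (h4f : 4 ∣ f) (hpf : p ∣ f)
    (c : ℤ) (hc : Int.gcd c (f : ℤ) = 1)
    (σ : ℤ → (ZMod f)ˣ)
    (hσ : ∀ a : ℤ, Int.gcd a (f : ℤ) = 1 → ((σ a : (ZMod f)ˣ) : ZMod f) = (a : ZMod f))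
    (a' : ℤ → ℤ)
    (ha' : ∀ a : ℤ, Int.gcd a (f : ℤ) = 1 →
      1 ≤ a' a ∧ a' a ≤ f ∧ a' a * c ≡ a [ZMOD (f : ℤ)])
    (lam : ℤ → ℤ)
    (hlam : ∀ a : ℤ, Int.gcd a (f : ℤ) = 1 → lam a * f = a' a * c - a) :
    ((1 + MonoidAlgebra.single (σ (-1)) 1 : MonoidAlgebra (ZMod p) (ZMod f)ˣ) *
      ∑ a ∈ (Finset.Icc (1 : ℤ) (f : ℤ)).filter
          (fun a => Int.gcd a (f : ℤ) = 1 ∧ a % 4 = 1),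
        MonoidAlgebra.single (σ a)
          (((lam a + (1 - c) / 2 : ℤ) : ZMod p) * ((a : ZMod p))⁻¹)) =
    ∑ a ∈ (Finset.Icc (1 : ℤ) (f : ℤ)).filter (fun a => Int.gcd a (f : ℤ) = 1),
        MonoidAlgebra.single (σ a)
          (((lam a + (1 - c) / 2 : ℤ) : ZMod p) * ((a : ZMod p))⁻¹) := by
  set g : ℤ → MonoidAlgebra (ZMod p) (ZMod f)ˣ := fun a => MonoidAlgebra.single (σ a)
    (((lam a + (1 - c) / 2 : ℤ) : ZMod p) * ((a : ZMod p))⁻¹) with hg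
  have hodd : ∀ a : ℤ, Int.gcd a f = 1 → a % 2 = 1 := by
    intro a ha
    by_contra h
    have h2 : (2 : ℤ) ∣ Int.gcd a f := Int.dvd_coe_gcd (by omega) (by omega)
    rw [ha] at h2
    omega
  have hc2 := hodd c hc
  have hf0 : (f : ℤ) ≠ 0 := by omega
  have hneg : ∀ a : ℤ, Int.gcd a f = 1 → MonoidAlgebra.single (σ (-1)) 1 * g a = g (f - a) := by
    intro a ha
    have hb := Int.gcd_natCast_sub_left f ha
    obtain ⟨h1, h2, h3⟩ := ha' a ha
    obtain ⟨k1, k2, k3⟩ := ha' _ hb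
    have hrep := representative_sub hf hc ha h1 h2 h3 k1 k2 k3
    have hl : lam (f - a) = c - 1 - lam a := by
      refine mul_right_cancel₀ hf0 ?_
      rw [hlam _ hb, hrep]
      linear_combination hlam a ha
    have hμ : lam (f - a) + (1 - c) / 2 = -(lam a + (1 - c) / 2) := by omega
    have hσ' : σ (-1) * σ a = σ (f - a) := by
      ext
      rw [Units.val_mul, hσ _ ha, hσ _ hb, hσ (-1) (by simp)]
      simp
    have hfp : (f : ZMod p) = 0 := (ZMod.natCast_eq_zero_iff f p).mpr hpf
    have : Fact p.Prime := ⟨hp⟩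
    simp only [hg, MonoidAlgebra.single_mul_single, hσ', hμ, one_mul]
    congr 1
    push_cast
    rw [hfp, zero_sub, inv_neg, neg_mul_neg]
  rw [← Finset.sum_filter_add_sum_filter_not
    ((Finset.Icc (1 : ℤ) (f : ℤ)).filter (fun a => Int.gcd a (f : ℤ) = 1)) (fun a => a % 4 = 1),
    Finset.filter_filter, Finset.filter_filter, add_mul, one_mul, Finset.mul_sum]
  congr 1
  refine Finset.sum_bij' (fun a _ => f - a) (fun a _ => f - a) ?_ ?_ ?_ ?_ ?_
  · intro a ha
    simp only [Finset.mem_filter, Finset.mem_Icc] at ha ⊢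
    obtain ⟨⟨h1, h2⟩, h3, h4⟩ := ha
    have : a ≠ f := by omega
    exact ⟨by omega, Int.gcd_natCast_sub_left f h3, by omega⟩
  · intro a ha
    simp only [Finset.mem_filter, Finset.mem_Icc] at ha ⊢
    obtain ⟨⟨h1, h2⟩, h3, h4⟩ := ha
    have := hodd a h3
    exact ⟨by omega, Int.gcd_natCast_sub_left f h3, by omega⟩
  · intro a _; simp
  · intro a _; simp
  · intro a ha
    exact hneg a (Finset.mem_filter.mp ha).2.1
end

section
/- Let p be an odd prime and N ≥ 2 an integer with p ∤ N, and let K := ℚ(N). Then p is unramified in K; let g be the number of primes of the ring of integers of K lying above p, and let K' be the decomposition field of p in K/ℚ, i.e. the unique subfield of K of degree g over ℚ (K/ℚ being cyclic); K' is the largest subfield of K in which p splits completely. For m ≥ 0 put K_m := K·ℚ(p^m) and K'_m := K'·ℚ(p^m) (composita inside a fixed algebraic closure of ℚ). Assume that p does not divide the class number of K. Then for every m ≥ 0: p divides the class number of K_m if and only if p divides the class number of K'_m. -/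
open NumberField

section

open scoped Pointwise nonZeroDivisors

theorem natCard_eq_natCard_ker_mul_natCard_range {A B : Type*} [AddCommGroup A] [AddCommGroup B]
    (f : A →+ B) : Nat.card A = Nat.card f.ker * Nat.card f.range := by
  rw [AddSubgroup.card_eq_card_quotient_mul_card_addSubgroup f.ker, mul_comm,
    Nat.card_congr (QuotientAddGroup.quotientKerEquivRange f).toEquiv]

/-- A finitely generated abelian group without `p`-torsion has `p ^ rank` classes modulo `p`. -/
theorem natCard_modN_of_no_torsion {A : Type*} [AddCommGroup A] [Module.Finite ℤ A]
    {p : ℕ} (hp : p ≠ 0) (hA : ∀ a : A, p • a = 0 → a = 0) :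
    Nat.card (ModN A p) = p ^ Module.finrank ℤ A := by
  have : NeZero p := ⟨hp⟩
  let T := Submodule.torsion ℤ A
  have h1 : Module.finrank ℤ (A ⧸ T) = Module.finrank ℤ A :=
    finrank_quotient_eq_of_le_torsion le_rfl
  rw [← h1]
  have hfree : Module.Free ℤ (A ⧸ T) := inferInstance
  rw [← ModN.natCard_eq]
  have hT : Finite T := by
    have : Module.Finite ℤ T := inferInstance
    exact Module.finite_of_fg_torsion T (Submodule.torsion_isTorsion)
  have hsurj : ∀ t : T, ∃ t' : T, p • t' = t := by
    have : Function.Injective (fun t : T => p • t) := by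
      intro t t' h
      have : p • (t - t') = 0 := by simpa [smul_sub, sub_eq_zero] using h
      have := hA (t - t' : A) (by simpa using congrArg Subtype.val this)
      exact Subtype.ext (sub_eq_zero.mp this)
    exact Finite.surjective_of_injective this
  let f : ModN A p →ₗ[ℤ] ModN (A ⧸ T) p := Submodule.mapQ _ _ T.mkQ (by
    rintro _ ⟨a, rfl⟩
    exact ⟨T.mkQ a, by simp⟩)
  refine Nat.card_congr (Equiv.ofBijective f ⟨?_, ?_⟩)
  · rw [injective_iff_map_eq_zero]
    intro x
    obtain ⟨a, rfl⟩ := Submodule.mkQ_surjective _ x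
    intro h
    have h2 : T.mkQ a ∈ LinearMap.range (LinearMap.lsmul ℤ (A ⧸ T) p) := by
      simpa [f] using h
    obtain ⟨b, hb⟩ := h2
    obtain ⟨b, rfl⟩ := T.mkQ_surjective b
    have h3 : a - (p : ℤ) • b ∈ T := by
      rw [← Submodule.Quotient.mk_eq_zero, Submodule.Quotient.mk_sub]
      simpa [sub_eq_zero] using hb.symm
    obtain ⟨t, ht⟩ := hsurj ⟨_, h3⟩
    have h4 : (p • (t : A)) = a - (p : ℤ) • b := by simpa using congrArg Subtype.val ht
    simp only [Submodule.mkQ_apply, Submodule.Quotient.mk_eq_zero]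
    exact ⟨b + t, by simp [h4]⟩
  · intro y
    obtain ⟨y, rfl⟩ := Submodule.mkQ_surjective _ y
    obtain ⟨a, rfl⟩ := T.mkQ_surjective y
    exact ⟨Submodule.mkQ _ a, rfl⟩

/-- The freshman's dream for `1 - σ` in a commutative ring, modulo `p`. -/
theorem exists_one_sub_pow_eq {R : Type*} [CommRing R] (p m : ℕ) (hp : p.Prime) (σ : R) :
    ∃ w : R, (1 - σ) ^ (p ^ m - 1) = ∑ i ∈ Finset.range (p ^ m), σ ^ i + p * w := by
  open Polynomial in
  have := Fact.mk hp
  have key : ((1 - X : ℤ[X]) ^ (p ^ m - 1) - ∑ i ∈ Finset.range (p ^ m), X ^ i).map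
      (Int.castRingHom (ZMod p)) = 0 := by
    have h0 : (1 - X : (ZMod p)[X]) ≠ 0 := by
      intro h
      have := congrArg (eval 0) h
      simp at this
    simp only [Polynomial.map_sub, Polynomial.map_pow, Polynomial.map_one, Polynomial.map_X,
      Polynomial.map_sum]
    apply mul_left_cancel₀ h0
    rw [mul_zero, mul_sub, ← pow_succ', Nat.sub_add_cancel (Nat.one_le_pow _ _ hp.pos),
      mul_neg_geom_sum, sub_pow_char_pow, one_pow, sub_self]
  have : (C (p : ℤ)) ∣ ((1 - X : ℤ[X]) ^ (p ^ m - 1) - ∑ i ∈ Finset.range (p ^ m), X ^ i) := by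
    rw [C_dvd_iff_dvd_coeff]
    intro i
    have := congrArg (fun q => q.coeff i) key
    rw [coeff_map] at this
    rw [← ZMod.intCast_zmod_eq_zero_iff_dvd]
    simpa using this
  obtain ⟨w, hw⟩ := this
  refine ⟨aeval σ w, ?_⟩
  have := congrArg (aeval σ) hw
  simp only [map_sub, map_pow, map_one, aeval_X, map_sum, map_mul, aeval_C] at this
  rw [← sub_eq_iff_eq_add', this]
  simp


theorem natCard_ker_smul_pow_le {R A : Type*} [CommRing R] [AddCommGroup A] [Module R A] [Finite A]
    (s : R) (k : ℕ) : Nat.card (DistribSMul.toAddMonoidHom A (s ^ k)).ker ≤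
      Nat.card (DistribSMul.toAddMonoidHom A s).ker ^ k := by
  induction k with
  | zero =>
    rw [pow_zero, pow_zero]
    refine (Nat.card_eq_one_iff_unique.mpr ⟨⟨fun a b => ?_⟩, inferInstance⟩).le
    have h (a : (DistribSMul.toAddMonoidHom A (1 : R)).ker) : (a : A) = 0 := by
      simpa using (AddMonoidHom.mem_ker.mp a.2)
    exact Subtype.ext ((h a).trans (h b).symm)
  | succ k ih =>
    let h : (DistribSMul.toAddMonoidHom A (s ^ (k + 1))).ker →+ A :=
      (DistribSMul.toAddMonoidHom A (s ^ k)).comp (AddSubgroup.subtype _)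
    rw [natCard_eq_natCard_ker_mul_natCard_range h, pow_succ (Nat.card _)]
    refine Nat.mul_le_mul ((Nat.card_le_card_of_injective (fun x : h.ker =>
      (⟨x.1.1, x.2⟩ : (DistribSMul.toAddMonoidHom A (s ^ k)).ker)) ?_).trans ih)
      (Nat.card_le_card_of_injective (fun x : h.range =>
        (⟨x.1, ?_⟩ : (DistribSMul.toAddMonoidHom A s).ker)) ?_)
    · intro x y hxy
      exact Subtype.ext (Subtype.ext (congrArg Subtype.val hxy :))
    · obtain ⟨⟨y, hy0⟩, hy⟩ := x.2
      rw [← hy]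
      have := AddMonoidHom.mem_ker.mp hy0
      rw [DistribSMul.toAddMonoidHom_apply, pow_succ', mul_smul] at this
      exact this
    · intro x y hxy
      exact Subtype.ext (congrArg Subtype.val hxy :)

/-- Let `σ` act with `σ ^ (p ^ m) = 1` on a finitely generated abelian group `U` without
`p`-torsion.  If the kernel of the norm `ν` is `(1 - σ) U` and the rank of `U` is at least
`p ^ m` times that of the invariants, then every invariant is a norm. -/
theorem exists_norm_eq_of_finrank_le {R U : Type*} [CommRing R] [AddCommGroup U] [Module R U]
    [Module.Finite ℤ U] {p : ℕ} (hp : p.Prime) (m : ℕ) {σ : R} (hσ : σ ^ p ^ m = 1)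
    (htors : ∀ u : U, p • u = 0 → u = 0)
    (hker : ∀ u : U, (∑ i ∈ Finset.range (p ^ m), σ ^ i) • u = 0 → ∃ v, u = (1 - σ) • v)
    (hrank : p ^ m * Module.finrank ℤ (DistribSMul.toAddMonoidHom U (1 - σ)).ker ≤
      Module.finrank ℤ U) {ε : U} (hε : (1 - σ) • ε = 0) :
    ∃ η : U, ε = (∑ i ∈ Finset.range (p ^ m), σ ^ i) • η := by
  set ν := ∑ i ∈ Finset.range (p ^ m), σ ^ i with hν
  set s := 1 - σ with hs
  have hsν : s * ν = 0 := by rw [hs, hν, mul_neg_geom_sum, hσ, sub_self]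
  have hpm : 1 ≤ p ^ m := Nat.one_le_pow _ _ hp.pos
  obtain ⟨w, hw⟩ := exists_one_sub_pow_eq p m hp σ
  have : NeZero p := ⟨hp.ne_zero⟩
  have htorsR : ∀ u : U, (p : R) • u = 0 → u = 0 := fun u hu => htors u (by
    rwa [Nat.cast_smul_eq_nsmul] at hu)
  -- the operator induced by `s` on `U / p U`
  let P : Submodule R U := LinearMap.range (LinearMap.lsmul R U (p : R))
  let V := U ⧸ P
  have hcardMod : ∀ (A : Type _) [AddCommGroup A] [Module.Finite ℤ A],
      (∀ a : A, p • a = 0 → a = 0) →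
      Nat.card (A ⧸ (DistribSMul.toAddMonoidHom A (p : ℤ)).range) = p ^ Module.finrank ℤ A :=
    fun A _ _ h => natCard_modN_of_no_torsion hp.ne_zero h
  have hP' : P.toAddSubgroup = (DistribSMul.toAddMonoidHom U (p : ℤ)).range := by
    ext u
    simp [P, Nat.cast_smul_eq_nsmul]
  have hVcard : Nat.card V = p ^ Module.finrank ℤ U := by
    rw [← hcardMod U htors, ← hP']
    rfl
  have hVfin : Finite V := Nat.finite_of_card_ne_zero (by rw [hVcard]; exact pow_ne_zero _ hp.ne_zero)
  let T : V →+ V := DistribSMul.toAddMonoidHom V s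
  have hnorm : ∀ u : U, (Submodule.Quotient.mk (p := P) (s ^ (p ^ m - 1) • u) : V) =
      Submodule.Quotient.mk (p := P) (ν • u) := by
    intro u
    rw [hw, add_smul, Submodule.Quotient.mk_add, add_eq_left, Submodule.Quotient.mk_eq_zero]
    exact ⟨w • u, by simp [smul_smul, mul_comm]⟩
  -- the kernel of `T` is the image of the kernel of `s`
  let F := (DistribSMul.toAddMonoidHom U s).ker
  have hkerT : ∀ x : V, T x = 0 → ∃ f : F, (Submodule.Quotient.mk (p := P) (f : U) : V) = x := by
    intro x hx
    obtain ⟨u, rfl⟩ := Submodule.Quotient.mk_surjective P x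
    rw [show T (Submodule.Quotient.mk u) = Submodule.Quotient.mk (s • u) from rfl,
      Submodule.Quotient.mk_eq_zero] at hx
    obtain ⟨y, hy⟩ := hx
    simp only [LinearMap.lsmul_apply] at hy
    have h1 : ν • y = 0 := by
      apply htorsR
      rw [smul_comm, hy, smul_smul, mul_comm, hsν, zero_smul]
    obtain ⟨v, rfl⟩ := hker y h1
    refine ⟨⟨u - (p : R) • v, ?_⟩, ?_⟩
    · rw [AddMonoidHom.mem_ker, DistribSMul.toAddMonoidHom_apply, smul_sub, ← hy, smul_comm,
        sub_self]
    · rw [Submodule.Quotient.mk_sub, sub_eq_self, Submodule.Quotient.mk_eq_zero]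
      exact ⟨v, rfl⟩
  have hFfin : Module.Finite ℤ F := inferInstanceAs (Module.Finite ℤ (AddSubgroup.toIntSubmodule F))
  have hκ : Nat.card T.ker ≤ p ^ Module.finrank ℤ F := by
    rw [← hcardMod F fun a ha => Subtype.ext (htors a (by simpa using congrArg Subtype.val ha))]
    have : Finite (F ⧸ (DistribSMul.toAddMonoidHom F (p : ℤ)).range) := by
      apply Nat.finite_of_card_ne_zero
      rw [hcardMod F fun a ha => Subtype.ext (htors a (by simpa using congrArg Subtype.val ha))]
      exact pow_ne_zero _ hp.ne_zero
    let q : F ⧸ (DistribSMul.toAddMonoidHom F (p : ℤ)).range →+ V :=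
      QuotientAddGroup.map _ P.toAddSubgroup F.subtype (by
        rintro _ ⟨f, rfl⟩
        exact ⟨f, by simp [Nat.cast_smul_eq_nsmul]⟩)
    have hle : T.ker ≤ q.range := by
      intro x hx
      obtain ⟨f, hf⟩ := hkerT x hx
      exact ⟨QuotientAddGroup.mk f, hf⟩
    exact (Nat.card_le_card_of_injective (AddSubgroup.inclusion hle)
      (AddSubgroup.inclusion_injective hle)).trans
      (Nat.card_le_card_of_surjective q.rangeRestrict q.rangeRestrict_surjective)
  -- counting
  let Tk : V →+ V := DistribSMul.toAddMonoidHom V (s ^ (p ^ m - 1))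
  have hrange_le : Tk.range ≤ T.ker := by
    rintro _ ⟨x, rfl⟩
    obtain ⟨u, rfl⟩ := Submodule.Quotient.mk_surjective P x
    change s • Submodule.Quotient.mk (p := P) (s ^ (p ^ m - 1) • u) = 0
    rw [hnorm, ← Submodule.Quotient.mk_smul, smul_smul, hsν, zero_smul, Submodule.Quotient.mk_zero]
  have hκpos : 0 < Nat.card T.ker := Nat.card_pos
  have hcount : Nat.card T.ker ≤ Nat.card Tk.range := by
    have h1 := natCard_eq_natCard_ker_mul_natCard_range Tk
    have h2 : Nat.card Tk.ker ≤ Nat.card T.ker ^ (p ^ m - 1) := natCard_ker_smul_pow_le s _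
    have h3 : Nat.card T.ker ^ (p ^ m) ≤ Nat.card V := by
      rw [hVcard]
      calc _ ≤ (p ^ Module.finrank ℤ F) ^ (p ^ m) := Nat.pow_le_pow_left hκ _
        _ = p ^ (p ^ m * Module.finrank ℤ F) := by rw [← pow_mul, mul_comm]
        _ ≤ _ := Nat.pow_le_pow_right hp.pos hrank
    have h4 : Nat.card T.ker ^ (p ^ m - 1) * Nat.card T.ker ≤
        Nat.card T.ker ^ (p ^ m - 1) * Nat.card Tk.range := by
      rw [← pow_succ, Nat.sub_add_cancel hpm]
      exact h3.trans (h1.le.trans (Nat.mul_le_mul_right _ h2))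
    exact Nat.le_of_mul_le_mul_left h4 (pow_pos hκpos _)
  have hrange_eq : Tk.range = T.ker :=
    SetLike.coe_injective (Set.eq_of_subset_of_ncard_le hrange_le hcount)
  -- every invariant is a norm modulo `p` times an invariant
  have hstep : ∀ ε : U, s • ε = 0 → ∃ η ε' : U, s • ε' = 0 ∧ ε = ν • η + (p : R) • ε' := by
    intro ε hε
    have h1 : (Submodule.Quotient.mk (p := P) ε : V) ∈ Tk.range := by
      rw [hrange_eq, AddMonoidHom.mem_ker]
      change Submodule.Quotient.mk (p := P) (s • ε) = 0
      rw [hε, Submodule.Quotient.mk_zero]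
    obtain ⟨x, hx⟩ := h1
    obtain ⟨u, rfl⟩ := Submodule.Quotient.mk_surjective P x
    have h2 : (Submodule.Quotient.mk (p := P) (ν • u) : V) = Submodule.Quotient.mk (p := P) ε := by
      rw [← hnorm, ← hx]
      rfl
    rw [eq_comm, ← sub_eq_zero, ← Submodule.Quotient.mk_sub, Submodule.Quotient.mk_eq_zero] at h2
    obtain ⟨e, he⟩ := h2
    simp only [LinearMap.lsmul_apply] at he
    refine ⟨u, e, ?_, ?_⟩
    · apply htorsR
      rw [smul_comm, he, smul_sub, hε, smul_smul, hsν, zero_smul, sub_zero]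
    · rw [he]; abel
  have hiter : ∀ k : ℕ, ∃ η ε' : U, s • ε' = 0 ∧ ε = ν • η + (p : R) ^ k • ε' := by
    intro k
    induction k with
    | zero => exact ⟨0, ε, hε, by simp⟩
    | succ k ih =>
      obtain ⟨η, ε', h1, h2⟩ := ih
      obtain ⟨η', ε'', h3, h4⟩ := hstep ε' h1
      refine ⟨η + (p : R) ^ k • η', ε'', h3, ?_⟩
      rw [h2, h4, smul_add, smul_add, smul_comm ν, smul_smul _ (p : R), ← pow_succ, add_assoc]
  obtain ⟨η, ε', h1, h2⟩ := hiter m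
  have h3 : ν • ε' = (p : R) ^ m • ε' := by
    have h4 : ∀ i, σ ^ i • ε' = ε' := by
      have h5 : σ • ε' = ε' := by
        rw [hs, sub_smul, one_smul, sub_eq_zero] at h1
        exact h1.symm
      intro i
      induction i with
      | zero => simp
      | succ i ih => rw [pow_succ, mul_smul, h5, ih]
    rw [hν, Finset.sum_smul, Finset.sum_congr rfl fun i _ => h4 i, Finset.sum_const,
      Finset.card_range, ← Nat.cast_smul_eq_nsmul R]
    push_cast
    rfl
  exact ⟨η + ε', by rw [h2, smul_add, h3]⟩

theorem mem_of_coprime_nsmul_mem {A : Type*} [AddCommGroup A] {H : AddSubgroup A} {a b : ℕ}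
    (hab : a.Coprime b) {x : A} (ha : a • x ∈ H) (hb : b • x ∈ H) : x ∈ H := by
  have h := Nat.gcd_eq_gcd_ab a b
  rw [hab.gcd_eq_one] at h
  have : x = a.gcdA b • a • x + a.gcdB b • b • x := by
    rw [← natCast_zsmul, ← natCast_zsmul, ← mul_zsmul', ← mul_zsmul', ← add_zsmul, ← h,
      Nat.cast_one, one_zsmul]
  rw [this]
  exact H.add_mem (H.zsmul_mem ha _) (H.zsmul_mem hb _)

/-- A vanishing criterion for the `p`-torsion of the cokernel of `φ : X → J`, where `σ` of
`p`-power order and `δ` (the norm element of a group of order `d` prime to `p`) act on `X`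
and `J`.  In the application `X` is the multiplicative group of a number field and `J` its
group of fractional ideals. -/
theorem mem_range_of_prime_nsmul_mem_range {R X J : Type*} [CommRing R] [AddCommGroup X]
    [Module R X] [AddCommGroup J] [Module R J] (φ : X →ₗ[R] J) {p : ℕ} (hp : p.Prime) (m : ℕ)
    {σ δ : R} (hσ : σ ^ p ^ m = 1) {d h : ℕ} (hd : d.Coprime p) (hh : h.Coprime p)
    (hδ : δ * δ = d * δ)
    (hilbert90 : ∀ x : X, (∑ i ∈ Finset.range (p ^ m), σ ^ i) • x = 0 → ∃ y, x = (1 - σ) • y)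
    (hinv : ∀ j : J, (1 - σ) • j = 0 →
      ∃ b : X, (1 - σ) • b = 0 ∧ ((h : R) * (d - δ)) • j = φ b)
    (hnorm : ∀ j : J, p • j ∈ LinearMap.range φ → δ • j ∈ LinearMap.range φ)
    [Module.Finite ℤ (LinearMap.ker φ)]
    (htors : ∀ u ∈ LinearMap.ker φ, p • u = 0 → u = 0)
    (hrank : p ^ m * Module.finrank ℤ (LinearMap.ker φ ⊓ LinearMap.ker (LinearMap.lsmul R X δ) ⊓
        LinearMap.ker (LinearMap.lsmul R X (1 - σ)) : Submodule R X) ≤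
      Module.finrank ℤ (LinearMap.ker φ ⊓ LinearMap.ker (LinearMap.lsmul R X δ) : Submodule R X))
    {j : J} (hj : p • j ∈ LinearMap.range φ) : j ∈ LinearMap.range φ := by
  set ν := ∑ i ∈ Finset.range (p ^ m), σ ^ i with hν
  have hsν : (1 - σ) * ν = 0 := by rw [hν, mul_neg_geom_sum, hσ, sub_self]
  set s := 1 - σ with hs
  let U : Submodule R X := LinearMap.ker φ ⊓ LinearMap.ker (LinearMap.lsmul R X δ)
  have hU : ∀ {x : X}, x ∈ U ↔ φ x = 0 ∧ δ • x = 0 := Iff.rfl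
  have hdδ : δ * (d - δ) = 0 := by rw [mul_sub, hδ, mul_comm]; ring
  have hUfin : Module.Finite ℤ U := by
    have : Function.Injective (Submodule.inclusion (inf_le_left : U ≤ LinearMap.ker φ)) :=
      Submodule.inclusion_injective _
    exact Module.Finite.of_injective
      ((Submodule.inclusion (inf_le_left : U ≤ LinearMap.ker φ)).restrictScalars ℤ) this
  -- `H¹` of `U` vanishes
  have hH1 : ∀ u : U, ν • u = 0 → ∃ v, u = s • v := by
    rintro ⟨u, hu⟩ hνu
    have hνu' : ν • u = 0 := congrArg Subtype.val hνu
    obtain ⟨hu1, hu2⟩ := hU.mp hu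
    let H : AddSubgroup U := (DistribSMul.toAddMonoidHom U s).range
    suffices (⟨u, hu⟩ : U) ∈ H by
      obtain ⟨v, hv⟩ := this
      exact ⟨v, hv.symm⟩
    have hcop : (h * d * d).Coprime (p ^ m) := ((hh.mul_left hd).mul_left hd).pow_right m
    refine mem_of_coprime_nsmul_mem hcop ?_ ?_
    · obtain ⟨γ, rfl⟩ := hilbert90 u hνu'
      obtain ⟨b, hb, hb'⟩ := hinv (φ γ) (by rw [← map_smul, hu1])
      let v : X := ((h : R) * (d - δ)) • γ - b
      have hφv : φ v = 0 := by simp only [v, map_sub, map_smul]; rw [hb', sub_self]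
      have hsv : s • v = ((h : R) * d) • s • γ := by
        simp only [v, smul_sub, hb, sub_zero]
        rw [smul_comm, mul_sub, sub_smul, mul_smul _ δ, hu2, smul_zero, sub_zero]
      refine ⟨⟨((d : R) - δ) • v, hU.mpr ⟨by rw [map_smul, hφv, smul_zero], ?_⟩⟩, ?_⟩
      · rw [smul_smul, hdδ, zero_smul]
      · apply Subtype.ext
        change s • ((d : R) - δ) • v = (h * d * d) • s • γ
        rw [smul_comm, hsv, smul_smul, ← Nat.cast_smul_eq_nsmul R, sub_mul, sub_smul,
          mul_comm δ, mul_smul _ δ, hu2, smul_zero, sub_zero]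
        push_cast
        ring_nf
    · obtain ⟨μ, hμ⟩ : ∃ μ : R, ((p ^ m : ℕ) : R) - ν = s * μ := by
        have : ((p ^ m : ℕ) : R) - ν = ∑ i ∈ Finset.range (p ^ m), (1 - σ ^ i) := by
          simp [hν]
        rw [this]
        exact Finset.dvd_sum fun i _ => by simpa using sub_dvd_pow_sub_pow 1 σ i
      refine ⟨μ • ⟨u, hu⟩, ?_⟩
      rw [DistribSMul.toAddMonoidHom_apply, smul_smul, ← hμ, sub_smul, hνu, sub_zero,
        Nat.cast_smul_eq_nsmul]
  have hrank' : p ^ m * Module.finrank ℤ (DistribSMul.toAddMonoidHom U s).ker ≤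
      Module.finrank ℤ U := by
    refine le_trans (Nat.mul_le_mul_left _ (le_of_eq ?_)) hrank
    let e : (DistribSMul.toAddMonoidHom U s).ker ≃+
        (U ⊓ LinearMap.ker (LinearMap.lsmul R X s) : Submodule R X) :=
      { toFun := fun x => ⟨x.1.1, x.1.2, congrArg Subtype.val (AddMonoidHom.mem_ker.mp x.2)⟩
        invFun := fun x => ⟨⟨x.1, x.2.1⟩, Subtype.ext x.2.2⟩
        left_inv := fun x => rfl
        right_inv := fun x => rfl
        map_add' := fun x y => rfl }
    exact e.toIntLinearEquiv.finrank_eq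
  have hH0 : ∀ ε : X, φ ε = 0 → s • ε = 0 →
      ∃ η : X, φ η = 0 ∧ ((d : R) - δ) • ε = ν • η := by
    intro ε hε hsε
    have hmem : ((d : R) - δ) • ε ∈ U :=
      hU.mpr ⟨by rw [map_smul, hε, smul_zero], by rw [smul_smul, hdδ, zero_smul]⟩
    obtain ⟨η, hη⟩ := exists_norm_eq_of_finrank_le hp m hσ
      (fun u hu => Subtype.ext (htors u u.2.1 (by simpa using congrArg Subtype.val hu)))
      hH1 hrank' (ε := ⟨_, hmem⟩) (Subtype.ext (by
        change s • ((d : R) - δ) • ε = 0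
        rw [smul_comm, hsε, smul_zero]))
    exact ⟨η, (hU.mp η.2).1, congrArg Subtype.val hη⟩
  -- invariant classes
  have hfixed : ∀ j : J, p • j ∈ LinearMap.range φ → s • j ∈ LinearMap.range φ →
      j ∈ LinearMap.range φ := by
    rintro j hj ⟨α, hα⟩
    obtain ⟨β, hβ⟩ := hnorm j hj
    have hφε : φ (ν • α) = 0 := by rw [map_smul, hα, smul_smul, mul_comm, hsν, zero_smul]
    obtain ⟨η, hη, hη'⟩ := hH0 (ν • α) hφε (by rw [smul_smul, hsν, zero_smul])
    let α' : X := (d : R) • α - η - (δ • α - s • β)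
    have hνα' : ν • α' = 0 := by
      simp only [α', smul_sub]
      rw [← hη', smul_smul ν s, mul_comm ν s, hsν, zero_smul, sub_zero, sub_smul, smul_comm ν,
        smul_comm ν δ]
      abel
    have hφα' : φ α' = s • ((d : R) • j) := by
      simp only [α', map_sub, map_smul, hη, hα, hβ]
      rw [smul_comm s δ, sub_self, sub_zero, sub_zero, smul_comm]
    obtain ⟨y, hy⟩ := hilbert90 α' hνα'
    obtain ⟨b, -, hb⟩ := hinv ((d : R) • j - φ y) (by
      rw [smul_sub, ← hφα', ← map_smul, ← hy, sub_self])
    refine mem_of_coprime_nsmul_mem (H := (LinearMap.range φ).toAddSubgroup)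
      ((hh.mul_left hd).mul_left hd) ?_ hj
    have h1 : (h * d * d) • j = φ (b + ((h : R) * (d - δ)) • y + ((h : R) * d) • β) := by
      rw [map_add, map_add, map_smul, map_smul, ← hb, hβ, smul_sub, sub_add_cancel,
        ← Nat.cast_smul_eq_nsmul R, smul_smul, smul_smul, ← add_smul]
      push_cast
      ring_nf
    exact ⟨_, h1.symm⟩
  -- `s` is nilpotent on the `p`-torsion of the cokernel
  have hnil : s ^ (p ^ m) • j ∈ LinearMap.range φ := by
    obtain ⟨w, hw⟩ := exists_one_sub_pow_eq p m hp σ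
    have : s ^ (p ^ m) = s * w * p := by
      rw [← Nat.sub_add_cancel (Nat.one_le_pow m p hp.pos), pow_succ, hs, hw, ← hs, ← hν, add_mul,
        mul_comm ν, hsν]
      ring
    rw [this, mul_smul, Nat.cast_smul_eq_nsmul]
    exact Submodule.smul_mem _ _ hj
  have hdescend : ∀ k : ℕ, s ^ k • j ∈ LinearMap.range φ → j ∈ LinearMap.range φ := by
    intro k
    induction k with
    | zero => intro h; simpa using h
    | succ k ih =>
      intro h
      refine ih (hfixed _ ?_ ?_)
      · rw [smul_comm]; exact Submodule.smul_mem _ _ hj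
      · rwa [smul_smul, ← pow_succ']
  exact hdescend _ hnil

theorem finrank_int_range_add_finrank_int_ker {V W : Type*} [AddCommGroup V] [AddCommGroup W]
    [Module.Finite ℤ V] (f : V →ₗ[ℤ] W) :
    Module.finrank ℤ (LinearMap.range f) + Module.finrank ℤ (LinearMap.ker f) =
      Module.finrank ℤ V := by
  rw [← Submodule.finrank_quotient_add_finrank (LinearMap.ker f), f.quotKerEquivRange.finrank_eq]

/-- The norm element of a finite subgroup splits the rank of a stable group. -/
theorem finrank_inf_ker_add_finrank_inf_invariants {G X : Type*} [Group G] [AddCommGroup X]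
    (ρ : Representation ℤ G X) (D : Subgroup G) [Fintype D] (A : Submodule ℤ X)
    [Module.Finite ℤ A] (hA : ∀ g ∈ D, ∀ x ∈ A, ρ g x ∈ A) :
    Module.finrank ℤ ↥(A ⊓ LinearMap.ker (∑ g : D, ρ g)) +
      Module.finrank ℤ ↥(A ⊓ Representation.invariants (ρ.comp D.subtype)) = Module.finrank ℤ A := by
  set δ : X →ₗ[ℤ] X := ∑ g : D, ρ g with hδ
  set B := A ⊓ Representation.invariants (ρ.comp D.subtype) with hB
  let f : A →ₗ[ℤ] X := δ.comp A.subtype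
  have hf : Module.finrank ℤ (LinearMap.range f) + Module.finrank ℤ (LinearMap.ker f) =
    Module.finrank ℤ A := finrank_int_range_add_finrank_int_ker f
  have hk : Module.finrank ℤ (LinearMap.ker f) = Module.finrank ℤ ↥(A ⊓ LinearMap.ker δ) := by
    have : A ⊓ LinearMap.ker δ = (LinearMap.ker f).map A.subtype := by
      ext x
      simp [f, and_comm]
    rw [this, LinearEquiv.finrank_eq (Submodule.equivMapOfInjective _ A.subtype_injective _)]
  have hBfin : Module.Finite ℤ B :=
    Module.Finite.of_injective (Submodule.inclusion inf_le_left : B →ₗ[ℤ] A)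
      (Submodule.inclusion_injective _)
  have hle : LinearMap.range f ≤ B := by
    rintro _ ⟨a, rfl⟩
    refine ⟨?_, fun g => ?_⟩
    · simp only [f, LinearMap.comp_apply, hδ, LinearMap.sum_apply]
      exact Submodule.sum_mem _ fun g _ => hA _ g.2 _ a.2
    · simp only [f, LinearMap.comp_apply, hδ, LinearMap.sum_apply, map_sum, MonoidHom.comp_apply,
        ← Module.End.mul_apply, ← map_mul]
      exact Fintype.sum_equiv (Equiv.mulLeft g) _ _ fun h => by simp
  let e : B →ₗ[ℤ] LinearMap.range f :=
    (f.rangeRestrict).comp (Submodule.inclusion inf_le_left : B →ₗ[ℤ] A)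
  have he : ∀ b : B, ((e b : LinearMap.range f) : X) = Fintype.card D • (b : X) := by
    intro b
    have h2 : ∀ g : D, ρ g (b : X) = b := fun g => b.2.2 g
    simp [e, f, hδ, h2]
  have hke : Module.finrank ℤ (LinearMap.ker e) = 0 := by
    refine Module.finrank_eq_zero_iff.mpr fun x => ⟨Fintype.card D, by simp, ?_⟩
    have := he x.1
    rw [LinearMap.mem_ker.mp x.2] at this
    refine Subtype.ext (Subtype.ext ?_)
    simpa using this.symm
  have h1 := finrank_int_range_add_finrank_int_ker e
  have h2 := Submodule.finrank_le (LinearMap.range e)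
  have h3 := Submodule.finrank_mono hle
  omega

/-- A form of `mem_range_of_prime_nsmul_mem_range` for representations of commutative groups. -/
theorem mem_range_of_prime_nsmul_mem_range_of_representation {G X J : Type*} [CommGroup G]
    [AddCommGroup X] [AddCommGroup J] (ρ : Representation ℤ G X) (τ : Representation ℤ G J)
    (φ : X →ₗ[ℤ] J) (hφ : ∀ g x, φ (ρ g x) = τ g (φ x)) {p : ℕ} (hp : p.Prime) (m : ℕ)
    {σ : G} (hσ : σ ^ p ^ m = 1) (D : Subgroup G) [Fintype D]
    (hd : (Fintype.card D).Coprime p) {h : ℕ} (hh : h.Coprime p)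
    (hilbert90 : ∀ x : X, ∑ i ∈ Finset.range (p ^ m), ρ (σ ^ i) x = 0 → ∃ y, x = y - ρ σ y)
    (hinv : ∀ j : J, τ σ j = j → ∃ b : X, ρ σ b = b ∧
      h • (Fintype.card D • j - ∑ g : D, τ g j) = φ b)
    (hnorm : ∀ j : J, p • j ∈ LinearMap.range φ → ∑ g : D, τ g j ∈ LinearMap.range φ)
    [Module.Finite ℤ (LinearMap.ker φ)] (htors : ∀ u ∈ LinearMap.ker φ, p • u = 0 → u = 0)
    (hrank : Module.finrank ℤ ↥(LinearMap.ker φ ⊓ Representation.invariants (ρ.comp D.subtype)) +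
        p ^ m * Module.finrank ℤ
          ↥(LinearMap.ker φ ⊓ Representation.invariants (ρ.comp (Subgroup.zpowers σ).subtype)) ≤
      Module.finrank ℤ (LinearMap.ker φ) + p ^ m * Module.finrank ℤ
          ↥(LinearMap.ker φ ⊓ Representation.invariants (ρ.comp (Subgroup.zpowers σ).subtype) ⊓
            Representation.invariants (ρ.comp D.subtype)))
    {j : J} (hj : p • j ∈ LinearMap.range φ) : j ∈ LinearMap.range φ := by
  let R := MonoidAlgebra ℤ G
  let iX : Module R X := Module.compHom X ρ.asAlgebraHom.toRingHom
  let iJ : Module R J := Module.compHom J τ.asAlgebraHom.toRingHom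
  have hX (r : R) (x : X) : r • x = ρ.asAlgebraHom r x := rfl
  have hJ (r : R) (x : J) : r • x = τ.asAlgebraHom r x := rfl
  let s : R := MonoidAlgebra.of ℤ G σ
  let δ : R := ∑ g : D, MonoidAlgebra.of ℤ G g
  have hsX (x : X) : s • x = ρ σ x := by rw [hX, Representation.asAlgebraHom_of]
  have hsJ (x : J) : s • x = τ σ x := by rw [hJ, Representation.asAlgebraHom_of]
  have hδX (x : X) : δ • x = ∑ g : D, ρ g x := by
    simp only [δ, hX, map_sum, Representation.asAlgebraHom_of, LinearMap.sum_apply]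
  have hδJ (x : J) : δ • x = ∑ g : D, τ g x := by
    simp only [δ, hJ, map_sum, Representation.asAlgebraHom_of, LinearMap.sum_apply]
  let Φ : X →ₗ[R] J :=
    { toFun := φ
      map_add' := map_add φ
      map_smul' := fun r x => by
        simp only [RingHom.id_apply, hX, hJ]
        induction r using MonoidAlgebra.induction_on with
        | of g => rw [Representation.asAlgebraHom_of, Representation.asAlgebraHom_of, hφ]
        | add a b ha hb => simp [ha, hb]
        | smul r a ha => simp [ha] }
  have hΦ (x : X) : Φ x = φ x := rfl
  have hδδ : δ * δ = (Fintype.card D : R) * δ := by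
    have (g : D) : MonoidAlgebra.of ℤ G g * δ = δ := by
      simp only [δ, Finset.mul_sum, ← map_mul]
      exact Fintype.sum_equiv (Equiv.mulLeft g) _ _ fun h => by simp
    conv_lhs => enter [1]; simp only [δ]
    rw [Finset.sum_mul, Finset.sum_congr rfl fun g _ => this g]
    simp
  have hone (x : X) : (1 - s) • x = x - ρ σ x := by rw [sub_smul, one_smul, hsX]
  have honeJ (x : J) : (1 - s) • x = x - τ σ x := by rw [sub_smul, one_smul, hsJ]
  have hfin : Module.Finite ℤ (LinearMap.ker Φ) :=
    inferInstanceAs (Module.Finite ℤ (LinearMap.ker φ))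
  have hinvσ (x : X) : (x ∈ Representation.invariants (ρ.comp (Subgroup.zpowers σ).subtype)) ↔ ρ σ x = x := by
    refine ⟨fun hx => hx ⟨σ, Subgroup.mem_zpowers σ⟩, fun hx g => ?_⟩
    obtain ⟨g, hg⟩ := g
    have : Subgroup.zpowers σ ≤ (MulAction.stabilizer (Module.End ℤ X)ˣ x).comap ρ.toHomUnits := by
      rw [Subgroup.zpowers_le]
      exact hx
    exact this hg
  refine mem_range_of_prime_nsmul_mem_range Φ hp m (σ := s) (δ := δ) (d := Fintype.card D) (h := h)
    (by rw [← map_pow, hσ, map_one]) hd hh hδδ ?_ ?_ ?_ htors ?_ (j := j) hj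
  · intro x hx
    obtain ⟨y, hy⟩ := hilbert90 x (by
      rw [← hx, Finset.sum_smul]
      exact Finset.sum_congr rfl fun i _ => by
        rw [← map_pow, hX, Representation.asAlgebraHom_of])
    exact ⟨y, by rw [hone, ← hy]⟩
  · intro j hj
    rw [honeJ, sub_eq_zero] at hj
    obtain ⟨b, hb, hb'⟩ := hinv j hj.symm
    refine ⟨b, by rw [hone, hb, sub_self], ?_⟩
    rw [hΦ, ← hb', mul_smul, sub_smul, hδJ, Nat.cast_smul_eq_nsmul, Nat.cast_smul_eq_nsmul]
  · intro j hj
    obtain ⟨x, hx⟩ := hnorm j hj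
    exact ⟨x, by rw [hδJ]; exact hx⟩
  · have hsub1 : ((LinearMap.ker Φ ⊓ LinearMap.ker (LinearMap.lsmul R X δ) :
        Submodule R X).restrictScalars ℤ) = LinearMap.ker φ ⊓ LinearMap.ker (∑ g : D, ρ g) := by
      ext x
      simp [hδX, hΦ]
    have hsub2 : ((LinearMap.ker Φ ⊓ LinearMap.ker (LinearMap.lsmul R X δ) ⊓
        LinearMap.ker (LinearMap.lsmul R X (1 - s)) : Submodule R X).restrictScalars ℤ) =
        LinearMap.ker φ ⊓ Representation.invariants (ρ.comp (Subgroup.zpowers σ).subtype) ⊓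
          LinearMap.ker (∑ g : D, ρ g) := by
      ext x
      have := hinvσ x
      simp only [Submodule.restrictScalars_inf, Submodule.mem_inf, this]
      simp [hδX, hΦ, hsX, sub_eq_zero, eq_comm (a := x) (b := ρ σ x)]
      tauto
    have hstab : ∀ g ∈ D, ∀ x ∈ LinearMap.ker φ, ρ g x ∈ LinearMap.ker φ := fun g _ x hx => by
      rw [LinearMap.mem_ker, hφ, LinearMap.mem_ker.mp hx, map_zero]
    have e1 := finrank_inf_ker_add_finrank_inf_invariants ρ D (LinearMap.ker φ) hstab
    have : Module.Finite ℤ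
        ↥(LinearMap.ker φ ⊓ Representation.invariants (ρ.comp (Subgroup.zpowers σ).subtype)) :=
      Module.Finite.of_injective (Submodule.inclusion inf_le_left : _ →ₗ[ℤ] LinearMap.ker φ)
        (Submodule.inclusion_injective _)
    have e2 := finrank_inf_ker_add_finrank_inf_invariants ρ D
      (LinearMap.ker φ ⊓ Representation.invariants (ρ.comp (Subgroup.zpowers σ).subtype)) (by
        rintro g hg x ⟨hx, hx'⟩
        refine ⟨hstab g hg x hx, ?_⟩
        rw [SetLike.mem_coe, hinvσ] at hx' ⊢
        rw [← Module.End.mul_apply, ← map_mul, mul_comm, map_mul, Module.End.mul_apply, hx'])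
    change _ * Module.finrank ℤ ((LinearMap.ker Φ ⊓ LinearMap.ker (LinearMap.lsmul R X δ) ⊓
        LinearMap.ker (LinearMap.lsmul R X (1 - s)) : Submodule R X).restrictScalars ℤ) ≤
      Module.finrank ℤ ((LinearMap.ker Φ ⊓ LinearMap.ker (LinearMap.lsmul R X δ) :
        Submodule R X).restrictScalars ℤ)
    rw [hsub1, hsub2]
    rw [← e1, ← e2] at hrank
    nlinarith

theorem Ideal.eq_of_le_of_absNorm_eq {R : Type*} [CommRing R] [IsDedekindDomain R]
    [Module.Free ℤ R] {I J : Ideal R} (h : I ≤ J) (hJ : Ideal.absNorm J ≠ 0)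
    (hn : Ideal.absNorm I = Ideal.absNorm J) : I = J := by
  obtain ⟨C, rfl⟩ := Ideal.dvd_iff_le.mpr h
  rw [map_mul, mul_eq_left₀ hJ, Ideal.absNorm_eq_one_iff] at hn
  rw [hn, Ideal.mul_top]

theorem absNorm_smul {L G : Type*} [Field L] [NumberField L] [Group G] [MulSemiringAction G L]
    (g : G) (I : Ideal (𝓞 L)) : Ideal.absNorm (g • I) = Ideal.absNorm I := by
  rw [Ideal.absNorm_apply, Ideal.absNorm_apply, Submodule.cardQuot_apply, Submodule.cardQuot_apply]
  exact (Nat.card_congr (Ideal.quotientEquiv I (g • I)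
    (MulSemiringAction.toRingEquiv G (𝓞 L) g) rfl).toEquiv).symm

/-- The relative norm of an ideal in a Galois extension is the product of its conjugates. -/
theorem map_relNorm_eq_prod_smul {M L : Type*} [Field M] [NumberField M] [Field L] [NumberField L]
    [Algebra M L] [IsGalois M L] (I : Ideal (𝓞 L)) :
    (Ideal.relNorm (𝓞 M) I).map (algebraMap (𝓞 M) (𝓞 L)) = ∏ g : Gal(L/M), g • I := by
  by_cases hI : I = ⊥
  · subst hI
    obtain ⟨g⟩ : Nonempty Gal(L/M) := inferInstance
    rw [Ideal.relNorm_bot, Ideal.map_bot, ← Ideal.zero_eq_bot]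
    exact (Finset.prod_eq_zero (Finset.mem_univ g) (smul_zero g)).symm
  apply Ideal.eq_of_le_of_absNorm_eq
  · rw [Ideal.map_le_iff_le_comap, Ideal.relNorm_apply, Ideal.span_le]
    rintro _ ⟨x, hx, rfl⟩
    have : algebraMap (𝓞 M) (𝓞 L) (Algebra.intNorm (𝓞 M) (𝓞 L) x) = ∏ g : Gal(L/M), g • x := by
      apply FaithfulSMul.algebraMap_injective (𝓞 L) L
      rw [← IsScalarTower.algebraMap_apply, IsScalarTower.algebraMap_apply (𝓞 M) M L,
        Algebra.algebraMap_intNorm (A := 𝓞 M) (K := M) (L := L) (B := 𝓞 L),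
        Algebra.norm_eq_prod_automorphisms, map_prod]
      rfl
    rw [SetLike.mem_coe, Ideal.mem_comap, this]
    exact Ideal.prod_mem_prod fun g _ => Ideal.smul_mem_pointwise_smul _ _ _ hx
  · rw [map_prod, Finset.prod_ne_zero_iff]
    intro g _
    rw [absNorm_smul, Ne, Ideal.absNorm_eq_zero_iff]
    exact hI
  · rw [Ideal.absNorm_algebraMap, Ideal.absNorm_relNorm, map_prod,
      Finset.prod_congr rfl fun g _ => absNorm_smul g I, Finset.prod_const, Finset.card_univ,
      ← Nat.card_eq_fintype_card, IsGalois.card_aut_eq_finrank]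
    congr 1
    exact (IsFractionRing.finrank_eq (𝓞 M) M (𝓞 L) L).symm
/-- The action of a Galois group on the group of fractional ideals. -/
noncomputable def galFractionalIdeal (L : Type*) [Field L] [NumberField L] :
    Gal(L/ℚ) →* Monoid.End (FractionalIdeal (𝓞 L)⁰ L)ˣ where
  toFun g := Units.map (FractionalIdeal.ringEquivOfRingEquiv L L
    (MulSemiringAction.toRingEquiv Gal(L/ℚ) (𝓞 L) g) : _ →* _)
  map_one' := by
    have : MulSemiringAction.toRingEquiv Gal(L/ℚ) (𝓞 L) 1 = RingEquiv.refl _ := by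
      ext x
      exact congrArg NumberField.RingOfIntegers.val (one_smul Gal(L/ℚ) x)
    rw [this, FractionalIdeal.ringEquivOfRingEquiv_refl]
    rfl
  map_mul' g h := by
    have : MulSemiringAction.toRingEquiv Gal(L/ℚ) (𝓞 L) (g * h) =
        (MulSemiringAction.toRingEquiv Gal(L/ℚ) (𝓞 L) h).trans
          (MulSemiringAction.toRingEquiv Gal(L/ℚ) (𝓞 L) g) := by
      ext x
      exact congrArg _ (mul_smul g h x)
    rw [this, FractionalIdeal.ringEquivOfRingEquiv_trans L L L]
    rfl

theorem galFractionalIdeal_toPrincipalIdeal {L : Type*} [Field L] [NumberField L] (g : Gal(L/ℚ))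
    (x : Lˣ) : galFractionalIdeal L g (toPrincipalIdeal (𝓞 L) L x) =
      toPrincipalIdeal (𝓞 L) L (g • x) := by
  ext1
  change FractionalIdeal.ringEquivOfRingEquiv L L _ _ = _
  rw [coe_toPrincipalIdeal, coe_toPrincipalIdeal,
    FractionalIdeal.ringEquivOfRingEquiv_spanSingleton]
  congr 1
  obtain ⟨a, b, hb, hx⟩ := IsFractionRing.div_surjective (A := 𝓞 L) (x : L)
  rw [← hx, map_div₀, IsFractionRing.ringEquivOfRingEquiv_algebraMap,
    IsFractionRing.ringEquivOfRingEquiv_algebraMap]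
  change _ = g (x : L)
  rw [← hx, map_div₀]
  rfl

theorem galFractionalIdeal_mk0 {L : Type*} [Field L] [NumberField L] (g : Gal(L/ℚ))
    {I J : (Ideal (𝓞 L))⁰} (h : g • (I : Ideal (𝓞 L)) = J) :
    galFractionalIdeal L g (FractionalIdeal.mk0 L I) = FractionalIdeal.mk0 L J := by
  ext1
  change FractionalIdeal.ringEquivOfRingEquiv L L _ _ = _
  rw [FractionalIdeal.coe_mk0, FractionalIdeal.coe_mk0, ← h]
  ext x
  rw [FractionalIdeal.ringEquivOfRingEquiv_apply, FractionalIdeal.mem_coeIdeal]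
  change x ∈ Submodule.map _ _ ↔ _
  rw [Submodule.mem_map]
  constructor
  · rintro ⟨y, hy, rfl⟩
    obtain ⟨a, ha, rfl⟩ := hy
    refine ⟨g • a, Ideal.smul_mem_pointwise_smul _ _ _ ha, ?_⟩
    exact (IsFractionRing.ringEquivOfRingEquiv_algebraMap
      (MulSemiringAction.toRingEquiv Gal(L/ℚ) (𝓞 L) g) (K := L) (L := L) a).symm
  · rintro ⟨a, ha, rfl⟩
    refine ⟨algebraMap _ _ (g⁻¹ • a), ⟨_, Ideal.mem_pointwise_smul_iff_inv_smul_mem.mp ha, rfl⟩, ?_⟩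
    refine (IsFractionRing.ringEquivOfRingEquiv_algebraMap
      (MulSemiringAction.toRingEquiv Gal(L/ℚ) (𝓞 L) g) (K := L) (L := L) (g⁻¹ • a)).trans ?_
    exact congrArg _ (smul_inv_smul g a)

/-- Every fractional ideal is the quotient of an integral ideal by a rational integer. -/
theorem exists_mul_toPrincipalIdeal_eq_mk0 {L : Type*} [Field L] [NumberField L]
    (j : (FractionalIdeal (𝓞 L)⁰ L)ˣ) : ∃ (n : Lˣ) (I : (Ideal (𝓞 L))⁰),
      (∀ g : Gal(L/ℚ), g • n = n) ∧ j * toPrincipalIdeal (𝓞 L) L n = FractionalIdeal.mk0 L I := by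
  obtain ⟨a, I, ha, hj⟩ := FractionalIdeal.exists_eq_spanSingleton_mul (j : FractionalIdeal (𝓞 L)⁰ L)
  have hI : I ≠ ⊥ := by
    rintro rfl
    simp at hj
  have hn0 : Ideal.absNorm (Ideal.span {a}) ≠ 0 := by
    rwa [Ne, Ideal.absNorm_eq_zero_iff, Ideal.span_singleton_eq_bot]
  obtain ⟨c, hc⟩ := Ideal.mem_span_singleton.mp (Ideal.absNorm_mem (Ideal.span {a}))
  have hc0 : c ≠ 0 := by
    rintro rfl
    rw [mul_zero, Nat.cast_eq_zero] at hc
    exact hn0 hc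
  have ha' : algebraMap (𝓞 L) L a ≠ 0 := by simpa using ha
  refine ⟨Units.mk0 (Ideal.absNorm (Ideal.span {a}) : L) (Nat.cast_ne_zero.mpr hn0),
    ⟨Ideal.span {c} * I, mem_nonZeroDivisors_of_ne_zero (mul_ne_zero ?_ hI)⟩, fun g => ?_, ?_⟩
  · simpa using hc0
  · ext
    exact map_natCast g _
  · ext1
    rw [Units.val_mul, hj, coe_toPrincipalIdeal, FractionalIdeal.coe_mk0, Units.val_mk0]
    have : (Ideal.absNorm (Ideal.span {a}) : L) = algebraMap (𝓞 L) L a * algebraMap (𝓞 L) L c := by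
      rw [← map_mul, ← hc, map_natCast]
    rw [this, FractionalIdeal.coeIdeal_mul, FractionalIdeal.coeIdeal_span_singleton,
      mul_right_comm, FractionalIdeal.spanSingleton_mul_spanSingleton, inv_mul_cancel_left₀ ha']
/-- The group of fractional ideals as a Galois representation. -/
noncomputable def fractionalIdealRep (L : Type*) [Field L] [NumberField L] :
    Representation ℤ Gal(L/ℚ) (Additive (FractionalIdeal (𝓞 L)⁰ L)ˣ) :=
  (addMonoidEndRingEquivInt (Additive (FractionalIdeal (𝓞 L)⁰ L)ˣ)).toMonoidHom.comp
    ((monoidEndToAdditive (FractionalIdeal (𝓞 L)⁰ L)ˣ).toMonoidHom.comp (galFractionalIdeal L))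

/-- The map sending a nonzero element to the fractional ideal it generates. -/
noncomputable def principalHom (L : Type*) [Field L] [NumberField L] :
    Additive Lˣ →ₗ[ℤ] Additive (FractionalIdeal (𝓞 L)⁰ L)ˣ :=
  (MonoidHom.toAdditive (toPrincipalIdeal (𝓞 L) L)).toIntLinearMap

theorem fractionalIdealRep_ofMul {L : Type*} [Field L] [NumberField L] (g : Gal(L/ℚ))
    (j : (FractionalIdeal (𝓞 L)⁰ L)ˣ) :
    fractionalIdealRep L g (Additive.ofMul j) = Additive.ofMul (galFractionalIdeal L g j) := rfl

theorem principalHom_ofMul {L : Type*} [Field L] [NumberField L] (x : Lˣ) :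
    principalHom L (Additive.ofMul x) = Additive.ofMul (toPrincipalIdeal (𝓞 L) L x) := rfl

theorem principalHom_ofMulDistribMulAction {L : Type*} [Field L] [NumberField L] (g : Gal(L/ℚ))
    (x : Additive Lˣ) :
    principalHom L (Representation.ofMulDistribMulAction Gal(L/ℚ) Lˣ g x) =
      fractionalIdealRep L g (principalHom L x) := by
  rw [Representation.ofMulDistribMulAction_apply_apply, principalHom_ofMul,
    ← galFractionalIdeal_toPrincipalIdeal]
  rfl

theorem ofMul_mk0_mem_range_principalHom {L : Type*} [Field L] [NumberField L]
    (I : (Ideal (𝓞 L))⁰) :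
    Additive.ofMul (FractionalIdeal.mk0 L I) ∈ LinearMap.range (principalHom L) ↔
      Submodule.IsPrincipal (I : Ideal (𝓞 L)) := by
  rw [← ClassGroup.mk0_eq_one_iff I.2, ← ClassGroup.mk_mk0 L, ClassGroup.mk_eq_one_iff,
    FractionalIdeal.isPrincipal_iff]
  constructor
  · rintro ⟨x, hx⟩
    exact ⟨(x.toMul : Lˣ), (toPrincipalIdeal_eq_iff.mp (congrArg Additive.toMul hx)).symm⟩
  · rintro ⟨x, hx⟩
    have hx0 : x ≠ 0 := by
      rintro rfl
      rw [FractionalIdeal.spanSingleton_zero] at hx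
      exact Units.ne_zero _ hx
    exact ⟨Additive.ofMul (Units.mk0 x hx0),
      congrArg Additive.ofMul (toPrincipalIdeal_eq_iff.mpr hx.symm)⟩

theorem sum_fractionalIdealRep_mk0 {L ι : Type*} [Field L] [NumberField L] (s : Finset ι)
    (f : ι → Gal(L/ℚ)) {I J : (Ideal (𝓞 L))⁰}
    (h : ∏ i ∈ s, f i • (I : Ideal (𝓞 L)) = J) :
    ∑ i ∈ s, fractionalIdealRep L (f i) (Additive.ofMul (FractionalIdeal.mk0 L I)) =
      Additive.ofMul (FractionalIdeal.mk0 L J) := by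
  have hne (i : ι) : f i • (I : Ideal (𝓞 L)) ∈ (Ideal (𝓞 L))⁰ := by
    refine mem_nonZeroDivisors_of_ne_zero fun h0 => nonZeroDivisors.coe_ne_zero I ?_
    rw [← inv_smul_smul (f i) (I : Ideal (𝓞 L)), h0, smul_zero]
  have hJ : J = ∏ i ∈ s, ⟨f i • (I : Ideal (𝓞 L)), hne i⟩ := by
    ext1
    rw [← h, SubmonoidClass.coe_finsetProd]
  rw [hJ, map_prod, ofMul_prod]
  exact Finset.sum_congr rfl fun i _ => by
    rw [fractionalIdealRep_ofMul, galFractionalIdeal_mk0 (f i) (J := ⟨_, hne i⟩) rfl]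

/-- Up to a rational factor every fractional ideal is integral. -/
theorem exists_add_principalHom_eq_mk0 {L : Type*} [Field L] [NumberField L]
    (j : Additive (FractionalIdeal (𝓞 L)⁰ L)ˣ) : ∃ (n : Additive Lˣ) (I : (Ideal (𝓞 L))⁰),
      (∀ g, Representation.ofMulDistribMulAction Gal(L/ℚ) Lˣ g n = n) ∧
      j + principalHom L n = Additive.ofMul (FractionalIdeal.mk0 L I) := by
  obtain ⟨n, I, hn, h⟩ := exists_mul_toPrincipalIdeal_eq_mk0 j.toMul
  exact ⟨Additive.ofMul n, I, fun g => congrArg Additive.ofMul (hn g), congrArg Additive.ofMul h⟩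

theorem prod_fixingSubgroup_smul {L : Type*} [Field L] [NumberField L] [IsGalois ℚ L]
    (M : IntermediateField ℚ L) [Fintype M.fixingSubgroup] (I : Ideal (𝓞 L)) :
    ∏ d : M.fixingSubgroup, (d : Gal(L/ℚ)) • I =
      (Ideal.relNorm (𝓞 M) I).map (algebraMap (𝓞 M) (𝓞 L)) := by
  rw [map_relNorm_eq_prod_smul]
  exact Fintype.prod_equiv (M.fixingSubgroupEquiv).toEquiv _ _ fun d => rfl

/-- The units of the integers of a subfield as nonzero elements of the big field. -/
noncomputable def unitsHom (M L : Type*) [Field M] [Field L] [Algebra M L] :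
    Additive (𝓞 M)ˣ →ₗ[ℤ] Additive Lˣ :=
  (MonoidHom.toAdditive (Units.map (algebraMap (𝓞 M) L : 𝓞 M →* L))).toIntLinearMap

theorem unitsHom_injective (M L : Type*) [Field M] [Field L] [Algebra M L] :
    Function.Injective (unitsHom M L) := by
  have h : Function.Injective (algebraMap (𝓞 M) L) := by
    rw [IsScalarTower.algebraMap_eq (𝓞 M) M L]
    exact (algebraMap M L).injective.comp RingOfIntegers.coe_injective
  exact Units.map_injective h

theorem finrank_range_unitsHom (M L : Type*) [Field M] [NumberField M] [Field L] [Algebra M L]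
    [IsTotallyReal M] :
    Module.finrank ℤ (LinearMap.range (unitsHom M L)) + 1 = Module.finrank ℚ M := by
  rw [← LinearEquiv.finrank_eq (LinearEquiv.ofInjective _ (unitsHom_injective M L)),
    NumberField.Units.finrank_eq, NumberField.Units.rank,
    InfinitePlace.card_eq_nrRealPlaces_add_nrComplexPlaces,
    IsTotallyReal.nrComplexPlaces_eq_zero, ← IsTotallyReal.finrank M]
  have : 0 < Module.finrank ℚ M := Module.finrank_pos
  omega

theorem mem_ker_principalHom {L : Type*} [Field L] [NumberField L] {x : Additive Lˣ} :
    x ∈ LinearMap.ker (principalHom L) ↔ IsIntegral ℤ ((x.toMul : Lˣ) : L) ∧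
      IsIntegral ℤ (((x.toMul : Lˣ)⁻¹ : Lˣ) : L) := by
  have h1 (y : L) : y ∈ (1 : FractionalIdeal (𝓞 L)⁰ L) ↔ IsIntegral ℤ y := by
    rw [FractionalIdeal.mem_one_iff]
    exact ⟨fun ⟨z, hz⟩ => hz ▸ RingOfIntegers.isIntegral_coe z, fun h => ⟨⟨y, h⟩, rfl⟩⟩
  have h2 (y : Lˣ) : FractionalIdeal.spanSingleton (𝓞 L)⁰ (y : L) ≤ 1 ↔ IsIntegral ℤ (y : L) := by
    rw [FractionalIdeal.spanSingleton_le_iff_mem, h1]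
  have h3 (y : Lˣ) : FractionalIdeal.spanSingleton (𝓞 L)⁰ (y : L) = toPrincipalIdeal (𝓞 L) L y :=
    (coe_toPrincipalIdeal y).symm
  have h4 : x ∈ LinearMap.ker (principalHom L) ↔
      FractionalIdeal.spanSingleton (𝓞 L)⁰ ((x.toMul : Lˣ) : L) = 1 :=
    toPrincipalIdeal_eq_iff (I := 1)
  rw [h4, ← h2, ← h2, h3, h3, map_inv, Units.val_inv_eq_inv_val]
  refine ⟨fun h => by simp [h], fun h => le_antisymm h.1 ?_⟩
  calc (1 : FractionalIdeal (𝓞 L)⁰ L)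
      = (toPrincipalIdeal (𝓞 L) L x.toMul : FractionalIdeal (𝓞 L)⁰ L) *
        (toPrincipalIdeal (𝓞 L) L x.toMul : FractionalIdeal (𝓞 L)⁰ L)⁻¹ :=
        (mul_inv_cancel₀ (Units.ne_zero _)).symm
    _ ≤ _ := mul_le_of_le_one_right' h.2

theorem mem_range_unitsHom {M L : Type*} [Field M] [Field L] [Algebra M L] [CharZero L]
    {x : Additive Lˣ} :
    x ∈ LinearMap.range (unitsHom M L) ↔ IsIntegral ℤ ((x.toMul : Lˣ) : L) ∧
      IsIntegral ℤ (((x.toMul : Lˣ)⁻¹ : Lˣ) : L) ∧ ((x.toMul : Lˣ) : L) ∈ (algebraMap M L).range := by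
  constructor
  · rintro ⟨u, rfl⟩
    refine ⟨?_, ?_, u.toMul, ?_⟩
    · exact (RingOfIntegers.isIntegral_coe (u.toMul : 𝓞 M)).algebraMap (B := L)
    · exact (RingOfIntegers.isIntegral_coe ((u.toMul⁻¹ : (𝓞 M)ˣ) : 𝓞 M)).algebraMap (B := L)
    · rfl
  · rintro ⟨h1, h2, y, hy⟩
    have hy1 : IsIntegral ℤ y := by
      rwa [← isIntegral_algebraMap_iff (algebraMap M L).injective, hy]
    have hy2 : IsIntegral ℤ y⁻¹ := by
      rwa [← isIntegral_algebraMap_iff (algebraMap M L).injective, map_inv₀, hy,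
        ← Units.val_inv_eq_inv_val]
    have hy0 : y ≠ 0 := by
      rintro rfl
      exact Units.ne_zero _ (hy.symm.trans (map_zero _))
    refine ⟨Additive.ofMul ⟨⟨y, hy1⟩, ⟨y⁻¹, hy2⟩, ?_, ?_⟩, ?_⟩
    · exact RingOfIntegers.ext (mul_inv_cancel₀ hy0)
    · exact RingOfIntegers.ext (inv_mul_cancel₀ hy0)
    · exact congrArg Additive.ofMul (Units.ext hy)

theorem range_unitsHom_self (L : Type*) [Field L] [NumberField L] :
    LinearMap.range (unitsHom L L) = LinearMap.ker (principalHom L) := by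
  ext x
  rw [mem_range_unitsHom, mem_ker_principalHom]
  simp

theorem range_unitsHom_intermediateField {L : Type*} [Field L] [NumberField L] [IsGalois ℚ L]
    (M : IntermediateField ℚ L) : LinearMap.range (unitsHom M L) =
      LinearMap.ker (principalHom L) ⊓ Representation.invariants
        ((Representation.ofMulDistribMulAction Gal(L/ℚ) Lˣ).comp M.fixingSubgroup.subtype) := by
  ext x
  rw [mem_range_unitsHom, Submodule.mem_inf, mem_ker_principalHom, and_assoc]
  refine and_congr_right fun _ => and_congr_right fun _ => ?_
  rw [Representation.mem_invariants]
  have : ((x.toMul : Lˣ) : L) ∈ (algebraMap M L).range ↔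
      ((x.toMul : Lˣ) : L) ∈ IntermediateField.fixedField M.fixingSubgroup := by
    rw [IsGalois.fixedField_fixingSubgroup]
    exact ⟨fun ⟨y, hy⟩ => hy ▸ y.2, fun h => ⟨⟨_, h⟩, rfl⟩⟩
  rw [this, IntermediateField.mem_fixedField_iff]
  refine ⟨fun h g => congrArg Additive.ofMul (Units.ext (h g g.2)), fun h g hg => ?_⟩
  exact congrArg (fun z : Additive Lˣ => ((z.toMul : Lˣ) : L)) (h ⟨g, hg⟩)
theorem finrank_range_unitsHom_add_le {L : Type*} [Field L] [NumberField L] [IsTotallyReal L]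
    {K M K' : IntermediateField ℚ L} (hK : K' ≤ K) (hM : K' ≤ M) {q : ℕ}
    (hL : Module.finrank ℚ L = q * Module.finrank ℚ K)
    (hM' : Module.finrank ℚ M = q * Module.finrank ℚ K') :
    Module.finrank ℤ (LinearMap.range (unitsHom M L)) +
        q * Module.finrank ℤ (LinearMap.range (unitsHom K L)) ≤
      Module.finrank ℤ (LinearMap.range (unitsHom L L)) +
        q * Module.finrank ℤ ↥(LinearMap.range (unitsHom K L) ⊓ LinearMap.range (unitsHom M L)) := by
  have hK1 := finrank_range_unitsHom K L
  have hM1 := finrank_range_unitsHom M L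
  have hL1 := finrank_range_unitsHom L L
  have hK'1 := finrank_range_unitsHom K' L
  have hle (E : IntermediateField ℚ L) (hE : K' ≤ E) :
      LinearMap.range (unitsHom K' L) ≤ LinearMap.range (unitsHom E L) := by
    intro x
    rw [mem_range_unitsHom, mem_range_unitsHom]
    rintro ⟨h1, h2, y, hy⟩
    exact ⟨h1, h2, ⟨y, hE y.2⟩, hy⟩
  have hfin : Module.Finite ℤ
      ↥(LinearMap.range (unitsHom K L) ⊓ LinearMap.range (unitsHom M L)) :=
    Module.Finite.of_injective
      (Submodule.inclusion inf_le_left : _ →ₗ[ℤ] LinearMap.range (unitsHom K L))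
      (Submodule.inclusion_injective _)
  have h := Submodule.finrank_mono (le_inf (hle K hK) (hle M hM))
  have hq := Nat.mul_le_mul_left q h
  rw [← hK1] at hL
  rw [← hK'1] at hM'
  nlinarith

theorem eq_one_of_pow_eq_one_of_odd {L : Type*} [Field L] [NumberField L] [IsTotallyReal L]
    {p : ℕ} (hp : Odd p) {x : L} (hx : x ^ p = 1) : x = 1 := by
  obtain ⟨v⟩ : Nonempty (InfinitePlace L) := inferInstance
  let f := InfinitePlace.embedding_of_isReal (IsTotallyReal.isReal v)
  apply f.injective
  rw [map_one, ← hp.strictMono_pow.injective.eq_iff, one_pow, ← map_pow, hx, map_one]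

/-- Hilbert's theorem 90 for a cyclic subgroup of a Galois group. -/
theorem exists_eq_sub_of_sum_zpowers_eq_zero {L : Type} [Field L] [NumberField L] [IsGalois ℚ L]
    {σ : Gal(L/ℚ)} {n : ℕ} (hσ : orderOf σ = n) (x : Additive Lˣ)
    (hx : ∑ i ∈ Finset.range n, Representation.ofMulDistribMulAction Gal(L/ℚ) Lˣ (σ ^ i) x = 0) :
    ∃ y, x = y - Representation.ofMulDistribMulAction Gal(L/ℚ) Lˣ σ y := by
  let K := IntermediateField.fixedField (Subgroup.zpowers σ)
  have hK : K.fixingSubgroup = Subgroup.zpowers σ :=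
    IntermediateField.fixingSubgroup_fixedField _
  let e : Subgroup.zpowers σ ≃* Gal(L/K) :=
    (MulEquiv.subgroupCongr hK.symm).trans K.fixingSubgroupEquiv
  have hcyc : IsCyclic Gal(L/K) := isCyclic_of_surjective e.toMonoidHom e.surjective
  let g : Gal(L/K) := e ⟨σ, Subgroup.mem_zpowers σ⟩
  have hg (y : L) : g y = σ y := rfl
  have hgen (z : Gal(L/K)) : z ∈ Subgroup.zpowers g := by
    obtain ⟨⟨_, i, rfl⟩, rfl⟩ := e.surjective z
    exact ⟨i, (map_zpow e _ _).symm⟩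
  have hnorm : Algebra.norm K ((x.toMul : Lˣ) : L) = 1 := by
    apply (algebraMap K L).injective
    have hx' : ∏ i ∈ Finset.range n, (σ ^ i) ((x.toMul : Lˣ) : L) = 1 := by
      have := congrArg (fun z : Additive Lˣ => ((z.toMul : Lˣ) : L)) hx
      rw [toMul_sum, Units.coe_prod] at this
      exact this
    rw [Algebra.norm_eq_prod_automorphisms, map_one, ← hx', ← hσ,
      ← Fin.prod_univ_eq_prod_range fun i => (σ ^ i) ((x.toMul : Lˣ) : L)]
    exact (Fintype.prod_equiv ((finEquivZPowers (isOfFinOrder_of_finite σ)).trans e.toEquiv)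
      _ _ fun i => rfl).symm
  obtain ⟨y, hy⟩ := groupCohomology.exists_div_of_norm_eq_one hgen hnorm
  refine ⟨Additive.ofMul y, ?_⟩
  have hxy : x.toMul = y / σ • y := by
    ext
    rw [← hy, hg, Units.val_div_eq_div_val]
    rfl
  exact congrArg Additive.ofMul hxy
/-- An ideal invariant under `Gal(L/K)` comes from `K` up to an ideal invariant under `G`, provided
`G` fixes the primes containing `a` and the other primes are unramified over `K`. -/
theorem exists_eq_map_mul_of_forall_smul_eq {K L G : Type*} [Field K] [NumberField K] [Field L]
    [NumberField L] [Algebra K L] [IsGalois K L] [Group G] [MulSemiringAction G (𝓞 L)] {a : ℕ}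
    (hfix : ∀ P : Ideal (𝓞 L), P.IsMaximal → (a : 𝓞 L) ∈ P → ∀ g : G, g • P = P)
    (hunr : ∀ P : Ideal (𝓞 L), P.IsMaximal → (a : 𝓞 L) ∉ P → P.ramificationIdx (𝓞 K) = 1)
    (I : Ideal (𝓞 L)) (hI0 : I ≠ ⊥) (hI : ∀ γ : Gal(L/K), γ • I = I) :
    ∃ (A : Ideal (𝓞 K)) (C : Ideal (𝓞 L)), (∀ g : G, g • C = C) ∧
      I = A.map (algebraMap (𝓞 K) (𝓞 L)) * C := by
  induction I using WellFoundedGT.induction with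
  | ind I ih =>
  by_cases hItop : I = ⊤
  · exact ⟨⊤, ⊤, fun g => by rw [← Ideal.one_eq_top, smul_one], by simp [hItop, Ideal.map_top]⟩
  obtain ⟨P, hP, hIP⟩ := Ideal.exists_le_maximal I hItop
  have hP0 : P ≠ ⊥ := fun h => hI0 (le_bot_iff.mp (h ▸ hIP))
  set q := P.under (𝓞 K) with hq
  have hqm : q.IsMaximal := Ideal.IsMaximal.under (𝓞 K) P
  have hq0 : q ≠ ⊥ := Ideal.under_ne_bot (𝓞 K) hP0
  have hfin : (q.primesOver (𝓞 L)).Finite := Set.toFinite _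
  let s := hfin.toFinset
  have hs {Q : Ideal (𝓞 L)} : Q ∈ s ↔ Q.IsPrime ∧ Q.LiesOver q := hfin.mem_toFinset
  have hsm {Q : Ideal (𝓞 L)} (hQ : Q ∈ s) : Q.IsMaximal :=
    Ideal.isMaximal_of_mem_primesOver (hfin.mem_toFinset.mp hQ)
  have hPs : P ∈ s := hs.mpr ⟨hP.isPrime, ⟨rfl⟩⟩
  have ha (Q : Ideal (𝓞 L)) (hQ : Q ∈ s) : (a : 𝓞 L) ∈ Q ↔ (a : 𝓞 L) ∈ P := by
    have := (hs.mp hQ).2.over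
    rw [← map_natCast (algebraMap (𝓞 K) (𝓞 L)) a, ← Ideal.mem_comap, ← Ideal.mem_comap]
    change _ ∈ Q.under (𝓞 K) ↔ _ ∈ P.under (𝓞 K)
    rw [← this]
  have hJI : ∏ Q ∈ s, Q ∣ I := by
    refine Finset.prod_primes_dvd I (fun Q hQ => ?_) fun Q hQ => ?_
    · exact Ideal.prime_of_isPrime (Ideal.ne_bot_of_mem_primesOver hq0 (hfin.mem_toFinset.mp hQ))
        (hs.mp hQ).1
    · have := (hs.mp hQ).1
      have := (hs.mp hQ).2
      have := hP.isPrime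
      obtain ⟨γ, rfl⟩ := Ideal.exists_smul_eq_of_isGaloisGroup q P Q Gal(L/K)
      rw [Ideal.dvd_iff_le, ← hI γ]
      exact Ideal.pointwise_smul_le_pointwise_smul_iff.mpr hIP
  have hJγ (γ : Gal(L/K)) : γ • ∏ Q ∈ s, Q = ∏ Q ∈ s, Q := by
    rw [Finset.smul_prod']
    have hγ (γ : Gal(L/K)) {Q : Ideal (𝓞 L)} (hQ : Q ∈ s) : γ • Q ∈ s := by
      have := (hs.mp hQ).1
      have := (hs.mp hQ).2
      exact hs.mpr ⟨inferInstance, inferInstance⟩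
    exact Finset.prod_bij' (fun Q _ => γ • Q) (fun Q _ => γ⁻¹ • Q) (fun Q hQ => hγ γ hQ)
      (fun Q hQ => hγ γ⁻¹ hQ) (fun Q _ => inv_smul_smul γ Q) (fun Q _ => smul_inv_smul γ Q)
      fun Q _ => rfl
  have hJP : ∏ Q ∈ s, Q ≤ P := Ideal.dvd_iff_le.mp (Finset.dvd_prod_of_mem (fun Q => Q) hPs)
  obtain ⟨I', hI'⟩ := hJI
  have hJ0 : ∏ Q ∈ s, Q ≠ 0 := left_ne_zero_of_mul (hI' ▸ hI0)
  have hI'0 : I' ≠ 0 := right_ne_zero_of_mul (hI' ▸ hI0)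
  have hlt : I < I' := by
    refine lt_of_le_of_ne (hI' ▸ Ideal.mul_le_right) fun h => ?_
    rw [h] at hI'
    have := (right_eq_mul₀ hI'0).mp hI'
    rw [this, Ideal.one_eq_top, top_le_iff] at hJP
    exact hP.ne_top hJP
  obtain ⟨A, C, hC, hAC⟩ := ih I' hlt hI'0 fun γ => by
    have := hI γ
    rw [hI', smul_mul', hJγ] at this
    exact mul_left_cancel₀ hJ0 this
  by_cases haP : (a : 𝓞 L) ∈ P
  · refine ⟨A, (∏ Q ∈ s, Q) * C, fun g => ?_, by rw [hI', hAC, mul_left_comm]⟩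
    rw [smul_mul', hC, Finset.smul_prod']
    exact congrArg (· * C) (Finset.prod_congr rfl fun Q hQ => hfix Q (hsm hQ) ((ha Q hQ).mpr haP) g)
  · refine ⟨q * A, C, hC, ?_⟩
    rw [Ideal.map_mul, hI', hAC, mul_assoc, Ideal.map_algebraMap_eq_finsetProd_pow hq0]
    refine congrArg (· * _) (Finset.prod_congr (by ext; simp [s]) fun Q hQ => ?_)
    rw [hunr Q (hsm hQ) (mt (ha Q hQ).mp haP), pow_one]
theorem sum_fixingSubgroup_mem_range_principalHom {L : Type*} [Field L] [NumberField L]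
    [IsGalois ℚ L] (M : IntermediateField ℚ L) [Fintype M.fixingSubgroup] {p : ℕ}
    (hM : p.Coprime (Nat.card (ClassGroup (𝓞 M)))) (j : Additive (FractionalIdeal (𝓞 L)⁰ L)ˣ)
    (hj : p • j ∈ LinearMap.range (principalHom L)) :
    ∑ d : M.fixingSubgroup, fractionalIdealRep L d j ∈ LinearMap.range (principalHom L) := by
  obtain ⟨n, I, -, hI⟩ := exists_add_principalHom_eq_mk0 j
  have hIp : Submodule.IsPrincipal (((I ^ p : (Ideal (𝓞 L))⁰) : Ideal (𝓞 L))) := by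
    rw [← ofMul_mk0_mem_range_principalHom, map_pow, ofMul_pow, ← hI, nsmul_add]
    exact add_mem hj (Submodule.smul_of_tower_mem _ p ⟨n, rfl⟩)
  have hN : Submodule.IsPrincipal (Ideal.relNorm (𝓞 M) (I : Ideal (𝓞 L))) := by
    rw [Nat.card_eq_fintype_card] at hM
    refine Ideal.IsPrincipal.of_isPrincipal_pow_of_coprime hM ?_
    obtain ⟨x, hx⟩ := hIp
    rw [← map_pow, ← SubmonoidClass.coe_pow, hx, Ideal.submodule_span_eq, Ideal.relNorm_singleton]
    exact ⟨_, rfl⟩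
  have hne : (Ideal.relNorm (𝓞 M) (I : Ideal (𝓞 L))).map (algebraMap (𝓞 M) (𝓞 L)) ∈
      (Ideal (𝓞 L))⁰ := by
    refine mem_nonZeroDivisors_of_ne_zero ?_
    rw [Ideal.zero_eq_bot, Ne,
      Ideal.map_eq_bot_iff_of_injective (FaithfulSMul.algebraMap_injective (𝓞 M) (𝓞 L)),
      Ideal.relNorm_eq_bot_iff]
    exact nonZeroDivisors.coe_ne_zero I
  have hsum := sum_fractionalIdealRep_mk0 (J := ⟨_, hne⟩) Finset.univ
    (fun d : M.fixingSubgroup => (d : Gal(L/ℚ))) (prod_fixingSubgroup_smul M (I : Ideal (𝓞 L)))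
  rw [← hI] at hsum
  simp only [map_add, Finset.sum_add_distrib, ← principalHom_ofMulDistribMulAction] at hsum
  rw [eq_sub_of_add_eq hsum, ← map_sum]
  refine sub_mem ((ofMul_mk0_mem_range_principalHom _).mpr ?_) ⟨_, rfl⟩
  exact hN.map_ringHom _

theorem smul_eq_of_fractionalIdealRep_mk0_eq {L : Type*} [Field L] [NumberField L] {σ : Gal(L/ℚ)}
    {I : (Ideal (𝓞 L))⁰} (h : fractionalIdealRep L σ (Additive.ofMul (FractionalIdeal.mk0 L I)) =
      Additive.ofMul (FractionalIdeal.mk0 L I)) : σ • (I : Ideal (𝓞 L)) = I := by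
  have hne : σ • (I : Ideal (𝓞 L)) ∈ (Ideal (𝓞 L))⁰ := by
    refine mem_nonZeroDivisors_of_ne_zero fun h0 => nonZeroDivisors.coe_ne_zero I ?_
    rw [← inv_smul_smul σ (I : Ideal (𝓞 L)), h0, smul_zero]
  rw [fractionalIdealRep_ofMul, galFractionalIdeal_mk0 σ (J := ⟨_, hne⟩) rfl] at h
  have h2 := congrArg Units.val (Additive.ofMul.injective h)
  rw [FractionalIdeal.coe_mk0, FractionalIdeal.coe_mk0] at h2
  exact FractionalIdeal.coeIdeal_injective h2

/-- The class number of a subfield kills the class of an extended ideal. -/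
theorem exists_card_smul_mk0_map_eq_principalHom {K L : Type*} [Field K] [NumberField K] [Field L]
    [NumberField L] [Algebra K L] (A : Ideal (𝓞 K)) {B : (Ideal (𝓞 L))⁰}
    (hB : A.map (algebraMap (𝓞 K) (𝓞 L)) = B) :
    ∃ c : Lˣ, (c : L) ∈ (algebraMap K L).range ∧ Nat.card (ClassGroup (𝓞 K)) •
      Additive.ofMul (FractionalIdeal.mk0 L B) = principalHom L (Additive.ofMul c) := by
  have hA0 : A ≠ 0 := by
    rintro rfl
    refine nonZeroDivisors.coe_ne_zero B ?_
    rw [← hB, Ideal.zero_eq_bot, Ideal.map_bot, Ideal.zero_eq_bot]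
  have hA : A ∈ (Ideal (𝓞 K))⁰ := mem_nonZeroDivisors_of_ne_zero hA0
  obtain ⟨x, hx⟩ : Submodule.IsPrincipal (A ^ Nat.card (ClassGroup (𝓞 K))) := by
    rw [← ClassGroup.mk0_eq_one_iff (pow_mem hA _), ← SubmonoidClass.mk_pow, map_pow,
      pow_card_eq_one']
    exact hA
  have hx0 : algebraMap (𝓞 K) L x ≠ 0 := by
    rw [Ne, FaithfulSMul.algebraMap_eq_zero_iff]
    rintro rfl
    exact pow_ne_zero _ hA0 (hx.trans (by simp))
  refine ⟨Units.mk0 _ hx0, ⟨x, rfl⟩, ?_⟩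
  rw [← ofMul_pow, principalHom_ofMul]
  refine congrArg Additive.ofMul (Eq.symm (toPrincipalIdeal_eq_iff.mpr ?_))
  rw [Units.val_pow_eq_pow_val, FractionalIdeal.coe_mk0, ← FractionalIdeal.coeIdeal_pow, ← hB,
    ← Ideal.map_pow, hx, Ideal.submodule_span_eq, Ideal.map_span, Set.image_singleton,
    FractionalIdeal.coeIdeal_span_singleton]
  rfl

open scoped IsMulCommutative in
theorem exists_smul_sub_sum_eq_principalHom {L : Type*} [Field L] [NumberField L]
    [IsAbelianGalois ℚ L] (K : IntermediateField ℚ L) {σ : Gal(L/ℚ)}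
    (hσ : Subgroup.zpowers σ = K.fixingSubgroup) (D : Subgroup Gal(L/ℚ)) [Fintype D] {a : ℕ}
    (hfix : ∀ P : Ideal (𝓞 L), P.IsMaximal → (a : 𝓞 L) ∈ P → ∀ g : D, g • P = P)
    (hunr : ∀ P : Ideal (𝓞 L), P.IsMaximal → (a : 𝓞 L) ∉ P → P.ramificationIdx (𝓞 K) = 1)
    (j : Additive (FractionalIdeal (𝓞 L)⁰ L)ˣ) (hj : fractionalIdealRep L σ j = j) :
    ∃ b, Representation.ofMulDistribMulAction Gal(L/ℚ) Lˣ σ b = b ∧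
      Nat.card (ClassGroup (𝓞 K)) •
        (Fintype.card D • j - ∑ g : D, fractionalIdealRep L g j) = principalHom L b := by
  obtain ⟨n, I, hn, hI⟩ := exists_add_principalHom_eq_mk0 j
  have hσI : σ • (I : Ideal (𝓞 L)) = I := by
    apply smul_eq_of_fractionalIdealRep_mk0_eq
    rw [← hI, map_add, hj, ← principalHom_ofMulDistribMulAction, hn]
  have hinv : ∀ γ : Gal(L/K), γ • (I : Ideal (𝓞 L)) = I := by
    intro γ
    obtain ⟨⟨g, hg⟩, rfl⟩ := K.fixingSubgroupEquiv.surjective γ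
    rw [← hσ] at hg
    have : Subgroup.zpowers σ ≤ MulAction.stabilizer Gal(L/ℚ) (I : Ideal (𝓞 L)) := by
      rwa [Subgroup.zpowers_le]
    exact this hg
  obtain ⟨A, C, hC, hAC⟩ := exists_eq_map_mul_of_forall_smul_eq hfix hunr (I : Ideal (𝓞 L))
    (nonZeroDivisors.coe_ne_zero I) hinv
  have hAC0 : A.map (algebraMap (𝓞 K) (𝓞 L)) * C ≠ 0 := hAC ▸ nonZeroDivisors.coe_ne_zero I
  let A' : (Ideal (𝓞 L))⁰ := ⟨_, mem_nonZeroDivisors_of_ne_zero (left_ne_zero_of_mul hAC0)⟩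
  let C' : (Ideal (𝓞 L))⁰ := ⟨_, mem_nonZeroDivisors_of_ne_zero (right_ne_zero_of_mul hAC0)⟩
  have hIAC : I = A' * C' := Subtype.ext hAC
  have hC' (g : D) : fractionalIdealRep L g (Additive.ofMul (FractionalIdeal.mk0 L C')) =
      Additive.ofMul (FractionalIdeal.mk0 L C') := by
    rw [fractionalIdealRep_ofMul, galFractionalIdeal_mk0]
    exact hC g
  obtain ⟨c, hc, hc'⟩ : ∃ c, Representation.ofMulDistribMulAction Gal(L/ℚ) Lˣ σ c = c ∧
      Nat.card (ClassGroup (𝓞 K)) • Additive.ofMul (FractionalIdeal.mk0 L A') =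
        principalHom L c := by
    obtain ⟨c, ⟨y, hy⟩, hc⟩ := exists_card_smul_mk0_map_eq_principalHom A (B := A') rfl
    have hσK : σ ∈ K.fixingSubgroup := hσ ▸ Subgroup.mem_zpowers σ
    have hσc : σ • c = c := by
      ext
      change σ (c : L) = c
      rw [← hy]
      exact hσK y
    exact ⟨Additive.ofMul c, congrArg Additive.ofMul hσc, hc⟩
  let T := Representation.ofMulDistribMulAction Gal(L/ℚ) Lˣ
  have hj' : j = Additive.ofMul (FractionalIdeal.mk0 L A') +
      Additive.ofMul (FractionalIdeal.mk0 L C') - principalHom L n := by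
    rw [← ofMul_mul, ← map_mul, ← hIAC, ← hI, add_sub_cancel_right]
  refine ⟨Fintype.card D • c - ∑ g : D, T g c, ?_, ?_⟩
  · rw [map_sub, map_nsmul, hc, map_sum]
    refine congrArg _ (Finset.sum_congr rfl fun g _ => ?_)
    rw [← Module.End.mul_apply, ← map_mul, mul_comm, map_mul, Module.End.mul_apply, hc]
  · let Ψ : Module.End ℤ (Additive (FractionalIdeal (𝓞 L)⁰ L)ˣ) :=
      Fintype.card D • 1 - ∑ g : D, fractionalIdealRep L g
    have hΨ (x) : Ψ x = Fintype.card D • x - ∑ g : D, fractionalIdealRep L g x := by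
      simp only [Ψ, LinearMap.sub_apply, LinearMap.sum_apply]
      rfl
    have hΨ0 (x) (hx : ∀ g : D, fractionalIdealRep L g x = x) : Ψ x = 0 := by
      rw [hΨ, Finset.sum_congr rfl fun g _ => hx g, Finset.sum_const, Finset.card_univ, sub_self]
    rw [← hΨ, hj', map_sub, map_add, hΨ0 _ hC', hΨ0 (principalHom L n) fun g => by
      rw [← principalHom_ofMulDistribMulAction, hn], add_zero, sub_zero, ← map_nsmul, hc', hΨ,
      map_sub, map_nsmul, map_sum]
    simp only [T, principalHom_ofMulDistribMulAction]

/-- In an extension of degree prime to `p` the class number keeps the factor `p`. -/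
theorem dvd_card_classGroup_of_dvd_of_coprime {M L : Type*} [Field M] [NumberField M] [Field L]
    [NumberField L] [Algebra M L] {p : ℕ} (hp : p.Prime)
    (hd : (Module.finrank M L).Coprime p) (h : p ∣ Nat.card (ClassGroup (𝓞 M))) :
    p ∣ Nat.card (ClassGroup (𝓞 L)) := by
  have : Fact p.Prime := ⟨hp⟩
  by_contra hL
  obtain ⟨c, hc⟩ := exists_prime_orderOf_dvd_card' p h
  obtain ⟨⟨I, hI⟩, rfl⟩ := ClassGroup.mk0_surjective c
  have hprin (n : ℕ) : Submodule.IsPrincipal (I ^ n) ↔ p ∣ n := by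
    rw [← ClassGroup.mk0_eq_one_iff (pow_mem hI n), ← SubmonoidClass.mk_pow I hI, map_pow,
      ← orderOf_dvd_iff_pow_eq_one, hc]
  have hJ : Submodule.IsPrincipal (I.map (algebraMap (𝓞 M) (𝓞 L))) := by
    refine Ideal.IsPrincipal.of_isPrincipal_pow_of_coprime (n := p) ?_ ?_
    · rw [← Nat.card_eq_fintype_card]
      exact (Nat.Prime.coprime_iff_not_dvd hp).mpr hL
    · rw [← Ideal.map_pow]
      exact ((hprin p).mpr dvd_rfl).map_ringHom _
  obtain ⟨x, hx⟩ := hJ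
  have hN := Ideal.relNorm_algebraMap (𝓞 L) I
  rw [hx, Ideal.submodule_span_eq, Ideal.relNorm_singleton, ← IsFractionRing.finrank_eq (𝓞 M) M (𝓞 L) L] at hN
  have hdvd : p ∣ Module.finrank M L := (hprin _).mp ⟨_, hN.symm⟩
  exact hp.one_lt.ne' (Nat.dvd_one.mp (hd ▸ Nat.dvd_gcd hdvd dvd_rfl))

open scoped IsMulCommutative in
theorem dvd_card_classGroup_iff_of_fixingSubgroup {L : Type} [Field L] [NumberField L]
    [IsAbelianGalois ℚ L] [IsTotallyReal L] {p : ℕ} (hp : p.Prime) (hodd : Odd p) {m : ℕ}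
    {K K' M : IntermediateField ℚ L} (hK : K' ≤ K) (hM : K' ≤ M) {σ : Gal(L/ℚ)}
    (hσ : Subgroup.zpowers σ = K.fixingSubgroup)
    (hL : Module.finrank ℚ L = p ^ m * Module.finrank ℚ K)
    (hM' : Module.finrank ℚ M = p ^ m * Module.finrank ℚ K')
    (hd : (Module.finrank M L).Coprime p)
    (hfix : ∀ P : Ideal (𝓞 L), P.IsMaximal → (p : 𝓞 L) ∈ P → ∀ g : M.fixingSubgroup, g • P = P)
    (hunr : ∀ P : Ideal (𝓞 L), P.IsMaximal → (p : 𝓞 L) ∉ P → P.ramificationIdx (𝓞 K) = 1)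
    (hcl : ¬ p ∣ Nat.card (ClassGroup (𝓞 K))) :
    p ∣ Nat.card (ClassGroup (𝓞 L)) ↔ p ∣ Nat.card (ClassGroup (𝓞 M)) := by
  refine ⟨fun h => ?_, dvd_card_classGroup_of_dvd_of_coprime hp hd⟩
  by_contra hcM
  have : Fact p.Prime := ⟨hp⟩
  obtain ⟨c, hc⟩ := exists_prime_orderOf_dvd_card' p h
  obtain ⟨I, rfl⟩ := ClassGroup.mk0_surjective c
  have hI (n : ℕ) : n • Additive.ofMul (FractionalIdeal.mk0 L I) ∈
      LinearMap.range (principalHom L) ↔ p ∣ n := by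
    rw [← ofMul_pow, ← map_pow, ofMul_mk0_mem_range_principalHom, ← hc, orderOf_dvd_iff_pow_eq_one,
      ← map_pow, ← ClassGroup.mk0_eq_one_iff (I ^ n).2]
  refine hp.one_lt.ne' (Nat.dvd_one.mp ((hI 1).mp ?_))
  rw [one_smul]
  let iD : Fintype M.fixingSubgroup := Fintype.ofFinite _
  have hord : orderOf σ = p ^ m := by
    rw [← Nat.card_zpowers, hσ, IsGalois.card_fixingSubgroup_eq_finrank]
    refine Nat.eq_of_mul_eq_mul_right (Module.finrank_pos (R := ℚ) (M := K)) ?_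
    rw [← hL, mul_comm, Module.finrank_mul_finrank]
  have hfin : Module.Finite ℤ (LinearMap.ker (principalHom L)) := by
    rw [← range_unitsHom_self]
    infer_instance
  refine mem_range_of_prime_nsmul_mem_range_of_representation
    (Representation.ofMulDistribMulAction Gal(L/ℚ) Lˣ) (fractionalIdealRep L) (principalHom L)
    principalHom_ofMulDistribMulAction hp m (hord ▸ pow_orderOf_eq_one σ) M.fixingSubgroup
    ?_ (((Nat.Prime.coprime_iff_not_dvd hp).mpr hcl).symm)
    (exists_eq_sub_of_sum_zpowers_eq_zero hord)
    (exists_smul_sub_sum_eq_principalHom K hσ M.fixingSubgroup hfix hunr)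
    (sum_fixingSubgroup_mem_range_principalHom M ((Nat.Prime.coprime_iff_not_dvd hp).mpr hcM))
    (fun u _ hu => ?_) ?_ ((hI p).mpr dvd_rfl)
  · rwa [← Nat.card_eq_fintype_card, IsGalois.card_fixingSubgroup_eq_finrank]
  · have hu' : ((u.toMul : Lˣ) : L) ^ p = 1 :=
      congrArg (fun z : Additive Lˣ => ((z.toMul : Lˣ) : L)) hu
    exact congrArg Additive.ofMul (Units.ext (eq_one_of_pow_eq_one_of_odd hodd hu'))
  · rw [hσ, ← range_unitsHom_intermediateField, ← range_unitsHom_intermediateField]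
    have h3 : LinearMap.range (unitsHom K L) ⊓ Representation.invariants
        ((Representation.ofMulDistribMulAction Gal(L/ℚ) Lˣ).comp M.fixingSubgroup.subtype) =
        LinearMap.range (unitsHom K L) ⊓ LinearMap.range (unitsHom M L) := by
      rw [range_unitsHom_intermediateField, range_unitsHom_intermediateField, ← inf_inf_distrib_left,
        inf_assoc]
    rw [h3, ← range_unitsHom_self]
    exact finrank_range_unitsHom_add_le hK hM hL hM'

theorem Subgroup.eq_of_card_eq_of_isCyclic {G : Type*} [Group G] [Finite G] [IsCyclic G]
    {H K : Subgroup G} (h : Nat.card H = Nat.card K) : H = K := by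
  classical
  have := Fintype.ofFinite G
  have key (J : Subgroup G) : (J : Set G) = {x | x ^ Nat.card J = 1} := by
    refine Set.eq_of_subset_of_ncard_le (fun x hx ↦ congrArg Subtype.val
      (pow_card_eq_one' (x := (⟨x, hx⟩ : J)))) ?_ (Set.toFinite _)
    rw [Set.ncard_eq_toFinset_card', Set.toFinset_ofPred, ← Nat.card_coe_set_eq]
    exact IsCyclic.card_pow_eq_one_le Nat.card_pos
  exact SetLike.coe_injective (by rw [key H, key K, h])

theorem liesOver_span_natCast_of_mem {R : Type*} [CommRing R] [Nontrivial R] {p : ℕ}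
    (hp : p.Prime) {P : Ideal R} [hP : P.IsPrime] (h : (p : R) ∈ P) :
    P.LiesOver (Ideal.span {(p : ℤ)}) := by
  have : (Ideal.span {(p : ℤ)}).IsMaximal :=
    PrincipalIdealRing.isMaximal_of_irreducible (Nat.prime_iff_prime_int.mp hp).irreducible
  refine ⟨this.eq_of_le (hP.comap (algebraMap ℤ R)).ne_top ?_⟩
  rw [Ideal.span_singleton_le_iff_mem, Ideal.mem_comap]
  simpa using h

/-- In a cyclic extension of `ℚ`, a subfield whose degree is the number of primes above `p` is
the decomposition field of each of these primes. -/
theorem stabilizer_eq_fixingSubgroup_of_finrank_eq {K : Type*} [Field K] [NumberField K]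
    [IsGalois ℚ K] [IsCyclic Gal(K/ℚ)] {p : ℕ} (hp : p.Prime) {E : IntermediateField ℚ K}
    (hE : Module.finrank ℚ E = Nat.card {P : Ideal (𝓞 K) // P.IsMaximal ∧
      Ideal.comap (algebraMap ℤ (𝓞 K)) P = Ideal.span {(p : ℤ)}})
    {q : Ideal (𝓞 K)} (hq : q.IsPrime) (hpq : (p : 𝓞 K) ∈ q) :
    MulAction.stabilizer Gal(K/ℚ) q = E.fixingSubgroup := by
  have hmax : (Ideal.span {(p : ℤ)}).IsMaximal :=
    PrincipalIdealRing.isMaximal_of_irreducible (Nat.prime_iff_prime_int.mp hp).irreducible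
  have := liesOver_span_natCast_of_mem hp hpq
  apply Subgroup.eq_of_card_eq_of_isCyclic
  have hcount : (MulAction.stabilizer Gal(K/ℚ) q).index = E.fixingSubgroup.index := by
    rw [MulAction.index_stabilizer,
      Algebra.IsInvariant.orbit_eq_primesOver ℤ (𝓞 K) Gal(K/ℚ) (Ideal.span {(p : ℤ)}) q,
      ← IntermediateField.finrank_eq_fixingSubgroup_index, hE, ← Nat.card_coe_set_eq]
    refine Nat.card_congr (Equiv.subtypeEquivRight fun P ↦ ⟨fun h ↦ ?_, fun h ↦ ?_⟩)
    · have := h.1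
      have := h.2
      exact ⟨Ideal.IsMaximal.of_liesOver_isMaximal P (Ideal.span {(p : ℤ)}),
        (h.2.over).symm⟩
    · exact ⟨h.1.isPrime, ⟨h.2.symm⟩⟩
  have h1 := (MulAction.stabilizer Gal(K/ℚ) q).card_mul_index
  rw [← E.fixingSubgroup.card_mul_index, hcount] at h1
  exact Nat.eq_of_mul_eq_mul_right (Nat.pos_of_ne_zero Subgroup.index_ne_zero_of_finite) h1

/-- If `d` fixes the trace of a prime on the Galois subextension `K`, and the order of `d` is
prime to the degree of `L / K`, then `d` fixes the prime. -/
theorem smul_eq_of_smul_under_eq {L : Type*} [Field L] [NumberField L] [IsAbelianGalois ℚ L]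
    {K : IntermediateField ℚ L} {d : Gal(L/ℚ)} (hd : (orderOf d).Coprime (Module.finrank K L))
    {Q : Ideal (𝓞 L)} (hQ : Q.IsPrime) (h : (d • Q).under (𝓞 K) = Q.under (𝓞 K)) : d • Q = Q := by
  have : (d • Q).IsPrime := inferInstance
  obtain ⟨γ, hγ⟩ := Algebra.IsInvariant.exists_smul_of_under_eq (𝓞 K) (𝓞 L) Gal(L/K) Q (d • Q) h.symm
  let c : Gal(L/ℚ) := γ.restrictScalars ℚ
  have hc : c • Q = d • Q := hγ.symm
  have hcom : Commute c⁻¹ d := (mul_comm' _ _ : _)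
  have hmem : c⁻¹ * d ∈ MulAction.stabilizer Gal(L/ℚ) Q := by
    rw [MulAction.mem_stabilizer_iff, mul_smul, ← hc, inv_smul_smul]
  have hc1 : c ^ Module.finrank K L = 1 := by
    have : γ ^ Nat.card Gal(L/K) = 1 := pow_card_eq_one'
    rw [IsGalois.card_aut_eq_finrank] at this
    ext x
    have h2 (n : ℕ) : (c ^ n) x = (γ ^ n) x := by
      induction n generalizing x with
      | zero => rfl
      | succ n ih => rw [pow_succ, pow_succ, AlgEquiv.mul_apply, AlgEquiv.mul_apply, ih]; rfl
    rw [h2, this]; rfl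
  have hcop : (orderOf d).Coprime (orderOf c⁻¹) := by
    rw [orderOf_inv]
    exact hd.coprime_dvd_right (orderOf_dvd_of_pow_eq_one hc1)
  obtain ⟨k, hk⟩ := exists_pow_eq_self_of_coprime hcop
  have hpow := pow_mem hmem (orderOf d)
  rw [hcom.mul_pow, pow_orderOf_eq_one, mul_one] at hpow
  have hcQ := pow_mem hpow k
  rw [hk] at hcQ
  rw [← hc]
  exact inv_mem_iff.mp hcQ

theorem ramificationIdx_dvd_finrank {F L : Type*} [Field F] [NumberField F] [Field L]
    [NumberField L] [Algebra F L] [IsGalois F L] {Q : Ideal (𝓞 L)} (hQ : Q.IsMaximal) :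
    Q.ramificationIdx (𝓞 F) ∣ Module.finrank F L := by
  have : (Q.under (𝓞 F)).IsMaximal := inferInstance
  rw [← IsGalois.card_aut_eq_finrank,
    ← Ideal.ncard_primesOver_mul_ramificationIdxIn_mul_inertiaDegIn (Q.under (𝓞 F)) (𝓞 L) Gal(L/F),
    Ideal.ramificationIdxIn_eq_ramificationIdx (Q.under (𝓞 F)) Q Gal(L/F)]
  exact dvd_mul_of_dvd_right (dvd_mul_right _ _) _

theorem ramificationIdx_eq_one_of_coprime {L : Type*} [Field L] [NumberField L] [IsGalois ℚ L]
    {K P : IntermediateField ℚ L} (h : (Module.finrank K L).Coprime (Module.finrank P L))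
    [IsGalois K L] [IsGalois P L] {Q : Ideal (𝓞 L)} (hQ : Q.IsMaximal)
    (hP : (Q.under (𝓞 P)).ramificationIdx ℤ = 1) : Q.ramificationIdx (𝓞 K) = 1 := by
  have h1 := Ideal.ramificationIdx_tower (R := ℤ) (Q.under (𝓞 P)) Q
  have h2 := Ideal.ramificationIdx_tower (R := ℤ) (Q.under (𝓞 K)) Q
  rw [h1, hP, one_mul] at h2
  refine Nat.eq_one_of_dvd_coprimes h (ramificationIdx_dvd_finrank hQ) ?_
  exact (Dvd.intro_left _ h2.symm).trans (ramificationIdx_dvd_finrank hQ)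

theorem under_smul_eq_smul_restrictNormalHom {L : Type*} [Field L] [NumberField L]
    {K : IntermediateField ℚ L} [Normal ℚ K] (d : Gal(L/ℚ)) (Q : Ideal (𝓞 L)) :
    (d • Q).under (𝓞 K) = AlgEquiv.restrictNormalHom K d • Q.under (𝓞 K) := by
  ext x
  rw [Ideal.under_def, Ideal.mem_comap, Ideal.mem_pointwise_smul_iff_inv_smul_mem,
    Ideal.mem_pointwise_smul_iff_inv_smul_mem, Ideal.mem_comap, ← map_inv]
  have : d⁻¹ • algebraMap (𝓞 K) (𝓞 L) x =
      algebraMap (𝓞 K) (𝓞 L) (AlgEquiv.restrictNormalHom K d⁻¹ • x) := by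
    ext
    exact (AlgEquiv.restrictNormal_commutes d⁻¹ K (x : K)).symm
  rw [this]

theorem dvd_card_classGroup_iff_of_sup_eq_top {L : Type} [Field L] [NumberField L]
    [IsAbelianGalois ℚ L] [IsTotallyReal L] {p : ℕ} (hp : p.Prime) (hodd : Odd p) {m : ℕ}
    {K K' P : IntermediateField ℚ L} (hsup : K ⊔ P = ⊤) (hK' : K' ≤ K)
    (hP : Module.finrank ℚ P = p ^ m) (hK : (Module.finrank ℚ K).Coprime p)
    [IsCyclic Gal(K/ℚ)] [IsCyclic Gal(P/ℚ)]
    (hunr : ∀ Q : Ideal (𝓞 P), Q.IsMaximal → (p : 𝓞 P) ∉ Q → Q.ramificationIdx ℤ = 1)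
    (hdec : Module.finrank ℚ K' = Nat.card {Q : Ideal (𝓞 K) // Q.IsMaximal ∧
      Ideal.comap (algebraMap ℤ (𝓞 K)) Q = Ideal.span {(p : ℤ)}})
    (hcl : ¬ p ∣ Nat.card (ClassGroup (𝓞 K))) :
    p ∣ Nat.card (ClassGroup (𝓞 L)) ↔
      p ∣ Nat.card (ClassGroup (𝓞 (K' ⊔ P : IntermediateField ℚ L))) := by
  have hdvd : Module.finrank ℚ K' ∣ Module.finrank ℚ K :=
    IntermediateField.finrank_dvd_of_le_right hK'
  have hL : Module.finrank ℚ L = p ^ m * Module.finrank ℚ K := by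
    rw [← IntermediateField.finrank_top', ← hsup,
      (IntermediateField.LinearDisjoint.of_finrank_coprime (by rw [hP]; exact hK.pow_right m)
        : K.LinearDisjoint P).finrank_sup, hP, mul_comm]
  have hM' : Module.finrank ℚ (K' ⊔ P : IntermediateField ℚ L) = p ^ m * Module.finrank ℚ K' := by
    rw [(IntermediateField.LinearDisjoint.of_finrank_coprime (by
      rw [hP]; exact (hK.coprime_dvd_left hdvd).pow_right m) :
        K'.LinearDisjoint P).finrank_sup, hP, mul_comm]
  have hKL : Module.finrank K L = p ^ m := by
    have := Module.finrank_mul_finrank ℚ K L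
    rw [hL, mul_comm] at this
    exact Nat.eq_of_mul_eq_mul_right Module.finrank_pos this
  have hML : (Module.finrank (K' ⊔ P : IntermediateField ℚ L) L).Coprime p := by
    refine hK.coprime_dvd_left ⟨Module.finrank ℚ K', ?_⟩
    have := Module.finrank_mul_finrank ℚ (K' ⊔ P : IntermediateField ℚ L) L
    rw [hL, hM', mul_assoc] at this
    rw [mul_comm, Nat.eq_of_mul_eq_mul_left (pow_pos hp.pos m) this]
  have hPL : (Module.finrank P L).Coprime p := by
    have := Module.finrank_mul_finrank ℚ P L
    rw [hL, hP] at this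
    rwa [Nat.eq_of_mul_eq_mul_left (pow_pos hp.pos m) this]
  have hKab : IsAbelianGalois ℚ K := .of_algHom (algebraMap K L).toRatAlgHom
  have hPab : IsAbelianGalois ℚ P := .of_algHom (algebraMap P L).toRatAlgHom
  have hcyc : IsCyclic K.fixingSubgroup := by
    refine isCyclic_of_injective ((AlgEquiv.restrictNormalHom P).comp K.fixingSubgroup.subtype) ?_
    rw [injective_iff_map_eq_one]
    rintro ⟨g, hg⟩ h
    have hgP : g ∈ P.fixingSubgroup := by
      rw [← IntermediateField.restrictNormalHom_ker]
      exact h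
    have : g ∈ (K ⊔ P).fixingSubgroup := by
      rw [IntermediateField.fixingSubgroup_sup]
      exact ⟨hg, hgP⟩
    rw [hsup, IntermediateField.fixingSubgroup_top, Subgroup.mem_bot] at this
    exact Subtype.ext this
  obtain ⟨σ, hσ⟩ := (Subgroup.isCyclic_iff_exists_zpowers_eq_top _).mp hcyc
  refine dvd_card_classGroup_iff_of_fixingSubgroup hp hodd hK' le_sup_left hσ hL hM' hML ?_ ?_ hcl
  · rintro Q hQ hpQ ⟨d, hd⟩
    have hdeg : Module.finrank ℚ (IntermediateField.restrict hK') = Module.finrank ℚ K' :=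
      (IntermediateField.restrictAlgEquiv hK').toLinearEquiv.finrank_eq.symm
    refine smul_eq_of_smul_under_eq (K := K) ?_ hQ.isPrime ?_
    · rw [hKL]
      refine (hML.coprime_dvd_left ?_).pow_right m
      rw [← IsGalois.card_fixingSubgroup_eq_finrank]
      exact Subgroup.orderOf_dvd_natCard _ hd
    · rw [under_smul_eq_smul_restrictNormalHom, ← MulAction.mem_stabilizer_iff,
        stabilizer_eq_fixingSubgroup_of_finrank_eq hp (hdeg.trans hdec) inferInstance
          (by simpa [Ideal.under_def] using hpQ)]
      refine (IntermediateField.mem_fixingSubgroup_iff _ _).mpr fun x hx ↦ ?_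
      apply Subtype.ext
      have h1 : algebraMap K L (AlgEquiv.restrictNormalHom K d x) = d (algebraMap K L x) :=
        AlgEquiv.restrictNormal_commutes d K x
      refine h1.trans ((IntermediateField.mem_fixingSubgroup_iff _ _).mp hd _ ?_)
      exact (le_sup_left : K' ≤ K' ⊔ P) ((IntermediateField.mem_restrict hK' x).mp hx)
  · intro Q hQ hpQ
    refine ramificationIdx_eq_one_of_coprime (P := P) ?_ hQ (hunr _ inferInstance ?_)
    · rw [hKL]; exact (hPL.pow_right m).symm
    · simpa [Ideal.under_def] using hpQ

theorem ZMod.isCyclic_of_surjective_of_neg_one_eq_one {G : Type*} [Group G] {n : ℕ}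
    {f : (ZMod (2 ^ (n + 2)))ˣ →* G} (hf : Function.Surjective f) (h : f (-1) = 1) :
    IsCyclic G := by
  have hcop : Nat.Coprime 5 (2 ^ (n + 2)) := Nat.Coprime.pow_right _ (by norm_num)
  let u : (ZMod (2 ^ (n + 2)))ˣ := ZMod.unitOfCoprime 5 hcop
  have hu : orderOf u = 2 ^ n := by
    rw [← orderOf_units, ZMod.coe_unitOfCoprime]
    exact_mod_cast ZMod.orderOf_five n
  have hidx : (Subgroup.zpowers u).index = 2 := by
    have h1 := (Subgroup.zpowers u).card_mul_index
    rw [Nat.card_zpowers, hu, Nat.card_eq_fintype_card, ZMod.card_units_eq_totient,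
      Nat.totient_prime_pow Nat.prime_two (by lia), show n + 2 - 1 = n + 1 by lia] at h1
    exact Nat.eq_of_mul_eq_mul_left (pow_pos two_pos n) (h1.trans (by ring))
  have hneg : (-1 : (ZMod (2 ^ (n + 2)))ˣ) ∉ Subgroup.zpowers u := by
    have h4 : 4 ∣ 2 ^ (n + 2) := ⟨2 ^ n, by ring⟩
    have hu4 : ZMod.unitsMap h4 u = 1 := by
      ext
      rw [ZMod.unitsMap_val, ZMod.coe_unitOfCoprime, ZMod.cast_natCast h4]
      rfl
    rintro ⟨k, hk⟩
    have := congrArg (ZMod.unitsMap h4) hk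
    simp only [map_zpow, hu4, one_zpow] at this
    have h2 := congrArg Units.val this
    rw [ZMod.unitsMap_val, Units.val_neg, Units.val_one, Units.val_one,
      ← ZMod.castHom_apply (h := h4), map_neg, map_one] at h2
    exact absurd h2 (by decide)
  refine ⟨f u, fun g ↦ ?_⟩
  obtain ⟨v, rfl⟩ := hf g
  have hmem (w) (hw : w ∈ Subgroup.zpowers u) : f w ∈ Subgroup.zpowers (f u) := by
    obtain ⟨k, rfl⟩ := hw
    exact ⟨k, (map_zpow f u k).symm⟩
  by_cases hv : v ∈ Subgroup.zpowers u
  · exact hmem v hv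
  · have := hmem (-1 * v) (by rw [Subgroup.mul_mem_iff_of_index_two hidx]; tauto)
    rwa [map_mul, h, one_mul] at this

/-- Restriction of automorphisms between normal subfields. -/
theorem exists_surjective_restrict {E A : IntermediateField ℚ ℂ} (h : E ≤ A) [Normal ℚ E]
    [Normal ℚ A] : ∃ f : Gal(A/ℚ) →* Gal(E/ℚ), Function.Surjective f ∧
      ∀ (g : Gal(A/ℚ)) (x : E), (f g x : ℂ) = g ⟨x, h x.2⟩ := by
  let : Algebra E A := (IntermediateField.inclusion h).toRingHom.toAlgebra
  have : IsScalarTower ℚ E A := .of_algebraMap_eq' (Subsingleton.elim _ _)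
  refine ⟨AlgEquiv.restrictNormalHom E, AlgEquiv.restrictNormalHom_surjective A, fun g x ↦ ?_⟩
  exact congrArg Subtype.val (AlgEquiv.restrictNormal_commutes g E x)

theorem isCyclotomicExtension_adjoin {n : ℕ} [NeZero n] {ζ : ℂ} (hζ : IsPrimitiveRoot ζ n) :
    IsCyclotomicExtension {n} ℚ (IntermediateField.adjoin ℚ {ζ}) := by
  have hζint : IsIntegral ℚ ζ := (hζ.isIntegral (NeZero.pos n)).tower_top
  change IsCyclotomicExtension {n} ℚ (IntermediateField.adjoin ℚ {ζ}).toSubalgebra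
  rw [IntermediateField.adjoin_simple_toSubalgebra_of_isAlgebraic hζint.isAlgebraic]
  exact hζ.adjoin_isCyclotomicExtension ℚ

theorem isAbelianGalois_of_le_adjoin {n : ℕ} [NeZero n] {ζ : ℂ} (hζ : IsPrimitiveRoot ζ n)
    {E : IntermediateField ℚ ℂ} (hE : E ≤ IntermediateField.adjoin ℚ {ζ}) :
    IsAbelianGalois ℚ E := by
  have := isCyclotomicExtension_adjoin hζ
  have : IsAbelianGalois ℚ (IntermediateField.adjoin ℚ {ζ}) :=
    IsCyclotomicExtension.isAbelianGalois {n} ℚ _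
  exact .of_algHom (IntermediateField.inclusion hE).toRingHom.toRatAlgHom

theorem finiteDimensional_of_le_adjoin {n : ℕ} [NeZero n] {ζ : ℂ} (hζ : IsPrimitiveRoot ζ n)
    {E : IntermediateField ℚ ℂ} (hE : E ≤ IntermediateField.adjoin ℚ {ζ}) :
    FiniteDimensional ℚ E := by
  have := isCyclotomicExtension_adjoin hζ
  have := IsCyclotomicExtension.finiteDimensional {n} ℚ (IntermediateField.adjoin ℚ {ζ})
  exact .of_injective (IntermediateField.inclusion hE).toLinearMap
    (IntermediateField.inclusion hE).injective

theorem isCyclic_of_le_adjoin_of_odd {ℓ k : ℕ} (hℓ : ℓ.Prime) (hodd : Odd ℓ) {ζ : ℂ}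
    (hζ : IsPrimitiveRoot ζ (ℓ ^ k)) {E : IntermediateField ℚ ℂ}
    (hE : E ≤ IntermediateField.adjoin ℚ {ζ}) : IsCyclic Gal(E/ℚ) := by
  have : NeZero (ℓ ^ k) := ⟨(pow_pos hℓ.pos k).ne'⟩
  have := isCyclotomicExtension_adjoin hζ
  have := isAbelianGalois_of_le_adjoin hζ hE
  have := isAbelianGalois_of_le_adjoin hζ le_rfl
  obtain ⟨f, hf, -⟩ := exists_surjective_restrict hE
  have : IsCyclic (ZMod (ℓ ^ k))ˣ :=
    ZMod.isCyclic_units_of_prime_pow ℓ hℓ (by rintro rfl; revert hodd; decide) k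
  have : IsCyclic Gal(IntermediateField.adjoin ℚ {ζ}/ℚ) :=
    isCyclic_of_injective _ ((IsCyclotomicExtension.zeta_spec (ℓ ^ k) ℚ _).autToPow_injective ℚ)
  exact isCyclic_of_surjective f hf

theorem isCyclic_of_le_adjoin_of_real {k : ℕ} {ζ : ℂ} (hζ : IsPrimitiveRoot ζ (2 ^ (k + 2)))
    {E : IntermediateField ℚ ℂ} (hE : E ≤ IntermediateField.adjoin ℚ {ζ})
    (hreal : ∀ x ∈ E, starRingEnd ℂ x = x) : IsCyclic Gal(E/ℚ) := by
  have := isCyclotomicExtension_adjoin hζ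
  have := isAbelianGalois_of_le_adjoin hζ hE
  have := isAbelianGalois_of_le_adjoin hζ le_rfl
  obtain ⟨f, hf, hfx⟩ := exists_surjective_restrict hE
  let A := IntermediateField.adjoin ℚ {ζ}
  let e : Gal(A/ℚ) ≃* (ZMod (2 ^ (k + 2)))ˣ := IsCyclotomicExtension.autEquivPow A
    (Polynomial.cyclotomic.irreducible_rat (by positivity))
  let conj : ℂ ≃ₐ[ℚ] ℂ := Complex.conjAe.restrictScalars ℚ
  let c : Gal(A/ℚ) := conj.restrictNormal A
  have hcA (x : A) : (c x : ℂ) = starRingEnd ℂ x := conj.restrictNormal_commutes A x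
  have hec : e c = -1 := by
    set μ := IsCyclotomicExtension.zeta (2 ^ (k + 2)) ℚ A
    have hμ : IsPrimitiveRoot μ (2 ^ (k + 2)) := IsCyclotomicExtension.zeta_spec _ ℚ A
    have h1 : μ ^ (e c : ZMod (2 ^ (k + 2))).val = c μ := hμ.autToPow_spec ℚ c
    have h2 : c μ * μ = 1 := by
      ext
      have hn : ‖(μ : ℂ)‖ = 1 := by
        refine Complex.norm_eq_one_of_pow_eq_one (n := 2 ^ (k + 2)) ?_ (by positivity)
        exact congrArg Subtype.val hμ.pow_eq_one
      rw [MulMemClass.coe_mul, hcA, ← Complex.normSq_eq_conj_mul_self, Complex.normSq_eq_norm_sq, hn]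
      simp
    rw [← h1, ← pow_succ, hμ.pow_eq_one_iff_dvd, ← ZMod.natCast_eq_zero_iff] at h2
    ext
    rw [Nat.cast_add, ZMod.natCast_zmod_val, Nat.cast_one] at h2
    rw [Units.val_neg, Units.val_one, eq_neg_of_add_eq_zero_left h2]
  refine ZMod.isCyclic_of_surjective_of_neg_one_eq_one (f := f.comp e.symm.toMonoidHom)
    (hf.comp e.symm.surjective) ?_
  rw [← hec]
  change f (e.symm (e c)) = 1
  rw [e.symm_apply_apply]
  ext x
  rw [hfx, hcA, hreal _ x.2]; rfl

theorem isAbelianGalois_of_le {E C : IntermediateField ℚ ℂ} (h : E ≤ C) [IsAbelianGalois ℚ C] :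
    IsAbelianGalois ℚ E :=
  .of_algHom (IntermediateField.inclusion h).toRingHom.toRatAlgHom

theorem finiteDimensional_of_le {E C : IntermediateField ℚ ℂ} (h : E ≤ C)
    [FiniteDimensional ℚ C] : FiniteDimensional ℚ E :=
  .of_injective (IntermediateField.inclusion h).toLinearMap
    (IntermediateField.inclusion h).injective

theorem isCyclic_sup {A B : IntermediateField ℚ ℂ}
    [IsAbelianGalois ℚ (A ⊔ B : IntermediateField ℚ ℂ)]
    [FiniteDimensional ℚ A] [FiniteDimensional ℚ B] [IsCyclic Gal(A/ℚ)] [IsCyclic Gal(B/ℚ)]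
    (h : (Module.finrank ℚ A).Coprime (Module.finrank ℚ B)) :
    IsCyclic Gal((A ⊔ B : IntermediateField ℚ ℂ)/ℚ) := by
  have := isAbelianGalois_of_le (le_sup_left : A ≤ A ⊔ B)
  have := isAbelianGalois_of_le (le_sup_right : B ≤ A ⊔ B)
  obtain ⟨f, -, hf⟩ := exists_surjective_restrict (le_sup_left : A ≤ A ⊔ B)
  obtain ⟨g, -, hg⟩ := exists_surjective_restrict (le_sup_right : B ≤ A ⊔ B)
  have : IsCyclic (Gal(A/ℚ) × Gal(B/ℚ)) := by
    rw [Group.isCyclic_prod_iff, IsGalois.card_aut_eq_finrank, IsGalois.card_aut_eq_finrank]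
    exact ⟨inferInstance, inferInstance, h⟩
  refine isCyclic_of_injective (f.prod g) ?_
  rw [injective_iff_map_eq_one]
  intro s hs
  have hA (x : A) : (s ⟨x, le_sup_left (a := A) (b := B) x.2⟩ : ℂ) = x := by
    rw [← hf, show f s = 1 from congrArg Prod.fst hs]; rfl
  have hB (x : B) : (s ⟨x, le_sup_right (a := A) (b := B) x.2⟩ : ℂ) = x := by
    rw [← hg, show g s = 1 from congrArg Prod.snd hs]; rfl
  have hle : A ⊔ B ≤ IntermediateField.lift
      (IntermediateField.fixedField (Subgroup.zpowers s) : IntermediateField ℚ ↥(A ⊔ B)) := by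
    refine sup_le (fun x hx ↦ ?_) fun x hx ↦ ?_
    · refine (IntermediateField.mem_lift (⟨x, le_sup_left (a := A) (b := B) hx⟩ :
        ↥(A ⊔ B))).mpr fun ⟨f, hf⟩ ↦ ?_
      exact (Subgroup.zpowers_le.mpr (MulAction.mem_stabilizer_iff.mpr
        (Subtype.ext (hA ⟨x, hx⟩))) :
          _ ≤ MulAction.stabilizer Gal((A ⊔ B : IntermediateField ℚ ℂ)/ℚ) _) hf
    · refine (IntermediateField.mem_lift (⟨x, le_sup_right (a := A) (b := B) hx⟩ :
        ↥(A ⊔ B))).mpr fun ⟨f, hf⟩ ↦ ?_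
      exact (Subgroup.zpowers_le.mpr (MulAction.mem_stabilizer_iff.mpr
        (Subtype.ext (hB ⟨x, hx⟩))) :
          _ ≤ MulAction.stabilizer Gal((A ⊔ B : IntermediateField ℚ ℂ)/ℚ) _) hf
  ext x
  exact congrArg Subtype.val (((IntermediateField.mem_lift x).mp (hle x.2))
    ⟨s, Subgroup.mem_zpowers s⟩)

theorem isCyclic_iSup {ι : Type*} {S : Finset ι} {F : ι → IntermediateField ℚ ℂ}
    {C : IntermediateField ℚ ℂ} [IsAbelianGalois ℚ C] [FiniteDimensional ℚ C]
    (hF : ∀ i ∈ S, F i ≤ C) (hcyc : ∀ i ∈ S, IsCyclic Gal(F i/ℚ))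
    (hcop : ∀ i ∈ S, ∀ j ∈ S, i ≠ j →
      (Module.finrank ℚ (F i)).Coprime (Module.finrank ℚ (F j))) :
    Module.finrank ℚ (⨆ i ∈ S, F i : IntermediateField ℚ ℂ) = ∏ i ∈ S, Module.finrank ℚ (F i) ∧
      IsCyclic Gal((⨆ i ∈ S, F i : IntermediateField ℚ ℂ)/ℚ) := by
  classical
  induction S using Finset.induction_on with
  | empty =>
    have h0 : (⨆ i ∈ (∅ : Finset ι), F i) = ⊥ := by simp
    rw [h0]
    refine ⟨by simp, ?_⟩
    have : Subsingleton Gal((⊥ : IntermediateField ℚ ℂ)/ℚ) := by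
      refine ⟨fun f g ↦ AlgEquiv.ext fun x ↦ ?_⟩
      obtain ⟨q, hq⟩ := IntermediateField.mem_bot.mp x.2
      obtain rfl : x = algebraMap ℚ _ q := by
        ext; rw [← hq]; simp
      rw [AlgEquiv.commutes, AlgEquiv.commutes]
    infer_instance
  | insert a S ha ih =>
    obtain ⟨ih1, ih2⟩ := ih (fun i hi ↦ hF i (by simp [hi])) (fun i hi ↦ hcyc i (by simp [hi]))
      (fun i hi j hj ↦ hcop i (by simp [hi]) j (by simp [hj]))
    have hle : F a ⊔ ⨆ i ∈ S, F i ≤ C :=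
      sup_le (hF a (by simp)) (iSup₂_le fun i hi ↦ hF i (by simp [hi]))
    have := isAbelianGalois_of_le hle
    have := finiteDimensional_of_le (le_sup_left.trans hle)
    have := finiteDimensional_of_le (le_sup_right.trans hle)
    have := hcyc a (by simp)
    have hc : (Module.finrank ℚ (F a)).Coprime
        (Module.finrank ℚ (⨆ i ∈ S, F i : IntermediateField ℚ ℂ)) := by
      rw [ih1]
      exact Nat.Coprime.prod_right fun i hi ↦
        hcop a (by simp) i (by simp [hi]) (by rintro rfl; exact ha hi)
    rw [Finset.iSup_insert, Finset.prod_insert ha]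
    refine ⟨?_, isCyclic_sup hc⟩
    rw [(IntermediateField.LinearDisjoint.of_finrank_coprime hc).finrank_sup, ih1]

theorem isTotallyReal_of_forall_conj_eq {E : IntermediateField ℚ ℂ} [IsAbelianGalois ℚ E]
    (h : ∀ x ∈ E, starRingEnd ℂ x = x) : IsTotallyReal E where
  isReal v := by
    rw [InfinitePlace.isReal_iff, ComplexEmbedding.isReal_iff]
    ext x
    let φ : E →ₐ[ℚ] ℂ := v.embedding.toRatAlgHom
    have hN : Normal ℚ E := (inferInstance : IsAbelianGalois ℚ E).toIsGalois.to_normal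
    exact h _ ((@AlgHom.fieldRange_of_normal _ _ _ _ _ E hN φ).le ⟨x, rfl⟩)

theorem conj_eq_of_odd_finrank {E : IntermediateField ℚ ℂ} [IsAbelianGalois ℚ E]
    [FiniteDimensional ℚ E] (h : Odd (Module.finrank ℚ E)) :
    ∀ x ∈ E, starRingEnd ℂ x = x := by
  let conj : ℂ ≃ₐ[ℚ] ℂ := Complex.conjAe.restrictScalars ℚ
  let c : Gal(E/ℚ) := conj.restrictNormal E
  have hc (x : E) : (c x : ℂ) = starRingEnd ℂ x := conj.restrictNormal_commutes E x
  have h2 : c ^ 2 = 1 := by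
    ext x
    rw [pow_two, AlgEquiv.mul_apply, hc, hc, Complex.conj_conj]; rfl
  have h3 : c = 1 := by
    have hcard : c ^ Module.finrank ℚ E = 1 := by
      rw [← IsGalois.card_aut_eq_finrank]; exact pow_card_eq_one'
    rw [← orderOf_eq_one_iff]
    exact Nat.eq_one_of_dvd_coprimes (Nat.coprime_two_left.mpr h) (orderOf_dvd_of_pow_eq_one h2)
      (orderOf_dvd_of_pow_eq_one hcard)
  intro x hx
  rw [← hc ⟨x, hx⟩, h3]; rfl

/-- A subfield of `ℚ(ζ_{p^k})` is unramified away from `p`. -/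
theorem ramificationIdx_eq_one_of_cyclotomic {E A : Type*} [Field E] [NumberField E] [Field A]
    [NumberField A] [Algebra E A] {p k : ℕ} (hp : p.Prime) [IsCyclotomicExtension {p ^ k} ℚ A]
    {Q : Ideal (𝓞 E)} (hQ : Q.IsMaximal) (hpQ : (p : 𝓞 E) ∉ Q) :
    Q.ramificationIdx ℤ = 1 := by
  have : NeZero (p ^ k) := ⟨(pow_pos hp.pos k).ne'⟩
  obtain ⟨P, hP, hPQ⟩ := Ideal.exists_maximal_ideal_liesOver_of_isIntegral (S := 𝓞 A) Q
  obtain ⟨q, hq, hqQ⟩ : ∃ q : ℕ, q.Prime ∧ (q : 𝓞 E) ∈ Q := by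
    have : NeZero Q := ⟨Ring.ne_bot_of_isMaximal_of_not_isField hQ (RingOfIntegers.not_isField E)⟩
    exact ⟨_, Nat.absNorm_under_prime Q, by exact_mod_cast Int.absNorm_under_mem Q⟩
  have : Fact q.Prime := ⟨hq⟩
  have hqp : ¬ q ∣ p ^ k := by
    intro h
    rw [(Nat.prime_dvd_prime_iff_eq hq hp).mp (hq.dvd_of_dvd_pow h)] at hqQ
    exact hpQ hqQ
  have hqP : (q : 𝓞 A) ∈ P := by
    have := (Ideal.mem_of_liesOver P Q (q : 𝓞 E)).mp hqQ
    simpa using this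
  have := liesOver_span_natCast_of_mem hq hqP
  have h1 : P.ramificationIdx ℤ = 1 :=
    IsCyclotomicExtension.Rat.ramificationIdx_eq_of_not_dvd q A P hqp
  rw [Ideal.ramificationIdx_tower (R := ℤ) Q P] at h1
  exact Nat.eq_one_of_mul_eq_one_right h1

theorem card_classGroup_congr {E F : Type*} [Field E] [Field F] (e : E ≃+* F) :
    Nat.card (ClassGroup (𝓞 E)) = Nat.card (ClassGroup (𝓞 F)) :=
  Nat.card_congr (ClassGroup.mulEquiv (RingOfIntegers.mapRingEquiv e)).toEquiv

theorem isCyclic_gal_congr {E F : Type*} [Field E] [Field F] [Algebra ℚ E] [Algebra ℚ F]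
    (e : E ≃+* F) [IsCyclic Gal(E/ℚ)] : IsCyclic Gal(F/ℚ) :=
  (AlgEquiv.autCongr e.toRatAlgEquiv).isCyclic.mp inferInstance

theorem card_maximal_comap_eq_congr {R S : Type*} [CommRing R] [CommRing S] (e : R ≃+* S)
    (I : Ideal ℤ) :
    Nat.card {Q : Ideal S // Q.IsMaximal ∧ Ideal.comap (algebraMap ℤ S) Q = I} =
      Nat.card {Q : Ideal R // Q.IsMaximal ∧ Ideal.comap (algebraMap ℤ R) Q = I} := by
  refine Nat.card_congr (e.idealComapOrderIso.toEquiv.subtypeEquiv fun Q ↦ ?_)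
  have h1 : (Q.comap e).IsMaximal ↔ Q.IsMaximal := by
    refine ⟨fun h ↦ ?_, fun h ↦ Ideal.comap_isMaximal_of_equiv e⟩
    have := Ideal.comap_isMaximal_of_equiv e.symm (p := Q.comap e)
    rwa [show (Q.comap e).comap e.symm = Q by
      ext x; simp only [Ideal.mem_comap, RingEquiv.apply_symm_apply]] at this
  have h2 : Ideal.comap (algebraMap ℤ R) (Q.comap e) = Ideal.comap (algebraMap ℤ S) Q := by
    ext x
    simp [Ideal.mem_comap]
  change _ ↔ (Q.comap e).IsMaximal ∧ Ideal.comap (algebraMap ℤ R) (Q.comap e) = I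
  rw [h1, h2]

theorem IntermediateField.restrict_sup {k E : Type*} [Field k] [Field E] [Algebra k E]
    {A B C : IntermediateField k E} (hA : A ≤ C) (hB : B ≤ C) :
    IntermediateField.restrict (sup_le hA hB) =
      IntermediateField.restrict hA ⊔ IntermediateField.restrict hB := by
  apply IntermediateField.lift_injective
  rw [IntermediateField.lift_sup, IntermediateField.lift_restrict, IntermediateField.lift_restrict,
    IntermediateField.lift_restrict]

/-- The fixed field of complex conjugation, as an extension of `ℚ`. -/
noncomputable def conjFixed : IntermediateField ℚ ℂ :=
  IntermediateField.fixedField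
    (Subgroup.zpowers (Complex.conjAe.restrictScalars ℚ : ℂ ≃ₐ[ℚ] ℂ))

theorem mem_conjFixed {x : ℂ} : x ∈ conjFixed ↔ starRingEnd ℂ x = x := by
  refine ⟨fun h ↦ h ⟨_, Subgroup.mem_zpowers _⟩, fun h ⟨f, hf⟩ ↦ ?_⟩
  exact (Subgroup.zpowers_le.mpr (MulAction.mem_stabilizer_iff.mpr h) :
    _ ≤ MulAction.stabilizer (ℂ ≃ₐ[ℚ] ℂ) x) hf

theorem adjoin_le_adjoin_of_dvd {ζ ω : ℂ} {k n : ℕ} [NeZero n] (hζ : IsPrimitiveRoot ζ k)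
    (hω : IsPrimitiveRoot ω n) (h : k ∣ n) :
    IntermediateField.adjoin ℚ {ζ} ≤ IntermediateField.adjoin ℚ {ω} := by
  obtain ⟨i, -, rfl⟩ := hω.eq_pow_of_pow_eq_one ((hζ.pow_eq_one_iff_dvd n).mpr h)
  rw [IntermediateField.adjoin_simple_le_iff]
  exact pow_mem (IntermediateField.mem_adjoin_simple_self ℚ ω) i

theorem dvd_card_classGroup_sup_iff {C K K' P : IntermediateField ℚ ℂ} [IsAbelianGalois ℚ C]
    [FiniteDimensional ℚ C] {p : ℕ} (hp : p.Prime) (hodd : Odd p) {m k : ℕ} (hK'K : K' ≤ K)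
    (hKC : K ≤ C) (hPC : P ≤ C) (hKreal : ∀ x ∈ K, starRingEnd ℂ x = x)
    (hPreal : ∀ x ∈ P, starRingEnd ℂ x = x)
    (hP : Module.finrank ℚ P = p ^ m) (hK : (Module.finrank ℚ K).Coprime p)
    [IsCyclic Gal(K/ℚ)] [IsCyclic Gal(P/ℚ)]
    {ξ : ℂ} (hξ : IsPrimitiveRoot ξ (p ^ k)) (hPξ : P ≤ IntermediateField.adjoin ℚ {ξ})
    (hdec : Module.finrank ℚ K' = Nat.card {Q : Ideal (𝓞 K) // Q.IsMaximal ∧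
      Ideal.comap (algebraMap ℤ (𝓞 K)) Q = Ideal.span {(p : ℤ)}})
    (hcl : ¬ p ∣ Nat.card (ClassGroup (𝓞 K))) :
    p ∣ Nat.card (ClassGroup (𝓞 ↥(K ⊔ P))) ↔ p ∣ Nat.card (ClassGroup (𝓞 ↥(K' ⊔ P))) := by
  have hle : K ⊔ P ≤ C := sup_le hKC hPC
  have := isAbelianGalois_of_le hle
  have := finiteDimensional_of_le hle
  have : NumberField ↥(K ⊔ P) := ⟨⟩
  have : IsTotallyReal ↥(K ⊔ P) := isTotallyReal_of_forall_conj_eq fun x hx ↦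
    mem_conjFixed.mp ((sup_le (fun x hx ↦ mem_conjFixed.mpr (hKreal x hx))
      (fun x hx ↦ mem_conjFixed.mpr (hPreal x hx)) : K ⊔ P ≤ conjFixed) hx)
  have hK1 : K ≤ K ⊔ P := le_sup_left
  have hP1 : P ≤ K ⊔ P := le_sup_right
  have hK'1 : K' ≤ K ⊔ P := hK'K.trans hK1
  let eK := IntermediateField.restrictAlgEquiv hK1
  let eP := IntermediateField.restrictAlgEquiv hP1
  have hKP : IntermediateField.restrict hK1 ⊔ IntermediateField.restrict hP1 = ⊤ := by
    rw [← IntermediateField.restrict_sup, eq_top_iff]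
    exact fun x _ ↦ (IntermediateField.mem_restrict _ x).mpr x.2
  have hK'P : IntermediateField.restrict (sup_le hK'1 hP1) =
      IntermediateField.restrict hK'1 ⊔ IntermediateField.restrict hP1 :=
    IntermediateField.restrict_sup hK'1 hP1
  have : IsCyclic Gal(IntermediateField.restrict hK1/ℚ) := isCyclic_gal_congr eK.toRingEquiv
  have : IsCyclic Gal(IntermediateField.restrict hP1/ℚ) := isCyclic_gal_congr eP.toRingEquiv
  rw [card_classGroup_congr (IntermediateField.restrictAlgEquiv (sup_le hK'1 hP1)).toRingEquiv,
    hK'P]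
  refine dvd_card_classGroup_iff_of_sup_eq_top (m := m) hp hodd hKP ?_ ?_ ?_ ?_ ?_ ?_
  · exact fun x hx ↦ (IntermediateField.mem_restrict hK1 x).mpr
      (hK'K ((IntermediateField.mem_restrict hK'1 x).mp hx))
  · rw [← hP]
    exact eP.toLinearEquiv.finrank_eq.symm
  · exact (congrArg (Nat.Coprime · p) eK.toLinearEquiv.finrank_eq).mp hK
  · intro Q hQ hpQ
    let f : IntermediateField.restrict hP1 →+* IntermediateField.adjoin ℚ {ξ} :=
      (IntermediateField.inclusion hPξ).toRingHom.comp eP.symm.toRingEquiv.toRingHom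
    have : NeZero (p ^ k) := ⟨(pow_pos hp.pos k).ne'⟩
    have := isCyclotomicExtension_adjoin hξ
    have : NumberField (IntermediateField.adjoin ℚ {ξ}) :=
      IsCyclotomicExtension.numberField {p ^ k} ℚ _
    let := f.toAlgebra
    exact ramificationIdx_eq_one_of_cyclotomic (A := IntermediateField.adjoin ℚ {ξ}) (k := k)
      hp hQ hpQ
  · refine (IntermediateField.restrictAlgEquiv hK'1).toLinearEquiv.finrank_eq.symm.trans
      (hdec.trans ?_)
    exact (card_maximal_comap_eq_congr (RingOfIntegers.mapRingEquiv eK.toRingEquiv) _).symm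
  · exact fun h ↦ hcl ((card_classGroup_congr eK.toRingEquiv).symm ▸ h)

end

/-- Let `p` be an odd prime, `N ≥ 2` with `p ∤ N`, and `K = ℚ(N)` the degree-`N` layer of the
cyclotomic `Ẑ`-extension of `ℚ`, realized inside `ℂ` as the compositum of the layers
`ℚ(ℓ^{n_ℓ})` (the unique totally real subfield of degree `ℓ^{n_ℓ}` of `ℚ(ζ_{ℓ^{n_ℓ+2}})`)
over the prime factors `ℓ` of `N`.  Let `g` be the number of primes of `𝒪_K` above `p` and
`K'` the decomposition field of `p` in `K/ℚ`, i.e. the unique subfield of `K` of degree `g`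
over `ℚ`.  If `p` does not divide the class number of `K`, then for every `m ≥ 0`,
`p` divides the class number of `K·ℚ(pᵐ)` iff `p` divides the class number of `K'·ℚ(pᵐ)`. -/
theorem dvd_classNumber_compositum_iff_decomposition_field
    (p : ℕ) (hp : p.Prime) (hpodd : Odd p)
    (N : ℕ) (hN : 2 ≤ N) (hpN : ¬ p ∣ N)
    -- the layers `F ℓ = ℚ(ℓ^{n_ℓ})` for the prime factors `ℓ` of `N`
    (F : ℕ → IntermediateField ℚ ℂ)
    (hF : ∀ ℓ ∈ N.primeFactors, ∃ ζ : ℂ,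
      IsPrimitiveRoot ζ (ℓ ^ (N.factorization ℓ + 2)) ∧
      F ℓ ≤ IntermediateField.adjoin ℚ {ζ} ∧
      Module.finrank ℚ (F ℓ) = ℓ ^ (N.factorization ℓ) ∧
      (∀ x ∈ F ℓ, (starRingEnd ℂ) x = x))
    -- `K = ℚ(N)` is the compositum of the layers
    (K : IntermediateField ℚ ℂ) (hK : K = ⨆ ℓ ∈ N.primeFactors, F ℓ)
    -- `g` is the number of primes of `𝒪_K` lying above `p`
    (g : ℕ)
    (hg : g = Nat.card {P : Ideal (𝓞 K) // P.IsMaximal ∧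
      Ideal.comap (algebraMap ℤ (𝓞 K)) P = Ideal.span {(p : ℤ)}})
    -- `K'` is the decomposition field of `p` in `K/ℚ`
    (K' : IntermediateField ℚ ℂ) (hK'le : K' ≤ K) (hK'deg : Module.finrank ℚ K' = g)
    -- `p` does not divide the class number of `K`
    (hclK : ¬ p ∣ Nat.card (ClassGroup (𝓞 K))) :
    ∀ (m : ℕ) (Pm : IntermediateField ℚ ℂ) (ξ : ℂ),
      IsPrimitiveRoot ξ (p ^ (m + 2)) →
      Pm ≤ IntermediateField.adjoin ℚ {ξ} →
      Module.finrank ℚ Pm = p ^ m →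
      (p ∣ Nat.card (ClassGroup (𝓞 ↥(K ⊔ Pm))) ↔
        p ∣ Nat.card (ClassGroup (𝓞 ↥(K' ⊔ Pm)))) := by
  intro m Pm ξ hξ hPξ hPm
  have hprime {ℓ : ℕ} (h : ℓ ∈ N.primeFactors) : ℓ.Prime := Nat.prime_of_mem_primeFactors h
  let n := (∏ ℓ ∈ N.primeFactors, ℓ ^ (N.factorization ℓ + 2)) * p ^ (m + 2)
  have hn0 : n ≠ 0 := mul_ne_zero
    (Finset.prod_ne_zero_iff.mpr fun ℓ h ↦ pow_ne_zero _ (hprime h).ne_zero)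
    (pow_ne_zero _ hp.ne_zero)
  have : NeZero n := ⟨hn0⟩
  have hω := Complex.isPrimitiveRoot_exp n hn0
  set ω := Complex.exp (2 * Real.pi * Complex.I / n)
  have := isAbelianGalois_of_le_adjoin hω le_rfl
  have := finiteDimensional_of_le_adjoin hω le_rfl
  have hFC : ∀ ℓ ∈ N.primeFactors, F ℓ ≤ IntermediateField.adjoin ℚ {ω} := fun ℓ h ↦ by
    obtain ⟨ζ, hζ, hle, -, -⟩ := hF ℓ h
    exact hle.trans (adjoin_le_adjoin_of_dvd hζ hω
      ((Finset.dvd_prod_of_mem (fun ℓ ↦ ℓ ^ (N.factorization ℓ + 2)) h).mul_right _))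
  have hPC : Pm ≤ IntermediateField.adjoin ℚ {ω} :=
    hPξ.trans (adjoin_le_adjoin_of_dvd hξ hω (Dvd.intro_left _ rfl))
  have hcyc : ∀ ℓ ∈ N.primeFactors, IsCyclic Gal(F ℓ/ℚ) := fun ℓ h ↦ by
    obtain ⟨ζ, hζ, hle, -, hreal⟩ := hF ℓ h
    rcases (hprime h).eq_two_or_odd' with rfl | hodd
    · exact isCyclic_of_le_adjoin_of_real hζ hle hreal
    · exact isCyclic_of_le_adjoin_of_odd (hprime h) hodd hζ hle
  have hdeg : ∀ ℓ ∈ N.primeFactors, Module.finrank ℚ (F ℓ) = ℓ ^ N.factorization ℓ :=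
    fun ℓ h ↦ (hF ℓ h).choose_spec.2.2.1
  obtain ⟨hKdeg, hKcyc⟩ := isCyclic_iSup hFC hcyc fun i hi j hj hij ↦ by
    rw [hdeg i hi, hdeg j hj]
    exact Nat.Coprime.pow _ _ ((Nat.coprime_primes (hprime hi) (hprime hj)).mpr hij)
  rw [← hK] at hKdeg hKcyc
  have hKN : Module.finrank ℚ K = N := by
    rw [hKdeg, Finset.prod_congr rfl hdeg]
    exact Nat.prod_factorization_pow_eq_self (by lia)
  have hKreal : K ≤ conjFixed := by
    rw [hK]
    refine iSup₂_le fun ℓ h x hx ↦ mem_conjFixed.mpr ?_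
    exact (hF ℓ h).choose_spec.2.2.2 x hx
  have := isAbelianGalois_of_le hPC
  have := finiteDimensional_of_le hPC
  have := isCyclic_of_le_adjoin_of_odd hp hpodd hξ hPξ
  refine dvd_card_classGroup_sup_iff hp hpodd hK'le ?_ hPC
    (fun x hx ↦ mem_conjFixed.mp (hKreal hx))
    (conj_eq_of_odd_finrank (by rw [hPm]; exact hpodd.pow)) hPm ?_ hξ hPξ (hK'deg.trans hg) hclK
  · rw [hK]
    exact iSup₂_le hFC
  · rw [hKN]
    exact ((Nat.Prime.coprime_iff_not_dvd hp).mpr hpN).symm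
end
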